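/- Fix α ∈ (1/2, ln 3/ln 2 − 1) and let ζ = 1 − 2(2^α − 1) > 0. There exist θ₀ = θ₀(α) > 0, β₀ = β₀(α) > 0 (and a sufficiently large value of J(1), depending on α) such that for every 0 < θ ≤ θ₀, every β ≥ β₀, and every finite set Λ ⊂ ℤ with 0 ∈ Λ, with probability at least 1 − 2e^{−b̄/200} over the random field one has simultaneously μ⁺_Λ(σ₀ = +1) > 1 − e^{−b̄/200} and μ⁻_Λ(σ₀ = −1) > 1 − e^{−b̄/200}, where b̄ = min(βζ/4, ζ²/(2¹⁰θ²)). (This uses that, since the field is symmetric, the joint spin–field flip σ ↦ −σ, h ↦ −h maps the + boundary condition Gibbs measure to the − boundary condition one in distribution.) -/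

import Mathlib

open scoped BigOperators Classical

noncomputable section

/-- The spin value associated to a Boolean: `true ↦ +1`, `false ↦ -1`. -/
def spin (b : Bool) : ℝ := if b then 1 else -1

/-- The pair coupling: `J(1) = J₁` (a large constant) and `J(n) = n^{-(2-α)}` for `n ≥ 2`. -/
def Jcoup (J₁ α : ℝ) (n : ℕ) : ℝ := if n = 1 then J₁ else (n : ℝ) ^ (α - 2)

/-- The Hamiltonian in the finite volume `Λ ⊂ ℤ` with homogeneous boundary condition `τ`,
random field `h` and field strength `θ`:
`H^τ(σ) = (1/2) Σ_{i≠j∈Λ} J(|i-j|)(1-σᵢσⱼ) + Σ_{i∈Λ} Σ_{j∉Λ} J(|i-j|)(1-τσᵢ) - θ Σ_{i∈Λ} hᵢσᵢ`. -/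
def Ham (J₁ α θ τ : ℝ) (Λ : Finset ℤ) (h : ℤ → ℝ) (σ : Λ → Bool) : ℝ :=
  (1 / 2) * ∑ i : Λ, ∑ j : Λ, (if i = j then 0 else
      Jcoup J₁ α ((i : ℤ) - (j : ℤ)).natAbs * (1 - spin (σ i) * spin (σ j)))
  + ∑ i : Λ, (∑' j : ℤ, if j ∈ Λ then 0 else Jcoup J₁ α ((i : ℤ) - j).natAbs)
      * (1 - τ * spin (σ i))
  - θ * ∑ i : Λ, h (i : ℤ) * spin (σ i)

/-- The finite volume Gibbs probability of an event `E` at inverse temperature `β`,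
with boundary condition `τ`. -/
def gibbs (J₁ α θ τ β : ℝ) (Λ : Finset ℤ) (h : ℤ → ℝ) (E : (Λ → Bool) → Prop) : ℝ :=
  (∑ σ : Λ → Bool, if E σ then Real.exp (-β * Ham J₁ α θ τ Λ h σ) else 0) /
    ∑ σ : Λ → Bool, Real.exp (-β * Ham J₁ α θ τ Λ h σ)

/-- Expectation over the i.i.d. symmetric `±1` random field (only its restriction to `Λ`
matters, so it is an average over the `2^|Λ|` field configurations in `Λ`). -/
def fieldE (Λ : Finset ℤ) (f : (ℤ → ℝ) → ℝ) : ℝ :=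
  (1 / 2 ^ Λ.card) *
    ∑ η : Λ → Bool, f (fun i => if hi : i ∈ Λ then spin (η ⟨i, hi⟩) else 1)

namespace LR
open scoped symmDiff ENNReal

/-- `S` separates `i` and `j`. -/
def sep (S : Finset ℤ) (i j : ℤ) : Prop := ¬ (i ∈ S ↔ j ∈ S)

/-- window size attached to a set -/
def ww (S : Finset ℤ) : ℕ := 32 * S.card ^ 3

/-- thick hull of `S` -/
def InT (S : Finset ℤ) (i : ℤ) : Prop :=
  ∃ a ∈ S, ∃ b ∈ S, a - 4 * (ww S : ℤ) ≤ i ∧ i ≤ b + 4 * (ww S : ℤ)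

/-- `S` is constant on the thick hull of `B` -/
def Flat (S B : Finset ℤ) : Prop := ∀ i j, InT B i → InT B j → ¬ sep S i j

/-- `B` is an isolated defect of `C` -/
def Isol (B C : Finset ℤ) : Prop := B.Nonempty ∧ Flat (C ∆ B) B

/-- irreducible sets -/
def Irred (B : Finset ℤ) : Prop := B.Nonempty ∧ ∀ C, Isol C B → C = B

/-- walls of `S` -/
def bd (S : Finset ℤ) : Finset ℤ := (S ∪ S.image (· + 1)).filter (fun i => sep S (i - 1) i)

lemma mem_bd {S : Finset ℤ} {i : ℤ} : i ∈ bd S ↔ sep S (i - 1) i := by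
  unfold bd
  rw [Finset.mem_filter]
  constructor
  · exact fun h => h.2
  · intro h
    refine ⟨?_, h⟩
    by_cases hi : i ∈ S
    · simp [hi]
    · have : i - 1 ∈ S := by
        unfold sep at h; tauto
      rw [Finset.mem_union, Finset.mem_image]
      right
      exact ⟨i - 1, this, by ring⟩

lemma sep_comm {S : Finset ℤ} {i j : ℤ} : sep S i j ↔ sep S j i := by unfold sep; tauto

lemma sep_symmDiff {S U : Finset ℤ} {i j : ℤ} :
    sep (S ∆ U) i j ↔ ¬ (sep S i j ↔ sep U i j) := by
  simp only [sep, Finset.mem_symmDiff]; tauto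

lemma not_sep_self {S : Finset ℤ} {i : ℤ} : ¬ sep S i i := by simp [sep]

lemma exists_wall {S : Finset ℤ} {i : ℤ} (n : ℕ) (h : sep S i (i + n)) :
    ∃ d ∈ bd S, i < d ∧ d ≤ i + n := by
  induction n with
  | zero => simp [sep] at h
  | succ n ih =>
    by_cases h1 : sep S i (i + n)
    · obtain ⟨d, hd, h2, h3⟩ := ih h1
      exact ⟨d, hd, h2, by push_cast; omega⟩
    · refine ⟨i + (n + 1 : ℕ), ?_, by push_cast; omega, le_refl _⟩
      rw [mem_bd]
      have : i + ((n + 1 : ℕ) : ℤ) - 1 = i + n := by push_cast; ring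
      rw [this]
      unfold sep at *; tauto

lemma exists_wall' {S : Finset ℤ} {i j : ℤ} (hij : i ≤ j) (h : sep S i j) :
    ∃ d ∈ bd S, i < d ∧ d ≤ j := by
  obtain ⟨n, hn⟩ := Int.le.dest hij
  subst hn
  exact exists_wall n h

lemma InT_conv {B : Finset ℤ} {i j k : ℤ} (hi : InT B i) (hk : InT B k) (h1 : i ≤ j) (h2 : j ≤ k) :
    InT B j := by
  obtain ⟨a, ha, b, hb, h3, h4⟩ := hi
  obtain ⟨a', ha', b', hb', h3', h4'⟩ := hk
  exact ⟨a, ha, b', hb', by omega, by omega⟩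

lemma Flat_of_bd {S C B : Finset ℤ} (h : bd S ⊆ bd C) (hC : Flat C B) : Flat S B := by
  have key : ∀ i j, i ≤ j → InT B i → InT B j → ¬ sep S i j := by
    intro i j hij hi hj hs
    obtain ⟨d, hd, h1, h2⟩ := exists_wall' hij hs
    have := mem_bd.1 (h hd)
    exact hC (d - 1) d (InT_conv hi hj (by omega) (by omega)) (InT_conv hi hj (by omega) h2) this
  intro i j hi hj
  rcases le_total i j with hij | hij
  · exact key i j hij hi hj
  · rw [sep_comm]; exact key j i hij hj hi

lemma card_lt_ww {B : Finset ℤ} (hB : B.Nonempty) : B.card < ww B ∧ 32 ≤ ww B := by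
  have h : 1 ≤ B.card := hB.card_pos
  unfold ww
  have : B.card ≤ B.card ^ 3 := Nat.le_self_pow (by norm_num) _
  constructor <;> omega

lemma InT_near {B : Finset ℤ} {b i : ℤ} (hb : b ∈ B) (h : |i - b| ≤ 4 * (ww B : ℤ)) : InT B i := by
  rw [abs_le] at h
  exact ⟨b, hb, b, hb, by omega, by omega⟩

lemma InT_self {B : Finset ℤ} {b : ℤ} (hb : b ∈ B) : InT B b :=
  InT_near hb (by simp)

lemma bd_InT {B : Finset ℤ} {d : ℤ} (hd : d ∈ bd B) : InT B (d - 1) ∧ InT B d := by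
  rw [mem_bd] at hd
  have : (d - 1 ∈ B) ∨ d ∈ B := by unfold sep at hd; tauto
  rcases this with h | h
  · have := card_lt_ww ⟨_, h⟩
    exact ⟨InT_self h, InT_near h (by rw [abs_le]; constructor <;> omega)⟩
  · have := card_lt_ww ⟨_, h⟩
    exact ⟨InT_near h (by rw [abs_le]; constructor <;> omega), InT_self h⟩

lemma Isol.bd_sub {B C : Finset ℤ} (h : Isol B C) : bd (C ∆ B) ⊆ bd C := by
  intro d hd
  by_cases hB : d ∈ bd B
  · exact absurd (mem_bd.1 hd) (h.2 _ _ (bd_InT hB).1 (bd_InT hB).2)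
  · rw [mem_bd] at *
    rw [sep_symmDiff] at hd
    exact by_contra fun hh => hd (iff_of_false hh hB)

lemma Isol.bd_sub' {B C : Finset ℤ} (h : Isol B C) : bd B ⊆ bd C := by
  intro d hd
  have h1 := (h.2 _ _ (bd_InT hd).1 (bd_InT hd).2)
  rw [mem_bd] at *
  rw [sep_symmDiff] at h1
  exact (not_not.1 h1).2 hd

lemma bd_nonempty {B : Finset ℤ} (h : B.Nonempty) : (bd B).Nonempty := by
  refine ⟨B.min' h, ?_⟩
  rw [mem_bd]
  have h1 := B.min'_mem h
  have h2 : B.min' h - 1 ∉ B := by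
    intro h3
    have := B.min'_le _ h3
    omega
  unfold sep; tauto

lemma Isol.bd_lt {B C : Finset ℤ} (h : Isol B C) : (bd (C ∆ B)).card < (bd C).card := by
  apply Finset.card_lt_card
  rw [Finset.ssubset_iff_of_subset h.bd_sub]
  obtain ⟨d, hd⟩ := bd_nonempty h.1
  refine ⟨d, h.bd_sub' hd, ?_⟩
  intro h3
  exact h.2 _ _ (bd_InT hd).1 (bd_InT hd).2 (mem_bd.1 h3)

/-- if a set contains the thick hull minus B, it is larger than B and its hull contains that of B -/
lemma Isol.cases {B C : Finset ℤ} (h : Isol B C) :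
    (B ⊆ C) ∨ ((∀ a ∈ B, ∃ a' ∈ C, a' ≤ a) ∧ (∀ a ∈ B, ∃ a' ∈ C, a ≤ a') ∧ B.card < C.card) := by
  obtain ⟨hne, hf⟩ := h
  have hw := card_lt_ww hne
  by_cases hc : B ⊆ C
  · exact Or.inl hc
  right
  obtain ⟨x, hx, hxC⟩ := Finset.not_subset.1 hc
  have hall : ∀ i, InT B i → i ∉ B → i ∈ C := by
    intro i hi hiB
    have := hf x i (InT_self hx) hi
    unfold sep at this
    simp only [Finset.mem_symmDiff] at this
    tauto
  have hm := B.min'_mem hne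
  have hM := B.max'_mem hne
  have h1 : ∀ k : ℤ, 1 ≤ k → k ≤ ww B → B.min' hne - k ∈ C := by
    intro k hk1 hk2
    apply hall
    · exact InT_near hm (by rw [abs_le]; constructor <;> omega)
    · intro hh
      have := B.min'_le _ hh
      omega
  refine ⟨?_, ?_, ?_⟩
  · intro a ha
    refine ⟨B.min' hne - 1, h1 1 (by norm_num) (by omega), ?_⟩
    have := B.min'_le _ ha
    omega
  · intro a ha
    refine ⟨B.max' hne + 1, ?_, ?_⟩
    · apply hall
      · exact InT_near hM (by rw [abs_le]; constructor <;> omega)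
      · intro hh
        have := B.le_max' _ hh
        omega
    · have := B.le_max' _ ha
      omega
  · have hsub : (Finset.Icc (B.min' hne - ww B) (B.min' hne - 1)) ⊆ C := by
      intro y hy
      rw [Finset.mem_Icc] at hy
      have := h1 (B.min' hne - y) (by omega) (by omega)
      simpa using this
    have := Finset.card_le_card hsub
    rw [Int.card_Icc] at this
    omega

lemma Isol.hull {B C : Finset ℤ} (h : Isol B C) :
    (∀ a ∈ B, ∃ a' ∈ C, a' ≤ a) ∧ (∀ a ∈ B, ∃ a' ∈ C, a ≤ a') := by
  rcases h.cases with h1 | h1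
  · exact ⟨fun a ha => ⟨a, h1 ha, le_refl _⟩, fun a ha => ⟨a, h1 ha, le_refl _⟩⟩
  · exact ⟨h1.1, h1.2.1⟩

lemma ww_mono {B C : Finset ℤ} (h : B.card ≤ C.card) : ww B ≤ ww C := by
  unfold ww
  gcongr

lemma exists_irred {C : Finset ℤ} (hC : C.Nonempty) : ∃ B, Isol B C ∧ Irred B := by
  have hex : ∃ n, ∃ B, Isol B C ∧ B.card = n := by
    refine ⟨_, C, ⟨hC, ?_⟩, rfl⟩
    intro i j _ _
    simp [sep]
  obtain ⟨B, hB, hn⟩ := Nat.find_spec hex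
  refine ⟨B, hB, hB.1, ?_⟩
  intro B' hB'
  by_contra hne
  have hlt : B'.card < B.card := by
    rcases hB'.cases with h | h
    · exact Finset.card_lt_card (lt_of_le_of_ne h hne)
    · exact h.2.2
  have hwm := ww_mono hlt.le
  refine Nat.find_min hex (m := B'.card) (by omega) ⟨B', ⟨hB'.1, ?_⟩, rfl⟩
  have hT : ∀ i, InT B' i → InT B i := by
    rintro i ⟨a, ha, b, hb, h1, h2⟩
    obtain ⟨a', ha', h3⟩ := hB'.hull.1 a ha
    obtain ⟨b', hb', h4⟩ := hB'.hull.2 b hb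
    exact ⟨a', ha', b', hb', by omega, by omega⟩
  intro i j hi hj
  have h1 := hB'.2 i j hi hj
  have h2 := hB.2 i j (hT i hi) (hT j hj)
  rw [sep_symmDiff] at *
  tauto

/-- a flat set that meets the thick hull has larger cardinality -/
lemma Flat.card_lt {S B : Finset ℤ} (hB : B.Nonempty) (h : Flat S B) {x : ℤ} (hx : x ∈ S)
    (hT : InT B x) : B.card < S.card := by
  obtain ⟨b, hb⟩ := hB
  have hw := card_lt_ww ⟨b, hb⟩
  have hsub : Finset.Icc b (b + ww B) ⊆ S := by
    intro y hy
    rw [Finset.mem_Icc] at hy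
    have := h x y hT (InT_near hb (by rw [abs_le]; constructor <;> omega))
    unfold sep at this
    tauto
  have := Finset.card_le_card hsub
  rw [Int.card_Icc] at this
  omega

end LR

namespace LR
open scoped symmDiff ENNReal

/-- coupling as an extended nonnegative real -/
def Jn (J₁ α : ℝ) (i j : ℤ) : ℝ≥0∞ := ENNReal.ofReal (Jcoup J₁ α (i - j).natAbs)

/-- local energy -/
def ph (J₁ α : ℝ) (S : Finset ℤ) (i : ℤ) : ℝ≥0∞ := ∑' j : ℤ, if sep S i j then Jn J₁ α i j else 0

/-- energy of a set -/
def En (J₁ α : ℝ) (S : Finset ℤ) : ℝ≥0∞ := ∑' i : ℤ, ph J₁ α S i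

/-- joint separation energy -/
def XX (J₁ α : ℝ) (S U : Finset ℤ) : ℝ≥0∞ :=
  ∑' i : ℤ, ∑' j : ℤ, if sep S i j ∧ sep U i j then Jn J₁ α i j else 0

lemma Jn_comm (J₁ α : ℝ) (i j : ℤ) : Jn J₁ α i j = Jn J₁ α j i := by
  unfold Jn
  rw [← Int.natAbs_neg, neg_sub]

lemma En_symmDiff (J₁ α : ℝ) (S U : Finset ℤ) :
    En J₁ α (S ∆ U) + 2 * XX J₁ α S U = En J₁ α S + En J₁ α U := by
  unfold En XX ph
  rw [two_mul]
  simp only [← ENNReal.tsum_add]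
  congr 1; ext i; congr 1; ext j
  rw [sep_symmDiff]
  by_cases h1 : sep S i j <;> by_cases h2 : sep U i j <;> simp [h1, h2]

lemma XX_mono_right {J₁ α : ℝ} {B R : Finset ℤ} {P : Finset (Finset ℤ)} {C : Finset ℤ}
    (h : ∀ i j, sep R i j → sep C i j ∨ ∃ b ∈ P, sep b i j) :
    XX J₁ α B R ≤ XX J₁ α B C + ∑ b ∈ P, XX J₁ α B b := by
  unfold XX
  have e1 : ∑ b ∈ P, (∑' i : ℤ, ∑' j : ℤ, if sep B i j ∧ sep b i j then Jn J₁ α i j else 0)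
      = ∑' i : ℤ, ∑' j : ℤ, ∑ b ∈ P, if sep B i j ∧ sep b i j then Jn J₁ α i j else 0 := by
    rw [← Summable.tsum_finsetSum (fun _ _ => ENNReal.summable)]
    congr 1; ext i
    rw [← Summable.tsum_finsetSum (fun _ _ => ENNReal.summable)]
  rw [e1]
  simp only [← ENNReal.tsum_add]
  refine ENNReal.tsum_le_tsum fun i => ENNReal.tsum_le_tsum fun j => ?_
  by_cases h1 : sep B i j ∧ sep R i j
  · rw [if_pos h1]
    rcases h i j h1.2 with h2 | ⟨b, hb, h2⟩
    · rw [if_pos ⟨h1.1, h2⟩]; exact le_self_add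
    · refine le_trans ?_ le_add_self
      refine le_trans ?_ (Finset.single_le_sum (fun _ _ => zero_le) hb)
      rw [if_pos ⟨h1.1, h2⟩]
  · rw [if_neg h1]; exact zero_le

lemma tsum_ite_mem (b : Finset ℤ) (f : ℤ → ℝ≥0∞) :
    (∑' i : ℤ, if i ∈ b then f i else 0) = ∑ i ∈ b, f i := by
  rw [tsum_eq_sum (s := b)]
  · exact Finset.sum_congr rfl fun i hi => if_pos hi
  · intro i hi; exact if_neg hi

/-- generic bound of a symmetric double sum -/
lemma dbl_le {f g : ℤ → ℤ → ℝ≥0∞} (b : Finset ℤ)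
    (h : ∀ i j, f i j ≤ (if i ∈ b then g i j else 0) + (if j ∈ b then g j i else 0)) :
    (∑' i : ℤ, ∑' j : ℤ, f i j) ≤ 2 * ∑ i ∈ b, ∑' j : ℤ, g i j := by
  calc (∑' i : ℤ, ∑' j : ℤ, f i j)
      ≤ ∑' i : ℤ, ∑' j : ℤ, ((if i ∈ b then g i j else 0) + (if j ∈ b then g j i else 0)) :=
        ENNReal.tsum_le_tsum fun i => ENNReal.tsum_le_tsum fun j => h i j
    _ = (∑' i : ℤ, ∑' j : ℤ, (if i ∈ b then g i j else 0))
        + ∑' i : ℤ, ∑' j : ℤ, (if j ∈ b then g j i else 0) := by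
        simp only [← ENNReal.tsum_add]
    _ = (∑' i : ℤ, ∑' j : ℤ, (if i ∈ b then g i j else 0))
        + ∑' i : ℤ, ∑' j : ℤ, (if i ∈ b then g i j else 0) := by
        congr 1
        rw [ENNReal.tsum_comm]
    _ = 2 * ∑ i ∈ b, ∑' j : ℤ, g i j := by
        rw [← two_mul, ← tsum_ite_mem]
        congr 2; ext i
        by_cases hi : i ∈ b <;> simp [hi]

lemma XX_le_ph {J₁ α : ℝ} (B b : Finset ℤ) :
    XX J₁ α B b ≤ 2 * ∑ i ∈ b, ph J₁ α B i := by
  unfold XX ph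
  apply dbl_le
  intro i j
  by_cases h : sep B i j ∧ sep b i j
  · rw [if_pos h]
    have h3 : sep B j i := sep_comm.1 h.1
    have : i ∈ b ∨ j ∈ b := by
      have := h.2; unfold sep at this; tauto
    rcases this with h2 | h2
    · rw [if_pos h2, if_pos h.1]; exact le_self_add
    · rw [if_pos h2, if_pos h3, Jn_comm]; exact le_add_self
  · rw [if_neg h]; exact zero_le

lemma Jcoup_far {J₁ α : ℝ} {n : ℕ} (hn : 2 ≤ n) : Jcoup J₁ α n = (n : ℝ) ^ (α - 2) := by
  unfold Jcoup; rw [if_neg (by omega)]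

lemma Jn_smooth {J₁ α : ℝ} (hα : 0 < α) (hα2 : α < 3 / 5) {n m : ℕ} (hn : 2 ≤ n) (hm : 2 ≤ m)
    (h : 4 * m ≤ 5 * n) : Jcoup J₁ α n ≤ 2 * Jcoup J₁ α m := by
  rw [Jcoup_far hn, Jcoup_far hm]
  have hn0 : (0 : ℝ) < n := by positivity
  have hm0 : (0 : ℝ) < m := by positivity
  have h1 : (m : ℝ) ≤ 5 / 4 * n := by
    have : (4 : ℝ) * m ≤ 5 * n := by exact_mod_cast h
    linarith
  have h2 : (5 / 4 * (n : ℝ)) ^ (α - 2) ≤ (m : ℝ) ^ (α - 2) :=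
    Real.rpow_le_rpow_of_nonpos hm0 h1 (by linarith)
  rw [Real.mul_rpow (by norm_num) hn0.le] at h2
  have h3 : (1 / 2 : ℝ) ≤ (5 / 4 : ℝ) ^ (α - 2) := by
    calc (1 / 2 : ℝ) ≤ (5 / 4 : ℝ) ^ (-2 : ℝ) := by
          rw [Real.rpow_neg (by norm_num)]; norm_num
      _ ≤ _ := Real.rpow_le_rpow_of_exponent_le (by norm_num) (by linarith)
  have h4 : 0 ≤ (n : ℝ) ^ (α - 2) := by positivity
  nlinarith

lemma far_of_sep {B b : Finset ℤ} (hF : Flat B b) {i i' j : ℤ} (hi : i ∈ b) (hi' : InT b i')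
    (h : sep B i' j) : 4 * (ww b : ℤ) < |i - j| := by
  by_contra hc
  push Not at hc
  exact hF i' j hi' (InT_near hi (by rw [abs_sub_comm]; exact hc)) h

lemma ph_smooth {J₁ α : ℝ} (hα : 0 < α) (hα2 : α < 3 / 5) {B b : Finset ℤ} (hF : Flat B b)
    {i i' : ℤ} (hi : i ∈ b) (hii : |i' - i| ≤ ww b) :
    ph J₁ α B i ≤ 2 * ph J₁ α B i' := by
  unfold ph
  rw [← ENNReal.tsum_mul_left]
  refine ENNReal.tsum_le_tsum fun j => ?_
  by_cases h : sep B i j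
  · have hw := card_lt_ww ⟨_, hi⟩
    have hT : InT b i' := InT_near hi (by omega)
    have h2 : sep B i' j := by
      have := hF i i' (InT_self hi) hT
      unfold sep at *; tauto
    rw [if_pos h, if_pos h2]
    have h3 := far_of_sep hF hi hT h2
    unfold Jn
    rw [Int.abs_eq_natAbs] at h3 hii
    have : (2 : ℝ≥0∞) = ENNReal.ofReal 2 := by simp
    rw [this, ← ENNReal.ofReal_mul (by norm_num)]
    apply ENNReal.ofReal_le_ofReal
    apply Jn_smooth hα hα2
    · omega
    · omega
    · omega
  · rw [if_neg h]; exact zero_le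

/-- `x` is near `b` -/
def near (b : Finset ℤ) (x : ℤ) : Prop := ∃ i ∈ b, |x - i| ≤ ww b

lemma ph_window {J₁ α : ℝ} (hα : 0 < α) (hα2 : α < 3 / 5) {B b : Finset ℤ} (hF : Flat B b)
    {i : ℤ} (hi : i ∈ b) :
    (ww b : ℝ≥0∞) * ph J₁ α B i ≤ ∑' x : ℤ, if near b x then ph J₁ α B x else 0 := by
  have h1 : ∑ x ∈ Finset.Icc (i - ww b) (i + ww b), (if near b x then ph J₁ α B x else 0)
      ≤ ∑' x : ℤ, if near b x then ph J₁ α B x else 0 := ENNReal.sum_le_tsum _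
  refine le_trans ?_ h1
  have h2 : ∀ x ∈ Finset.Icc (i - ww b) (i + ww b), (2 : ℝ≥0∞)⁻¹ * ph J₁ α B i ≤
      (if near b x then ph J₁ α B x else 0) := by
    intro x hx
    rw [Finset.mem_Icc] at hx
    have hx' : |x - i| ≤ ww b := by rw [abs_le]; constructor <;> omega
    rw [if_pos ⟨i, hi, hx'⟩]
    have := ph_smooth (J₁ := J₁) hα hα2 hF hi hx'
    calc (2 : ℝ≥0∞)⁻¹ * ph J₁ α B i ≤ 2⁻¹ * (2 * ph J₁ α B x) := by gcongr
      _ = ph J₁ α B x := by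
        rw [← mul_assoc, ENNReal.inv_mul_cancel (by norm_num) (by norm_num), one_mul]
  refine le_trans ?_ (Finset.sum_le_sum h2)
  rw [Finset.sum_const, Int.card_Icc, nsmul_eq_mul, ← mul_assoc]
  gcongr
  have : (i + (ww b : ℤ) + 1 - (i - (ww b : ℤ))).toNat = 2 * ww b + 1 := by omega
  rw [this]
  push_cast
  calc (ww b : ℝ≥0∞) = (2 * 2⁻¹) * ww b := by
        rw [ENNReal.mul_inv_cancel (by norm_num) (by norm_num), one_mul]
    _ = 2 * ww b * 2⁻¹ := by ring
    _ ≤ _ := by gcongr; exact le_self_add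

lemma ph_sum {J₁ α : ℝ} (hα : 0 < α) (hα2 : α < 3 / 5) {B b : Finset ℤ} (hb : b.Nonempty)
    (hF : Flat B b) :
    ∑ i ∈ b, ph J₁ α B i ≤
      ENNReal.ofReal (1 / (32 * (b.card : ℝ) ^ 2)) * ∑' x : ℤ, if near b x then ph J₁ α B x else 0 := by
  set Y := ∑' x : ℤ, if near b x then ph J₁ α B x else 0
  have hm : 0 < b.card := hb.card_pos
  have h1 : ∀ i ∈ b, ph J₁ α B i ≤ ENNReal.ofReal (1 / (32 * (b.card : ℝ) ^ 3)) * Y := by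
    intro i hi
    have h2 := ph_window (J₁ := J₁) hα hα2 hF hi
    have h3 : ENNReal.ofReal (1 / (32 * (b.card : ℝ) ^ 3)) * (ww b : ℝ≥0∞) = 1 := by
      rw [← ENNReal.ofReal_natCast, ← ENNReal.ofReal_mul (by positivity)]
      unfold ww
      push_cast
      rw [one_div, inv_mul_cancel₀ (by positivity)]
      simp
    calc ph J₁ α B i = ENNReal.ofReal (1 / (32 * (b.card : ℝ) ^ 3)) * (ww b : ℝ≥0∞) * ph J₁ α B i := by
          rw [h3, one_mul]
      _ ≤ _ := by rw [mul_assoc]; gcongr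
  refine (Finset.sum_le_sum h1).trans ?_
  rw [Finset.sum_const, nsmul_eq_mul, ← mul_assoc]
  gcongr
  rw [← ENNReal.ofReal_natCast, ← ENNReal.ofReal_mul (by positivity)]
  apply ENNReal.ofReal_le_ofReal
  apply le_of_eq
  have : (b.card : ℝ) ≠ 0 := by positivity
  field_simp

lemma sum_inv_sq (n : ℕ) : ∑ m ∈ Finset.range n, 1 / ((m : ℝ) + 1) ^ 2 ≤ 2 - 1 / (n : ℝ) := by
  induction n with
  | zero => norm_num
  | succ n ih =>
    rw [Finset.sum_range_succ]
    rcases Nat.eq_zero_or_pos n with h0 | h0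
    · subst h0; norm_num
    · have hn : (0 : ℝ) < n := by exact_mod_cast h0
      have : 1 / ((n : ℝ) + 1) ^ 2 ≤ 1 / (n : ℝ) - 1 / ((n : ℝ) + 1) := by
        rw [div_sub_div _ _ (by positivity) (by positivity), div_le_div_iff₀ (by positivity) (by positivity)]
        nlinarith
      push_cast
      linarith

end LR

namespace LR
open scoped symmDiff ENNReal

lemma near_card_ne {b b' : Finset ℤ} (hF : Flat b' b) {x : ℤ}
    (h1 : near b x) (h2 : near b' x) (hc : b.card = b'.card) : False := by
  obtain ⟨i, hi, hxi⟩ := h1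
  obtain ⟨i', hi', hxi'⟩ := h2
  have hw : ww b' = ww b := by unfold ww; rw [hc]
  rw [hw] at hxi'
  rw [abs_le] at hxi hxi'
  have hT : InT b i' := InT_near hi (by rw [abs_le]; constructor <;> omega)
  have := Flat.card_lt ⟨i, hi⟩ hF hi' hT
  omega

lemma sum_near (P : Finset (Finset ℤ)) (hne : ∀ b ∈ P, b.Nonempty)
    (hP : ∀ b ∈ P, ∀ b' ∈ P, b ≠ b' → Flat b' b ∨ Flat b b') (x : ℤ) :
    ∑ b ∈ P.filter (fun b => near b x), 1 / (16 * (b.card : ℝ) ^ 2) ≤ 1 / 8 := by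
  set Q := P.filter (fun b => near b x)
  have hinj : Set.InjOn (fun b : Finset ℤ => b.card - 1) Q := by
    intro b hb b' hb' hc
    simp only [Q, Finset.coe_filter, Set.mem_ofPred_eq] at hb hb'
    have h1 := (hne b hb.1).card_pos
    have h2 := (hne b' hb'.1).card_pos
    have hc' : b.card = b'.card := by simp only at hc; omega
    by_contra hbb
    rcases hP b hb.1 b' hb'.1 hbb with h | h
    · exact near_card_ne h hb.2 hb'.2 hc'
    · exact near_card_ne h hb'.2 hb.2 hc'.symm
  have e1 : ∑ b ∈ Q, 1 / (16 * (b.card : ℝ) ^ 2)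
      = ∑ m ∈ (Q.image (fun b => b.card - 1) : Finset ℕ), 1 / (16 * ((m : ℝ) + 1) ^ 2) := by
    rw [Finset.sum_image hinj]
    refine Finset.sum_congr rfl fun b hb => ?_
    have h1 := (hne b (Finset.mem_filter.1 hb).1).card_pos
    have : ((b.card - 1 : ℕ) : ℝ) + 1 = b.card := by
      rw [← Nat.cast_succ]; congr 1; omega
    rw [this]
  rw [e1]
  have hsub : Q.image (fun b => b.card - 1) ⊆ Finset.range ((Q.image (fun b => b.card - 1)).sup id + 1) := by
    intro m hm
    rw [Finset.mem_range]
    have : id m ≤ _ := Finset.le_sup hm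
    simp only [id] at this
    exact Nat.lt_succ_of_le this
  refine (Finset.sum_le_sum_of_subset_of_nonneg hsub (fun _ _ _ => by positivity)).trans ?_
  have h3 := sum_inv_sq ((Q.image (fun b => b.card - 1)).sup id + 1)
  have h4 : ∀ n : ℕ, ∑ m ∈ Finset.range n, 1 / (16 * ((m : ℝ) + 1) ^ 2)
      = (1 / 16) * ∑ m ∈ Finset.range n, 1 / ((m : ℝ) + 1) ^ 2 := by
    intro n
    rw [Finset.mul_sum]
    refine Finset.sum_congr rfl fun m _ => ?_
    rw [one_div_mul_one_div]
  rw [h4]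
  have h5 : (0 : ℝ) ≤ 1 / (((Q.image (fun b => b.card - 1)).sup id + 1 : ℕ) : ℝ) := by positivity
  linarith

lemma sum_XX {J₁ α : ℝ} (hα : 0 < α) (hα2 : α < 3 / 5) {B : Finset ℤ} (P : Finset (Finset ℤ))
    (hne : ∀ b ∈ P, b.Nonempty) (hF : ∀ b ∈ P, Flat B b)
    (hP : ∀ b ∈ P, ∀ b' ∈ P, b ≠ b' → Flat b' b ∨ Flat b b') :
    ∑ b ∈ P, XX J₁ α B b ≤ ENNReal.ofReal (1 / 8) * En J₁ α B := by
  have h1 : ∀ b ∈ P, XX J₁ α B b ≤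
      ∑' x : ℤ, (if near b x then ENNReal.ofReal (1 / (16 * (b.card : ℝ) ^ 2)) else 0) * ph J₁ α B x := by
    intro b hb
    refine (XX_le_ph B b).trans ?_
    have := ph_sum (J₁ := J₁) hα hα2 (hne b hb) (hF b hb)
    have e2 : (2 : ℝ≥0∞) * ENNReal.ofReal (1 / (32 * (b.card : ℝ) ^ 2))
        = ENNReal.ofReal (1 / (16 * (b.card : ℝ) ^ 2)) := by
      have h2 : (2 : ℝ≥0∞) = ENNReal.ofReal 2 := by simp
      rw [h2, ← ENNReal.ofReal_mul (by norm_num)]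
      congr 1
      have : (b.card : ℝ) ≠ 0 := by
        have := (hne b hb).card_pos
        positivity
      field_simp
      norm_num
    calc 2 * ∑ i ∈ b, ph J₁ α B i
        ≤ 2 * (ENNReal.ofReal (1 / (32 * (b.card : ℝ) ^ 2)) *
            ∑' x : ℤ, if near b x then ph J₁ α B x else 0) := by gcongr
      _ = ∑' x : ℤ, ENNReal.ofReal (1 / (16 * (b.card : ℝ) ^ 2)) *
            (if near b x then ph J₁ α B x else 0) := by
          rw [← mul_assoc, e2, ENNReal.tsum_mul_left]
      _ = _ := by
          congr 1; ext x
          by_cases h : near b x <;> simp [h]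
  refine (Finset.sum_le_sum h1).trans ?_
  rw [← Summable.tsum_finsetSum (fun _ _ => ENNReal.summable)]
  unfold En
  rw [← ENNReal.tsum_mul_left]
  refine ENNReal.tsum_le_tsum fun x => ?_
  rw [← Finset.sum_mul]
  gcongr
  rw [← Finset.sum_filter, ← ENNReal.ofReal_sum_of_nonneg (fun _ _ => by positivity)]
  exact ENNReal.ofReal_le_ofReal (sum_near P hne hP x)

/-- a universal constant -/
def C0 : ℝ≥0∞ := ∑' n : ℤ, ENNReal.ofReal (|(n : ℝ)| ^ (-(16 / 15) : ℝ))

lemma C0_lt : C0 < ⊤ := by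
  have : Summable fun n : ℤ => |(n : ℝ)| ^ (-(16 / 15) : ℝ) :=
    Real.summable_abs_int_rpow (by norm_num)
  unfold C0
  exact this.tsum_ofReal_lt_top

lemma C0_shift (i : ℤ) : (∑' j : ℤ, ENNReal.ofReal (|((i - j : ℤ) : ℝ)| ^ (-(16 / 15) : ℝ))) = C0 :=
  (Equiv.subLeft i).tsum_eq (fun n : ℤ => ENNReal.ofReal (|(n : ℝ)| ^ (-(16 / 15) : ℝ)))

lemma natAbs_cast (n : ℤ) : ((n.natAbs : ℕ) : ℝ) = |(n : ℝ)| := by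
  rw [Nat.cast_natAbs]; push_cast; rfl

lemma XX_flat {J₁ α : ℝ} (hα2 : α < 3 / 5) {B C' : Finset ℤ}
    (hF : Flat C' B) : XX J₁ α B C' ≤ 2 * C0 := by
  rcases B.eq_empty_or_nonempty with h0 | hB
  · subst h0
    unfold XX
    simp [sep]
  have hw := card_lt_ww hB
  have hm : 0 < B.card := hB.card_pos
  have h1 : XX J₁ α B C' ≤ 2 * ∑ i ∈ B, ∑' j : ℤ, if ¬ InT B j then Jn J₁ α i j else 0 := by
    unfold XX
    apply dbl_le
    intro i j
    by_cases h : sep B i j ∧ sep C' i j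
    · rw [if_pos h]
      have : i ∈ B ∨ j ∈ B := by
        have := h.1; unfold sep at this; tauto
      rcases this with h2 | h2
      · rw [if_pos h2, if_pos]
        · exact le_self_add
        · exact fun hj => hF i j (InT_self h2) hj h.2
      · have h5 : ¬ InT B i := fun hj => hF i j hj (InT_self h2) h.2
        rw [if_pos h2, if_pos h5, Jn_comm]
        exact le_add_self
    · rw [if_neg h]; exact zero_le
  refine h1.trans ?_
  gcongr
  have h2 : ∀ i ∈ B, (∑' j : ℤ, if ¬ InT B j then Jn J₁ α i j else 0)
      ≤ ENNReal.ofReal (1 / B.card) * C0 := by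
    intro i hi
    rw [← C0_shift i, ← ENNReal.tsum_mul_left]
    refine ENNReal.tsum_le_tsum fun j => ?_
    by_cases h : InT B j
    · simp [h]
    rw [if_pos h]
    have h3 : 4 * (ww B : ℤ) < |j - i| := by
      by_contra hc
      push Not at hc
      exact h (InT_near hi hc)
    unfold Jn
    rw [← ENNReal.ofReal_mul (by positivity)]
    apply ENNReal.ofReal_le_ofReal
    rw [Int.abs_eq_natAbs, ← Int.natAbs_neg, neg_sub] at h3
    rw [← natAbs_cast]
    set n := (i - j).natAbs
    have h4 : B.card ^ 3 ≤ n := by unfold ww at h3; push_cast at h3; zify; omega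
    rw [Jcoup_far (by omega)]
    have hn : (1 : ℝ) ≤ n := by
      have : 1 ≤ n := by omega
      exact_mod_cast this
    have h5 : (n : ℝ) ^ (α - 2) ≤ (n : ℝ) ^ (-(1 / 3) + -(16 / 15) : ℝ) :=
      Real.rpow_le_rpow_of_exponent_le hn (by linarith)
    refine h5.trans ?_
    rw [Real.rpow_add (by linarith)]
    gcongr
    have h6 : ((B.card : ℝ) ^ 3) ≤ n := by exact_mod_cast h4
    have hm' : (0 : ℝ) < B.card := by exact_mod_cast hm
    calc (n : ℝ) ^ (-(1 / 3) : ℝ) ≤ ((B.card : ℝ) ^ 3) ^ (-(1 / 3) : ℝ) :=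
          Real.rpow_le_rpow_of_nonpos (by positivity) h6 (by norm_num)
      _ = 1 / B.card := by
          rw [← Real.rpow_natCast, ← Real.rpow_mul hm'.le]
          norm_num
          rw [Real.rpow_neg_one]
  refine (Finset.sum_le_sum h2).trans ?_
  rw [Finset.sum_const, nsmul_eq_mul, ← mul_assoc, ← ENNReal.ofReal_natCast,
    ← ENNReal.ofReal_mul (by positivity)]
  have : (B.card : ℝ) * (1 / B.card) = 1 := by
    have : (B.card : ℝ) ≠ 0 := by positivity
    field_simp
  rw [this]; simp

lemma En_lt_top {J₁ α : ℝ} (hα2 : α < 3 / 5) (B : Finset ℤ) : En J₁ α B < ⊤ := by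
  have h1 : En J₁ α B ≤ 2 * ∑ i ∈ B, ∑' j : ℤ,
      ENNReal.ofReal (|J₁| + 1) * ENNReal.ofReal (|((i - j : ℤ) : ℝ)| ^ (-(16 / 15) : ℝ)) := by
    unfold En ph
    apply dbl_le
    have key : ∀ i j : ℤ, i ≠ j → Jn J₁ α i j ≤
        ENNReal.ofReal (|J₁| + 1) * ENNReal.ofReal (|((i - j : ℤ) : ℝ)| ^ (-(16 / 15) : ℝ)) := by
      intro i j hij
      unfold Jn
      rw [← ENNReal.ofReal_mul (by positivity), ← natAbs_cast]
      apply ENNReal.ofReal_le_ofReal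
      set n := (i - j).natAbs with hn
      by_cases h1 : n = 1
      · rw [h1]
        simp [Jcoup]
        have := le_abs_self J₁; linarith
      · rw [Jcoup_far (by omega)]
        have h2 : (1 : ℝ) ≤ n := by
          have : 1 ≤ n := by omega
          exact_mod_cast this
        have h3 : (n : ℝ) ^ (α - 2) ≤ (n : ℝ) ^ (-(16 / 15) : ℝ) :=
          Real.rpow_le_rpow_of_exponent_le h2 (by linarith)
        have h4 : (0 : ℝ) ≤ (n : ℝ) ^ (-(16 / 15) : ℝ) := by positivity
        have := abs_nonneg J₁
        nlinarith
    intro i j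
    by_cases h : sep B i j
    · rw [if_pos h]
      have hne : i ≠ j := by rintro rfl; exact not_sep_self h
      have : i ∈ B ∨ j ∈ B := by
        unfold sep at h; tauto
      rcases this with h2 | h2
      · rw [if_pos h2]; exact (key i j hne).trans le_self_add
      · rw [if_pos h2, Jn_comm]; exact (key j i hne.symm).trans le_add_self
    · rw [if_neg h]; exact zero_le
  refine h1.trans_lt ?_
  simp only [ENNReal.tsum_mul_left, C0_shift]
  refine ENNReal.mul_lt_top (by simp) ?_
  rw [ENNReal.sum_lt_top]
  intro i _
  exact ENNReal.mul_lt_top (by simp) C0_lt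

lemma bd_le_En {J₁ α : ℝ} (B : Finset ℤ) : ((bd B).card : ℝ≥0∞) * ENNReal.ofReal J₁ ≤ En J₁ α B := by
  have h1 : ∑ i ∈ bd B, ph J₁ α B i ≤ En J₁ α B := ENNReal.sum_le_tsum _
  refine le_trans ?_ h1
  rw [← nsmul_eq_mul, ← Finset.sum_const]
  refine Finset.sum_le_sum fun i hi => ?_
  unfold ph
  refine le_trans ?_ (ENNReal.le_tsum (i - 1))
  rw [if_pos (sep_comm.1 (mem_bd.1 hi))]
  unfold Jn Jcoup
  simp

lemma XX_comm (J₁ α : ℝ) (S U : Finset ℤ) : XX J₁ α S U = XX J₁ α U S := by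
  unfold XX; simp only [and_comm]

lemma gain {J₁ α : ℝ} (hα : 0 < α) (hα2 : α < 3 / 5) (hJ : 16 * C0 ≤ ENNReal.ofReal J₁)
    {A B C : Finset ℤ} {P : Finset (Finset ℤ)} (hI : Isol B C)
    (hne : ∀ b ∈ P, b.Nonempty) (hF : ∀ b ∈ P, Flat B b)
    (hP : ∀ b ∈ P, ∀ b' ∈ P, b ≠ b' → Flat b' b ∨ Flat b b')
    (hA : ∀ i j, sep (A ∆ C) i j → ∃ b ∈ P, sep b i j) :
    En J₁ α (A ∆ B) + En J₁ α B / 2 ≤ En J₁ α A := by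
  have h1 : XX J₁ α B (A ∆ B) ≤ XX J₁ α B (C ∆ B) + ∑ b ∈ P, XX J₁ α B b := by
    apply XX_mono_right
    intro i j h
    have e : A ∆ B = (A ∆ C) ∆ (C ∆ B) := by
      rw [← symmDiff_assoc, symmDiff_symmDiff_cancel_right]
    rw [e, sep_symmDiff] at h
    by_cases h2 : sep (C ∆ B) i j
    · exact Or.inl h2
    · right; apply hA; by_contra h3; exact h (iff_of_false h3 h2)
  have h2 := XX_flat (J₁ := J₁) hα2 hI.2
  have h3 := sum_XX (J₁ := J₁) hα hα2 P hne hF hP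
  have hfin := En_lt_top (J₁ := J₁) hα2 B
  have h4 : ENNReal.ofReal J₁ ≤ En J₁ α B := by
    refine le_trans ?_ (bd_le_En B)
    have : 1 ≤ (bd B).card := (bd_nonempty hI.1).card_pos
    calc ENNReal.ofReal J₁ = 1 * ENNReal.ofReal J₁ := by rw [one_mul]
      _ ≤ _ := by gcongr; exact_mod_cast this
  have h5 := En_symmDiff J₁ α (A ∆ B) B
  rw [symmDiff_symmDiff_cancel_right, XX_comm] at h5
  have h6 : 2 * XX J₁ α B (A ∆ B) ≤ En J₁ α B / 2 := by
    have h7 : 16 * C0 ≤ En J₁ α B := hJ.trans h4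
    have hX := (h1.trans (add_le_add h2 h3))
    have hC := C0_lt
    lift C0 to NNReal using hC.ne with c
    have hX' : XX J₁ α B (A ∆ B) < ⊤ := by
      refine hX.trans_lt ?_
      exact ENNReal.add_lt_top.2 ⟨ENNReal.mul_lt_top (by simp) (by simp), ENNReal.mul_lt_top (by simp) hfin⟩
    lift En J₁ α B to NNReal using hfin.ne with e
    lift XX J₁ α B (A ∆ B) to NNReal using hX'.ne with x
    have e8 : ENNReal.ofReal (1 / 8) = ((1 / 8 : NNReal) : ℝ≥0∞) := by
      rw [ENNReal.ofReal]; congr 1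
      ext; simp
    rw [e8] at hX
    have h7' : (16 : NNReal) * c ≤ e := by exact_mod_cast h7
    have hX2 : x ≤ 2 * c + 1 / 8 * e := by exact_mod_cast hX
    have : (2 : NNReal) * x ≤ e / 2 := by
      rw [← NNReal.coe_le_coe] at *
      push_cast at *
      linarith
    have h9 : ((e / 2 : NNReal) : ℝ≥0∞) = (e : ℝ≥0∞) / 2 := by
      rw [ENNReal.coe_div (by norm_num)]; simp
    rw [← h9]
    exact_mod_cast this
  have h7 : En J₁ α (A ∆ B) + En J₁ α B / 2 + En J₁ α B / 2 ≤ En J₁ α A + En J₁ α B / 2 := by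
    rw [add_assoc, ENNReal.add_halves, ← h5]
    gcongr
  refine (ENNReal.add_le_add_iff_right ?_).1 h7
  exact (ENNReal.div_lt_top hfin.ne (by norm_num)).ne

lemma contour_aux {J₁ α : ℝ} (hα : 0 < α) (hα2 : α < 3 / 5) (hJ : 16 * C0 ≤ ENNReal.ofReal J₁)
    {A : Finset ℤ} {p q : ℤ} (n : ℕ) : ∀ (C : Finset ℤ) (P : Finset (Finset ℤ)),
    (bd C).card ≤ n → 0 ∈ C → C ⊆ Finset.Icc p q →
    (∀ b ∈ P, b.Nonempty) → (∀ b ∈ P, Flat C b) →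
    (∀ b ∈ P, ∀ b' ∈ P, b ≠ b' → Flat b' b ∨ Flat b b') →
    (∀ i j, sep (A ∆ C) i j → ∃ b ∈ P, sep b i j) →
    ∃ B, Irred B ∧ 0 ∈ B ∧ B ⊆ Finset.Icc p q ∧ En J₁ α (A ∆ B) + En J₁ α B / 2 ≤ En J₁ α A := by
  induction n with
  | zero =>
    intro C P hn h0
    have := (bd_nonempty ⟨0, h0⟩).card_pos
    omega
  | succ n ih =>
    intro C P hn h0 hIcc hne hF hP hA
    obtain ⟨B, hI, hB⟩ := exists_irred ⟨0, h0⟩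
    have hBI : B ⊆ Finset.Icc p q := by
      intro x hx
      obtain ⟨y, hy, hy'⟩ := hI.hull.1 x hx
      obtain ⟨z, hz, hz'⟩ := hI.hull.2 x hx
      have h1 := Finset.mem_Icc.1 (hIcc hy)
      have h2 := Finset.mem_Icc.1 (hIcc hz)
      rw [Finset.mem_Icc]; constructor <;> omega
    have hFB : ∀ b ∈ P, Flat B b := fun b hb => Flat_of_bd hI.bd_sub' (hF b hb)
    have hFC : ∀ b ∈ P, Flat (C ∆ B) b := fun b hb => Flat_of_bd hI.bd_sub (hF b hb)
    by_cases hB0 : 0 ∈ B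
    · exact ⟨B, hB, hB0, hBI, gain hα hα2 hJ hI hne hFB hP hA⟩
    · refine ih (C ∆ B) (insert B P) ?_ ?_ ?_ ?_ ?_ ?_ ?_
      · have := hI.bd_lt; omega
      · rw [Finset.mem_symmDiff]; exact Or.inl ⟨h0, hB0⟩
      · intro x hx
        rw [Finset.mem_symmDiff] at hx
        rcases hx with hx | hx
        · exact hIcc hx.1
        · exact hBI hx.1
      · intro b hb
        rcases Finset.mem_insert.1 hb with rfl | hb
        · exact hB.1
        · exact hne b hb
      · intro b hb
        rcases Finset.mem_insert.1 hb with rfl | hb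
        · exact hI.2
        · exact hFC b hb
      · intro b hb b' hb' hbb
        rcases Finset.mem_insert.1 hb with h1 | h1
        · rcases Finset.mem_insert.1 hb' with h2 | h2
          · exact absurd (h1.trans h2.symm) hbb
          · right; rw [h1]; exact hFB b' h2
        · rcases Finset.mem_insert.1 hb' with h2 | h2
          · left; rw [h2]; exact hFB b h1
          · exact hP b h1 b' h2 hbb
      · intro i j h
        rw [← symmDiff_assoc, sep_symmDiff] at h
        by_cases h2 : sep B i j
        · exact ⟨B, Finset.mem_insert_self _ _, h2⟩
        · have h3 : sep (A ∆ C) i j := by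
            by_contra h3; exact h (iff_of_false h3 h2)
          obtain ⟨b, hb, hb'⟩ := hA i j h3
          exact ⟨b, Finset.mem_insert_of_mem hb, hb'⟩

/-- energy as a real number -/
def en (J₁ α : ℝ) (S : Finset ℤ) : ℝ := (En J₁ α S).toReal

lemma contour {J₁ α : ℝ} (hα : 0 < α) (hα2 : α < 3 / 5) (hJ : 16 * C0 ≤ ENNReal.ofReal J₁)
    {A : Finset ℤ} {p q : ℤ} (h0 : 0 ∈ A) (hA : A ⊆ Finset.Icc p q) :
    ∃ B, Irred B ∧ 0 ∈ B ∧ B ⊆ Finset.Icc p q ∧ en J₁ α (A ∆ B) + en J₁ α B / 2 ≤ en J₁ α A := by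
  obtain ⟨B, h1, h2, h3, h4⟩ := contour_aux hα hα2 hJ (A := A) (p := p) (q := q) _ A ∅ le_rfl h0 hA
    (by simp) (by simp) (by simp) (by simp [sep])
  refine ⟨B, h1, h2, h3, ?_⟩
  unfold en
  have f1 := (En_lt_top (J₁ := J₁) hα2 A).ne
  have f2 := (En_lt_top (J₁ := J₁) hα2 B).ne
  have f3 := (En_lt_top (J₁ := J₁) hα2 (A ∆ B)).ne
  have := ENNReal.toReal_mono f1 h4
  rw [ENNReal.toReal_add f3 (ENNReal.div_lt_top f2 (by norm_num)).ne, ENNReal.toReal_div] at this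
  simpa using this

end LR

namespace LR
open scoped symmDiff ENNReal

lemma en_ofReal {J₁ α : ℝ} (hα2 : α < 3 / 5) (B : Finset ℤ) :
    ENNReal.ofReal (en J₁ α B) = En J₁ α B := ENNReal.ofReal_toReal (En_lt_top hα2 B).ne

lemma en_nonneg (J₁ α : ℝ) (B : Finset ℤ) : 0 ≤ en J₁ α B := ENNReal.toReal_nonneg

/-- many points with large local energy -/
lemma card_le_en {J₁ α : ℝ} (hα2 : α < 3 / 5) {B X : Finset ℤ} {c : ℝ} (hc : 0 ≤ c)
    (h : ∀ x ∈ X, ENNReal.ofReal c ≤ ph J₁ α B x) : (X.card : ℝ) * c ≤ en J₁ α B := by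
  rw [← ENNReal.ofReal_le_ofReal_iff (en_nonneg _ _ _), en_ofReal hα2]
  have h1 : ∑ i ∈ X, ph J₁ α B i ≤ En J₁ α B := ENNReal.sum_le_tsum _
  refine le_trans ?_ h1
  rw [ENNReal.ofReal_mul (by positivity), ENNReal.ofReal_natCast, ← nsmul_eq_mul, ← Finset.sum_const]
  exact Finset.sum_le_sum h

lemma bd_le_en {J₁ α : ℝ} (hJ : 0 ≤ J₁) (hα2 : α < 3 / 5) (B : Finset ℤ) :
    ((bd B).card : ℝ) * J₁ ≤ en J₁ α B := by
  rw [← ENNReal.ofReal_le_ofReal_iff (en_nonneg _ _ _), en_ofReal hα2,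
    ENNReal.ofReal_mul (by positivity), ENNReal.ofReal_natCast]
  exact bd_le_En B

lemma Jcoup_lb {J₁ α : ℝ} (hJ : 1 ≤ J₁) (hα2 : α < 3 / 5) {n r : ℕ} (hn : 1 ≤ n)
    (hr : n ≤ r) : (r : ℝ) ^ (α - 2) ≤ Jcoup J₁ α n := by
  have hr1 : (1 : ℝ) ≤ r := by exact_mod_cast hn.trans hr
  unfold Jcoup
  split_ifs with h
  · refine le_trans ?_ hJ
    apply Real.rpow_le_one_of_one_le_of_nonpos hr1 (by linarith)
  · apply Real.rpow_le_rpow_of_nonpos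
    · exact_mod_cast hn
    · exact_mod_cast hr
    · linarith

/-- lower bound for local energy -/
lemma ph_lb {J₁ α : ℝ} (hJ : 1 ≤ J₁) (hα2 : α < 3 / 5) {B Y : Finset ℤ} {x : ℤ} {r k : ℕ}
    (hY : ∀ y ∈ Y, sep B x y ∧ |x - y| ≤ r) (hk : k ≤ Y.card) :
    ENNReal.ofReal (k * (r : ℝ) ^ (α - 2)) ≤ ph J₁ α B x := by
  unfold ph
  have h1 : ∑ y ∈ Y, (if sep B x y then Jn J₁ α x y else 0) ≤
      ∑' y, (if sep B x y then Jn J₁ α x y else 0) := ENNReal.sum_le_tsum _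
  refine le_trans ?_ h1
  have h2 : ∀ y ∈ Y, ENNReal.ofReal ((r : ℝ) ^ (α - 2)) ≤ (if sep B x y then Jn J₁ α x y else 0) := by
    intro y hy
    obtain ⟨hs, hd⟩ := hY y hy
    rw [if_pos hs]
    unfold Jn
    apply ENNReal.ofReal_le_ofReal
    have hne : x ≠ y := by rintro rfl; exact not_sep_self hs
    rw [Int.abs_eq_natAbs] at hd
    apply Jcoup_lb hJ hα2
    · omega
    · omega
  refine le_trans ?_ (Finset.sum_le_sum h2)
  rw [Finset.sum_const, ENNReal.ofReal_mul (by positivity), ENNReal.ofReal_natCast, nsmul_eq_mul]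
  gcongr

lemma init_seg (F : Finset ℤ) (l : ℕ) (h : l ≤ F.card) :
    ∃ F' ⊆ F, F'.card = l ∧ ∀ x ∈ F', (F.filter (· < x)).card < l := by
  induction F using Finset.induction_on_max with
  | empty =>
    have : l = 0 := by simpa using h
    subst this
    exact ⟨∅, by simp, by simp, by simp⟩
  | insert a s ha ih =>
    by_cases hl : l ≤ s.card
    · obtain ⟨F', h1, h2, h3⟩ := ih hl
      refine ⟨F', h1.trans (Finset.subset_insert _ _), h2, fun x hx => ?_⟩
      have hxa := ha x (h1 hx)
      have : (insert a s).filter (· < x) = s.filter (· < x) := by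
        ext y
        simp only [Finset.mem_filter, Finset.mem_insert]
        constructor
        · rintro ⟨rfl | hy, h⟩
          · omega
          · exact ⟨hy, h⟩
        · rintro ⟨hy, h⟩; exact ⟨Or.inr hy, h⟩
      rw [this]; exact h3 x hx
    · have hna : a ∉ s := fun h => lt_irrefl _ (ha a h)
      rw [Finset.card_insert_of_notMem hna] at h
      refine ⟨insert a s, subset_rfl, ?_, fun x hx => ?_⟩
      · rw [Finset.card_insert_of_notMem hna]; omega
      · have hlt : (insert a s).filter (· < x) ⊂ insert a s := by
          rw [Finset.ssubset_iff_of_subset (Finset.filter_subset _ _)]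
          exact ⟨x, hx, by simp⟩
        have := Finset.card_lt_card hlt
        rw [Finset.card_insert_of_notMem hna] at this
        omega

/-- no wall in `(a, b]` implies not separated -/
lemma not_sep_of {S : Finset ℤ} {a b x y : ℤ} (h : ∀ d ∈ bd S, a < d → d ≤ b → False)
    (hx : a ≤ x) (hx' : x ≤ b) (hy : a ≤ y) (hy' : y ≤ b) : ¬ sep S x y := by
  intro hs
  rcases le_total x y with hxy | hxy
  · obtain ⟨d, hd, h1, h2⟩ := exists_wall' hxy hs
    exact h d hd (by omega) (by omega)
  · obtain ⟨d, hd, h1, h2⟩ := exists_wall' hxy (sep_comm.1 hs)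
    exact h d hd (by omega) (by omega)

/-- walls preceded by a gap of size at least `R` -/
def DD (B : Finset ℤ) (R : ℕ) : Finset ℤ :=
  (bd B).filter (fun d => (∃ e ∈ bd B, e < d) ∧ ∀ e ∈ bd B, e < d → (R : ℤ) ≤ d - e)

lemma sep_trans_not {S : Finset ℤ} {x y z : ℤ} (h : sep S x y) (h' : ¬ sep S y z) : sep S x z := by
  unfold sep at *; tauto

lemma big_gap {B : Finset ℤ} (hB : Irred B) {l : ℕ} (hl : 1 ≤ l) {d : ℤ}
    (hd : d ∈ DD B (128 * l ^ 3)) :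
    ∃ c : ℤ, d ≤ c ∧ (∀ d' ∈ DD B (128 * l ^ 3), d < d' → c + 128 * l ^ 3 ≤ d') ∧
      l ≤ ((Finset.Ico d (c + 128 * l ^ 3)).filter (fun x => sep B (d - 1) x)).card := by
  have hR : ((128 * l ^ 3 : ℕ) : ℤ) = 128 * (l : ℤ) ^ 3 := by push_cast; ring
  set R : ℤ := 128 * (l : ℤ) ^ 3 with hRdef
  have hRl : (l : ℤ) < R := by
    have : (l : ℤ) ≤ (l : ℤ) ^ 3 := by
      exact_mod_cast Nat.le_self_pow (by norm_num) l
    have : (1 : ℤ) ≤ l := by exact_mod_cast hl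
    omega
  have hd0 := hd
  simp only [DD, Finset.mem_filter, hR] at hd
  obtain ⟨hdb, ⟨e, he, hed⟩, hgap⟩ := hd
  set Q := (bd B).filter (fun c => d ≤ c ∧ ∀ f ∈ DD B (128 * l ^ 3), d < f → ¬ f ≤ c) with hQ
  have hQne : Q.Nonempty := ⟨d, by
    rw [hQ, Finset.mem_filter]; exact ⟨hdb, le_rfl, fun f _ h1 h2 => by omega⟩⟩
  set c := Q.max' hQne with hc
  have hcQ : c ∈ Q := Q.max'_mem hQne
  have hcmax : ∀ x ∈ Q, x ≤ c := fun x hx => Q.le_max' x hx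
  obtain ⟨hcb, hdc, hcD⟩ := Finset.mem_filter.1 hcQ
  have hnext : ∀ d' ∈ DD B (128 * l ^ 3), d < d' → c + R ≤ d' := by
    intro d' hd' hlt
    have h1 := hcD d' hd' hlt
    have h2 := (Finset.mem_filter.1 hd').2.2 c hcb (by omega)
    omega
  refine ⟨c, hdc, hnext, ?_⟩
  have hnow : ∀ f ∈ bd B, c < f → f ≤ c + R - 1 → False := by
    intro f hf h1 h2
    have : f ∈ Q := by
      rw [hQ, Finset.mem_filter]
      refine ⟨hf, by omega, fun g hg h3 h4 => ?_⟩
      have := hnext g hg h3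
      omega
    have := hcmax f this
    omega
  have hpre : ∀ f ∈ bd B, d - R < f → f ≤ d - 1 → False := by
    intro f hf h1 h2
    have := hgap f hf (by omega)
    omega
  set F := (Finset.Ico d (c + R)).filter (fun x => sep B (d - 1) x) with hF
  by_contra hlt
  push Not at hlt
  have hcc : ¬ sep B (d - 1) c := by
    intro hs
    have hsub : Finset.Ico c (c + R) ⊆ F := by
      intro x hx
      rw [Finset.mem_Ico] at hx
      rw [hF, Finset.mem_filter, Finset.mem_Ico]
      refine ⟨⟨by omega, by omega⟩, sep_trans_not hs ?_⟩
      exact not_sep_of hnow (by omega) (by omega) (by omega) (by omega)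
    have := Finset.card_le_card hsub
    rw [Int.card_Ico] at this
    omega
  have hFlt : ∀ x ∈ F, d ≤ x ∧ x < c := by
    intro x hx
    rw [hF, Finset.mem_filter, Finset.mem_Ico] at hx
    refine ⟨hx.1.1, ?_⟩
    by_contra hxc
    apply hcc
    exact sep_trans_not hx.2 (not_sep_of hnow (by omega) (by omega) (by omega) (by omega))
  have hdF : d ∈ F := by
    rw [hF, Finset.mem_filter, Finset.mem_Ico]
    exact ⟨⟨le_rfl, by omega⟩, mem_bd.1 hdb⟩
  have hww : 4 * (ww F : ℤ) < R := by
    have h1 : F.card ^ 3 < l ^ 3 := Nat.pow_lt_pow_left hlt (by norm_num)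
    have h2 : (F.card : ℤ) ^ 3 < (l : ℤ) ^ 3 := by exact_mod_cast h1
    unfold ww
    push_cast
    omega
  have hflatB : ∀ x, d - R ≤ x → x < c + R → ¬ sep (B ∆ F) (d - 1) x := by
    intro x h1 h2 h3
    rw [sep_symmDiff] at h3
    have hd1 : d - 1 ∉ F := fun h => by have := hFlt _ h; omega
    by_cases hxd : x < d
    · have hx1 : x ∉ F := fun h => by have := hFlt _ h; omega
      have h4 : ¬ sep F (d - 1) x := by unfold sep; tauto
      have h5 : ¬ sep B (d - 1) x := not_sep_of hpre (by omega) (by omega) (by omega) (by omega)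
      exact h3 (iff_of_false h5 h4)
    · have h4 : x ∈ F ↔ sep B (d - 1) x := by
        rw [hF, Finset.mem_filter, Finset.mem_Ico]
        exact ⟨fun h => h.2, fun h => ⟨⟨by omega, by omega⟩, h⟩⟩
      apply h3
      rw [← h4]; unfold sep; tauto
  have hIs : Isol F B := by
    refine ⟨⟨d, hdF⟩, ?_⟩
    have key : ∀ i, InT F i → ¬ sep (B ∆ F) (d - 1) i := by
      rintro i ⟨a, ha, b, hb, h1, h2⟩
      have h3 := hFlt a ha
      have h4 := hFlt b hb
      exact hflatB i (by omega) (by omega)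
    intro i j hi hj hs
    have h1 := key i hi
    have h2 := key j hj
    unfold sep at *; tauto
  have hFB := hB.2 F hIs
  have h1 := hgap e he hed
  have h2 := mem_bd.1 he
  rw [← hFB] at h2
  have : e - 1 ∈ F ∨ e ∈ F := by unfold sep at h2; tauto
  rcases this with h | h
  · have := hFlt _ h; omega
  · have := hFlt _ h; omega

lemma count_gap {J₁ α : ℝ} (hJ : 1 ≤ J₁) (hα : 0 < α) (hα2 : α < 3 / 5) {B : Finset ℤ}
    (hB : Irred B) {l : ℕ} (hl : 1 ≤ l) :
    ((DD B (128 * l ^ 3)).card : ℝ) * (l : ℝ) ^ α ≤ 4 * en J₁ α B := by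
  have hR : ((128 * l ^ 3 : ℕ) : ℤ) = 128 * (l : ℤ) ^ 3 := by push_cast; ring
  have hRl : 2 * (l : ℤ) < 128 * (l : ℤ) ^ 3 := by
    have : (l : ℤ) ≤ (l : ℤ) ^ 3 := by
      exact_mod_cast Nat.le_self_pow (by norm_num) l
    have : (1 : ℤ) ≤ l := by exact_mod_cast hl
    omega
  have key : ∀ d : ℤ, ∃ F' : Finset ℤ, d ∈ DD B (128 * l ^ 3) → F'.card = l ∧
      (∀ x ∈ F', d ≤ x ∧ ∀ d' ∈ DD B (128 * l ^ 3), d < d' → x < d') ∧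
      ∀ x ∈ F', ENNReal.ofReal (l * ((2 * l : ℕ) : ℝ) ^ (α - 2)) ≤ ph J₁ α B x := by
    intro d
    by_cases hd : d ∈ DD B (128 * l ^ 3)
    swap
    · exact ⟨∅, fun h => absurd h hd⟩
    obtain ⟨c, hdc, hnext, hcard⟩ := big_gap hB hl hd
    set F := (Finset.Ico d (c + 128 * (l : ℤ) ^ 3)).filter (fun x => sep B (d - 1) x) with hF
    obtain ⟨F', h1, h2, h3⟩ := init_seg F l hcard
    refine ⟨F', fun _ => ⟨h2, ?_, ?_⟩⟩
    · intro x hx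
      have := h1 hx
      rw [hF, Finset.mem_filter, Finset.mem_Ico] at this
      refine ⟨this.1.1, fun d' hd' hlt => ?_⟩
      have := hnext d' hd' hlt
      omega
    · intro x hx
      have hxF := h1 hx
      rw [hF, Finset.mem_filter, Finset.mem_Ico] at hxF
      apply ph_lb hJ hα2 (Y := Finset.Ico (x - 2 * l) x \ F.filter (· < x))
      · intro y hy
        rw [Finset.mem_sdiff, Finset.mem_Ico] at hy
        refine ⟨?_, by rw [abs_le]; push_cast; constructor <;> omega⟩
        have hny : ¬ sep B (d - 1) y := by
          by_cases hyd : y < d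
          · refine not_sep_of (a := d - 128 * (l : ℤ) ^ 3) (b := d - 1) ?_ (by omega) (by omega) (by omega) (by omega)
            intro f hf h4 h5
            have := (Finset.mem_filter.1 hd).2.2 f hf (by omega)
            omega
          · intro hs
            apply hy.2
            rw [Finset.mem_filter, hF, Finset.mem_filter, Finset.mem_Ico]
            exact ⟨⟨⟨by omega, by omega⟩, hs⟩, hy.1.2⟩
        exact sep_trans_not (sep_comm.1 hxF.2) hny
      · have h4 := Finset.le_card_sdiff (F.filter (· < x)) (Finset.Ico (x - 2 * l) x)
        rw [Int.card_Ico] at h4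
        have h5 := h3 x hx
        have : (x - (x - 2 * (l : ℤ))).toNat = 2 * l := by omega
        omega
  choose F' hF' using key
  have hdisj : ∀ d ∈ DD B (128 * l ^ 3), ∀ d' ∈ DD B (128 * l ^ 3), d ≠ d' → Disjoint (F' d) (F' d') := by
    intro d hd d' hd' hne
    rw [Finset.disjoint_left]
    intro x hx hx'
    have h1 := (hF' d hd).2.1 x hx
    have h2 := (hF' d' hd').2.1 x hx'
    rcases lt_or_gt_of_ne hne with h | h
    · have := h1.2 d' hd' h; omega
    · have := h2.2 d hd h; omega
  have hcard : ((DD B (128 * l ^ 3)).biUnion F').card = (DD B (128 * l ^ 3)).card * l := by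
    rw [Finset.card_biUnion hdisj, Finset.sum_congr rfl (fun d hd => (hF' d hd).1)]
    simp
  have hmain := card_le_en (J₁ := J₁) hα2 (B := B) (X := (DD B (128 * l ^ 3)).biUnion F')
    (c := l * ((2 * l : ℕ) : ℝ) ^ (α - 2)) (by positivity) (by
      intro x hx
      obtain ⟨d, hd, hx'⟩ := Finset.mem_biUnion.1 hx
      exact (hF' d hd).2.2 x hx')
  rw [hcard] at hmain
  push_cast at hmain
  have hl0 : (0 : ℝ) < l := by exact_mod_cast hl
  rw [Real.mul_rpow (by norm_num) hl0.le] at hmain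
  have h2 : (1 / 4 : ℝ) ≤ 2 ^ (α - 2) := by
    calc (1 / 4 : ℝ) = 2 ^ (-2 : ℝ) := by rw [Real.rpow_neg (by norm_num)]; norm_num
      _ ≤ _ := Real.rpow_le_rpow_of_exponent_le (by norm_num) (by linarith)
  have h3 : (l : ℝ) ^ α = l * l * (l : ℝ) ^ (α - 2) := by
    rw [Real.rpow_sub hl0]; 
    have : (l : ℝ) ^ (2 : ℝ) = l * l := by rw [Real.rpow_two]; ring
    rw [this]; field_simp
  rw [h3]
  have h4 : 0 ≤ ((DD B (128 * l ^ 3)).card : ℝ) * (l * l * (l : ℝ) ^ (α - 2)) := by positivity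
  nlinarith

end LR

namespace LR
open scoped symmDiff ENNReal

/-- gap preceding a wall -/
def gp (B : Finset ℤ) (d : ℤ) : ℤ :=
  if h : ((bd B).filter (· < d)).Nonempty then d - ((bd B).filter (· < d)).max' h else 0

lemma gp_nonneg (B : Finset ℤ) (d : ℤ) : 0 ≤ gp B d := by
  unfold gp
  split_ifs with h
  · have := Finset.max'_mem _ h
    rw [Finset.mem_filter] at this
    omega
  · rfl

lemma gp_DD {B : Finset ℤ} {d : ℤ} {R : ℕ} (hR : 0 < R) (hd : d ∈ bd B) (h : (R : ℤ) ≤ gp B d) : d ∈ DD B R := by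
  unfold gp at h
  split_ifs at h with h1
  · have := Finset.max'_mem _ h1
    rw [Finset.mem_filter] at this
    rw [DD, Finset.mem_filter]
    refine ⟨hd, ⟨_, this.1, this.2⟩, fun e he hed => ?_⟩
    have := Finset.le_max' ((bd B).filter (· < d)) e (Finset.mem_filter.2 ⟨he, hed⟩)
    omega
  · omega

/-- fourth root of two -/
def rr : ℝ := (2 : ℝ) ^ (1 / 4 : ℝ)

lemma rr_pow : rr ^ 4 = 2 := by
  unfold rr
  rw [← Real.rpow_natCast, ← Real.rpow_mul (by norm_num)]; norm_num

lemma rr_pos : 0 < rr := by unfold rr; positivity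

lemma rr_lb : 1.18 ≤ rr := by
  by_contra h
  push Not at h
  have h1 := rr_pow
  have := pow_lt_pow_left₀ h rr_pos.le (n := 4) (by norm_num)
  norm_num at this
  linarith

lemma rr_ub : rr ≤ 1.2 := by
  by_contra h
  push Not at h
  have h1 := rr_pow
  have := pow_lt_pow_left₀ h (by norm_num) (n := 4) (by norm_num)
  norm_num at this
  linarith

lemma gap_pow (M : ℕ) (g : ℝ) (hg0 : 0 ≤ g) (hg : g < 128 * 8 ^ M) :
    g ^ (1 / 12 : ℝ) ≤ 2 * (1 + ∑ m ∈ Finset.range M, if 128 * 8 ^ m ≤ g then rr ^ (m + 1) else 0) := by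
  have hr := rr_pos
  have hb : ∀ M : ℕ, g < 128 * 8 ^ M → g ^ (1 / 12 : ℝ) ≤ 2 * rr ^ M := by
    intro M hM
    have h8 : (8 : ℝ) = rr ^ 12 := by
      have : rr ^ 12 = (rr ^ 4) ^ 3 := by ring
      rw [this, rr_pow]; norm_num
    have h1 : g ≤ (2 * rr ^ M) ^ 12 := by
      refine hM.le.trans ?_
      rw [mul_pow, h8, ← pow_mul, ← pow_mul, mul_comm 12 M]
      gcongr; norm_num
    calc g ^ (1 / 12 : ℝ) ≤ ((2 * rr ^ M) ^ 12) ^ (1 / 12 : ℝ) := by gcongr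
      _ = 2 * rr ^ M := by
        rw [← Real.rpow_natCast, ← Real.rpow_mul (by positivity)]
        norm_num
  induction M with
  | zero => simpa using hb 0 hg
  | succ M ih =>
    rw [Finset.sum_range_succ]
    by_cases h : g < 128 * 8 ^ M
    · have := ih h
      rw [if_neg (by linarith)]; linarith
    · rw [if_pos (by linarith)]
      have h1 := hb (M + 1) hg
      have h2 : 0 ≤ ∑ m ∈ Finset.range M, if 128 * 8 ^ m ≤ g then rr ^ (m + 1) else 0 := by
        refine Finset.sum_nonneg fun m _ => ?_
        split_ifs <;> positivity
      linarith

lemma gap_sum {J₁ α : ℝ} (hJ : 1 ≤ J₁) (hα : 1 / 2 < α) (hα2 : α < 3 / 5) {B : Finset ℤ}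
    (hB : Irred B) : ∑ d ∈ bd B, (gp B d : ℝ) ^ (1 / 12 : ℝ) ≤ 70 * en J₁ α B := by
  have hr := rr_pos
  have hE := en_nonneg J₁ α B
  set N := ∑ d ∈ bd B, (gp B d).natAbs with hN
  have hM : ∀ d ∈ bd B, (gp B d : ℝ) < 128 * 8 ^ N := by
    intro d hd
    have h1 : (gp B d).natAbs ≤ N := Finset.single_le_sum (f := fun d => (gp B d).natAbs) (fun _ _ => Nat.zero_le _) hd
    have h2 : N < 8 ^ N := Nat.lt_pow_self (by norm_num)
    have h3 : gp B d < 128 * 8 ^ N := by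
      have : (N : ℤ) < 8 ^ N := by exact_mod_cast h2
      omega
    exact_mod_cast h3
  have h1 : ∑ d ∈ bd B, (gp B d : ℝ) ^ (1 / 12 : ℝ) ≤ ∑ d ∈ bd B,
      2 * (1 + ∑ m ∈ Finset.range N, if 128 * 8 ^ m ≤ (gp B d : ℝ) then rr ^ (m + 1) else 0) :=
    Finset.sum_le_sum fun d hd => gap_pow N _ (by exact_mod_cast gp_nonneg B d) (hM d hd)
  refine h1.trans ?_
  rw [← Finset.mul_sum, Finset.sum_add_distrib, Finset.sum_comm]
  have h2 : ∀ m ∈ Finset.range N, (∑ d ∈ bd B, if 128 * 8 ^ m ≤ (gp B d : ℝ) then rr ^ (m + 1) else 0)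
      ≤ 4 * en J₁ α B * rr * (rr⁻¹) ^ m := by
    intro m _
    have h3 : (∑ d ∈ bd B, if 128 * 8 ^ m ≤ (gp B d : ℝ) then rr ^ (m + 1) else 0)
        ≤ (DD B (128 * (2 ^ m) ^ 3)).card * rr ^ (m + 1) := by
      rw [← Finset.sum_filter, Finset.sum_const, nsmul_eq_mul]
      gcongr
      intro d hd
      rw [Finset.mem_filter] at hd
      apply gp_DD (by positivity) hd.1
      have h8 : (128 * (2 ^ m) ^ 3 : ℕ) = 128 * 8 ^ m := by
        rw [← pow_mul, mul_comm m 3, pow_mul]; norm_num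
      rw [h8]
      have := hd.2
      have h9 : ((128 * 8 ^ m : ℕ) : ℝ) ≤ (gp B d : ℝ) := by push_cast; exact this
      exact_mod_cast h9
    have h4 := count_gap (J₁ := J₁) hJ (by linarith) hα2 hB (l := 2 ^ m) Nat.one_le_two_pow
    have h5 : rr ^ (2 * m) ≤ (((2 ^ m : ℕ) : ℝ)) ^ α := by
      calc rr ^ (2 * m) = (((2 ^ m : ℕ) : ℝ)) ^ (1 / 2 : ℝ) := by
            push_cast
            have : (2 : ℝ) ^ m = (rr ^ (2 * m)) ^ 2 := by
              rw [← pow_mul, ← rr_pow, ← pow_mul]; congr 1; ring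
            rw [this, ← Real.sqrt_eq_rpow, Real.sqrt_sq (by positivity)]
        _ ≤ _ := by
            apply Real.rpow_le_rpow_of_exponent_le _ hα.le
            exact_mod_cast Nat.one_le_two_pow
    have h6 : ((DD B (128 * (2 ^ m) ^ 3)).card : ℝ) * rr ^ (2 * m) ≤ 4 * en J₁ α B :=
      (mul_le_mul_of_nonneg_left h5 (by positivity)).trans h4
    refine h3.trans ?_
    calc ((DD B (128 * (2 ^ m) ^ 3)).card : ℝ) * rr ^ (m + 1)
        = ((DD B (128 * (2 ^ m) ^ 3)).card : ℝ) * rr ^ (2 * m) * (rr * rr⁻¹ ^ m) := by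
          rw [inv_pow]; field_simp; ring
      _ ≤ 4 * en J₁ α B * (rr * rr⁻¹ ^ m) := by gcongr
      _ = _ := by ring
  have h3 := Finset.sum_le_sum h2
  rw [← Finset.mul_sum] at h3
  have hr1 : rr⁻¹ < 1 := inv_lt_one_of_one_lt₀ (by linarith [rr_lb])
  have h4 : ∑ m ∈ Finset.range N, rr⁻¹ ^ m ≤ (1 - rr⁻¹)⁻¹ := by
    rw [← tsum_geometric_of_lt_one (by positivity) hr1]
    exact (summable_geometric_of_lt_one (by positivity) hr1).sum_le_tsum _ (fun _ _ => by positivity)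
  have h5 : rr * (1 - rr⁻¹)⁻¹ ≤ 8 := by
    have : (1 - rr⁻¹)⁻¹ = rr / (rr - 1) := by
      have : rr - 1 ≠ 0 := by linarith [rr_lb]
      field_simp
    rw [this, ← mul_div_assoc, div_le_iff₀ (by linarith [rr_lb])]
    nlinarith [rr_lb, rr_ub]
  have h6 := bd_le_en (J₁ := J₁) (by linarith) hα2 B
  have h7 : ((bd B).card : ℝ) ≤ en J₁ α B := by
    have : (0 : ℝ) ≤ (bd B).card := by positivity
    nlinarith
  have h8 : 4 * en J₁ α B * rr * ∑ m ∈ Finset.range N, rr⁻¹ ^ m ≤ 4 * en J₁ α B * 8 := by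
    calc _ ≤ 4 * en J₁ α B * rr * (1 - rr⁻¹)⁻¹ := by gcongr
      _ = 4 * en J₁ α B * (rr * (1 - rr⁻¹)⁻¹) := by ring
      _ ≤ _ := by gcongr
  simp only [Finset.sum_const, nsmul_eq_mul, mul_one]
  linarith

/-- potential -/
def GG (B : Finset ℤ) (d : ℤ) : ℝ := ∑ e ∈ (bd B).filter (· ≤ d), (gp B e : ℝ) ^ (1 / 12 : ℝ)

lemma gp_pow_nonneg (B : Finset ℤ) (e : ℤ) : 0 ≤ (gp B e : ℝ) ^ (1 / 12 : ℝ) :=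
  Real.rpow_nonneg (by exact_mod_cast gp_nonneg B e) _

lemma GG_nonneg (B : Finset ℤ) (d : ℤ) : 0 ≤ GG B d :=
  Finset.sum_nonneg fun e _ => gp_pow_nonneg B e

lemma GG_le (B : Finset ℤ) (d : ℤ) : GG B d ≤ ∑ e ∈ bd B, (gp B e : ℝ) ^ (1 / 12 : ℝ) :=
  Finset.sum_le_sum_of_subset_of_nonneg (Finset.filter_subset _ _) fun e _ _ => gp_pow_nonneg B e

lemma GG_step (B : Finset ℤ) {d : ℤ} (hd : d ∈ bd B) (n : ℕ) :
    ∀ d' ∈ bd B, d ≤ d' → (d' - d).toNat ≤ n → ((d' - d : ℤ) : ℝ) ^ (1 / 12 : ℝ) ≤ GG B d' - GG B d := by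
  induction n with
  | zero =>
    intro d' _ h1 h2
    have : d' = d := by omega
    subst this
    simp
  | succ n ih =>
    intro d' hd' h1 h2
    rcases h1.eq_or_lt with h | hlt
    · subst h; simp
    have hne : ((bd B).filter (· < d')).Nonempty := ⟨d, Finset.mem_filter.2 ⟨hd, hlt⟩⟩
    set e := ((bd B).filter (· < d')).max' hne with he
    have hem := Finset.max'_mem _ hne
    rw [← he, Finset.mem_filter] at hem
    have hde : d ≤ e := Finset.le_max' _ d (Finset.mem_filter.2 ⟨hd, hlt⟩)
    have h3 := ih e hem.1 hde (by omega)
    have hgp : gp B d' = d' - e := by unfold gp; rw [dif_pos hne]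
    have hG : GG B d' = GG B e + (gp B d' : ℝ) ^ (1 / 12 : ℝ) := by
      unfold GG
      have : (bd B).filter (· ≤ d') = insert d' ((bd B).filter (· ≤ e)) := by
        ext x
        simp only [Finset.mem_filter, Finset.mem_insert]
        constructor
        · rintro ⟨hx, hxd⟩
          rcases hxd.eq_or_lt with h | h
          · exact Or.inl h
          · exact Or.inr ⟨hx, Finset.le_max' _ x (Finset.mem_filter.2 ⟨hx, h⟩)⟩
        · rintro (rfl | ⟨hx, hxe⟩)
          · exact ⟨hd', le_rfl⟩
          · exact ⟨hx, by omega⟩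
      rw [this, Finset.sum_insert, add_comm]
      simp only [Finset.mem_filter, not_and]
      intro _; omega
    rw [hG, hgp]
    have h4 : ((d' - d : ℤ) : ℝ) = ((d' - e : ℤ) : ℝ) + ((e - d : ℤ) : ℝ) := by push_cast; ring
    rw [h4]
    have := Real.rpow_add_le_add_rpow (p := (1 / 12 : ℝ)) (a := ((d' - e : ℤ) : ℝ)) (b := ((e - d : ℤ) : ℝ))
      (by exact_mod_cast (by omega)) (by exact_mod_cast (by omega)) (by norm_num) (by norm_num)
    linarith

lemma GG_diff (B : Finset ℤ) {d d' : ℤ} (hd : d ∈ bd B) (hd' : d' ∈ bd B) (h : d ≤ d') :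
    ((d' - d : ℤ) : ℝ) ^ (1 / 12 : ℝ) ≤ GG B d' - GG B d := GG_step B hd _ d' hd' h le_rfl

end LR

namespace LR
open scoped symmDiff ENNReal

/-- number of points in a block -/
def nb (s : ℕ) (B : Finset ℤ) (k : ℤ) : ℕ := (B.filter (fun x => x / 2 ^ s = k)).card

/-- coarse grained set -/
def cs (s : ℕ) (B : Finset ℤ) : Finset ℤ :=
  (B.image (fun x => x / 2 ^ s)).filter (fun k => 2 ^ s ≤ 2 * nb s B k)

/-- expansion of a coarse set -/
def ex (s : ℕ) (K : Finset ℤ) : Finset ℤ :=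
  K.biUnion (fun k => Finset.Ico (k * 2 ^ s) ((k + 1) * 2 ^ s))

lemma div_eq_iff' (s : ℕ) (x k : ℤ) : x / 2 ^ s = k ↔ k * 2 ^ s ≤ x ∧ x < (k + 1) * 2 ^ s := by
  have hp : (0 : ℤ) < 2 ^ s := by positivity
  constructor
  · rintro rfl
    constructor
    · exact (Int.le_ediv_iff_mul_le hp).1 le_rfl
    · exact (Int.ediv_lt_iff_lt_mul hp).1 (by omega)
  · rintro ⟨h1, h2⟩
    have h3 := (Int.le_ediv_iff_mul_le hp).2 h1
    have h4 := (Int.ediv_lt_iff_lt_mul hp).2 h2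
    omega

lemma mem_cs {s : ℕ} {B : Finset ℤ} {k : ℤ} : k ∈ cs s B ↔ 2 ^ s ≤ 2 * nb s B k := by
  unfold cs
  rw [Finset.mem_filter]
  refine ⟨fun h => h.2, fun h => ⟨?_, h⟩⟩
  have : 0 < nb s B k := by
    have : 0 < 2 ^ s := by positivity
    omega
  obtain ⟨x, hx⟩ := Finset.card_pos.1 this
  rw [Finset.mem_filter] at hx
  exact Finset.mem_image.2 ⟨x, hx.1, hx.2⟩

lemma mem_ex {s : ℕ} {K : Finset ℤ} {x : ℤ} : x ∈ ex s K ↔ x / 2 ^ s ∈ K := by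
  unfold ex
  rw [Finset.mem_biUnion]
  constructor
  · rintro ⟨k, hk, hx⟩
    rw [Finset.mem_Ico, ← div_eq_iff'] at hx
    rwa [hx]
  · intro h
    exact ⟨_, h, by rw [Finset.mem_Ico, ← div_eq_iff']⟩

lemma ex_cs_zero (B : Finset ℤ) : ex 0 (cs 0 B) = B := by
  ext x
  rw [mem_ex, mem_cs]
  simp only [pow_zero, Int.ediv_one, nb]
  constructor
  · intro h
    have : 0 < (B.filter (fun y => y = x)).card := by omega
    obtain ⟨y, hy⟩ := Finset.card_pos.1 this
    rw [Finset.mem_filter] at hy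
    rw [← hy.2]; exact hy.1
  · intro h
    have : 0 < (B.filter (fun y => y = x)).card := Finset.card_pos.2 ⟨x, by simp [h]⟩
    omega

lemma cs_empty {s : ℕ} {B : Finset ℤ} (h : 2 * B.card < 2 ^ s) : cs s B = ∅ := by
  rw [Finset.eq_empty_iff_forall_notMem]
  intro k hk
  rw [mem_cs] at hk
  have : nb s B k ≤ B.card := Finset.card_filter_le _ _
  omega

/-- a block as a finset -/
def blk (s : ℕ) (k : ℤ) : Finset ℤ := Finset.Ico (k * 2 ^ s) ((k + 1) * 2 ^ s)

lemma mem_blk {s : ℕ} {k x : ℤ} : x ∈ blk s k ↔ x / 2 ^ s = k := by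
  rw [blk, Finset.mem_Ico, ← div_eq_iff']

lemma card_blk (s : ℕ) (k : ℤ) : (blk s k).card = 2 ^ s := by
  rw [blk, Int.card_Ico]
  have : (k + 1) * 2 ^ s - k * 2 ^ s = ((2 ^ s : ℕ) : ℤ) := by push_cast; ring
  rw [this]; exact Int.toNat_natCast _

lemma nb_eq (s : ℕ) (B : Finset ℤ) (k : ℤ) : ((blk s k).filter (· ∈ B)).card = nb s B k := by
  unfold nb
  congr 1
  ext x
  simp only [Finset.mem_filter, mem_blk]
  tauto

lemma nb_compl (s : ℕ) (B : Finset ℤ) (k : ℤ) :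
    ((blk s k).filter (· ∉ B)).card + nb s B k = 2 ^ s := by
  rw [← nb_eq, ← card_blk s k, add_comm]
  exact Finset.card_filter_add_card_filter_not (s := blk s k) (· ∈ B)

/-- both sides of a coarse wall -/
lemma coarse_wall {s : ℕ} {B : Finset ℤ} {k : ℤ} (hk : k ∈ bd (cs s B)) :
    ∃ U V : Finset ℤ, U ⊆ blk s k ∧ V ⊆ blk s (k - 1) ∧ 2 ^ s ≤ 2 * U.card ∧ 2 ^ s ≤ 2 * V.card ∧
      ∀ x ∈ U, ∀ y ∈ V, sep B x y := by
  rw [mem_bd] at hk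
  unfold sep at hk
  rw [mem_cs, mem_cs] at hk
  by_cases h : 2 ^ s ≤ 2 * nb s B k
  · have h2 : ¬ 2 ^ s ≤ 2 * nb s B (k - 1) := by tauto
    refine ⟨(blk s k).filter (· ∈ B), (blk s (k - 1)).filter (· ∉ B), Finset.filter_subset _ _,
      Finset.filter_subset _ _, ?_, ?_, ?_⟩
    · rw [nb_eq]; exact h
    · have := nb_compl s B (k - 1); omega
    · intro x hx y hy
      rw [Finset.mem_filter] at hx hy
      unfold sep; tauto
  · have h2 : 2 ^ s ≤ 2 * nb s B (k - 1) := by tauto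
    refine ⟨(blk s k).filter (· ∉ B), (blk s (k - 1)).filter (· ∈ B), Finset.filter_subset _ _,
      Finset.filter_subset _ _, ?_, ?_, ?_⟩
    · have := nb_compl s B k; omega
    · rw [nb_eq]; exact h2
    · intro x hx y hy
      rw [Finset.mem_filter] at hx hy
      unfold sep; tauto

lemma coarse_count {J₁ α : ℝ} (hJ : 1 ≤ J₁) (hα : 0 < α) (hα2 : α < 3 / 5) (s : ℕ) (B : Finset ℤ) :
    ((bd (cs s B)).card : ℝ) * ((2 : ℝ) ^ s) ^ α ≤ 16 * en J₁ α B := by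
  have key : ∀ k : ℤ, ∃ U : Finset ℤ, k ∈ bd (cs s B) → U ⊆ blk s k ∧ 2 ^ s ≤ 2 * U.card ∧
      ∀ x ∈ U, ENNReal.ofReal (((2 : ℝ) ^ s / 2) * (2 * (2 : ℝ) ^ s) ^ (α - 2)) ≤ ph J₁ α B x := by
    intro k
    by_cases hk : k ∈ bd (cs s B)
    swap
    · exact ⟨∅, fun h => absurd h hk⟩
    obtain ⟨U, V, h1, h2, h3, h4, h5⟩ := coarse_wall hk
    refine ⟨U, fun _ => ⟨h1, h3, fun x hx => ?_⟩⟩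
    have h6 := ph_lb (J₁ := J₁) hJ hα2 (B := B) (Y := V) (x := x) (r := 2 * 2 ^ s) (k := V.card) (by
      intro y hy
      refine ⟨h5 x hx y hy, ?_⟩
      have e1 := h1 hx
      have e2 := h2 hy
      rw [blk, Finset.mem_Ico] at e1 e2
      rw [abs_le]
      push_cast
      constructor <;> nlinarith) le_rfl
    refine le_trans ?_ h6
    apply ENNReal.ofReal_le_ofReal
    push_cast
    gcongr
    have : ((2 ^ s : ℕ) : ℝ) ≤ ((2 * V.card : ℕ) : ℝ) := by exact_mod_cast h4
    push_cast at this
    linarith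
  choose U hU using key
  have hdisj : ∀ k ∈ bd (cs s B), ∀ k' ∈ bd (cs s B), k ≠ k' → Disjoint (U k) (U k') := by
    intro k hk k' hk' hne
    rw [Finset.disjoint_left]
    intro x hx hx'
    have h1 := mem_blk.1 ((hU k hk).1 hx)
    have h2 := mem_blk.1 ((hU k' hk').1 hx')
    exact hne (h1.symm.trans h2)
  have hcard : ((bd (cs s B)).card : ℝ) * ((2 : ℝ) ^ s / 2) ≤ (((bd (cs s B)).biUnion U).card : ℝ) := by
    rw [Finset.card_biUnion hdisj, ← nsmul_eq_mul, ← Finset.sum_const]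
    push_cast
    refine Finset.sum_le_sum fun k hk => ?_
    have : ((2 ^ s : ℕ) : ℝ) ≤ ((2 * (U k).card : ℕ) : ℝ) := by exact_mod_cast (hU k hk).2.1
    push_cast at this
    linarith
  have hmain := card_le_en (J₁ := J₁) hα2 (B := B) (X := (bd (cs s B)).biUnion U)
    (c := ((2 : ℝ) ^ s / 2) * (2 * (2 : ℝ) ^ s) ^ (α - 2)) (by positivity) (by
      intro x hx
      obtain ⟨d, hd, hx'⟩ := Finset.mem_biUnion.1 hx
      exact (hU d hd).2.2 x hx')
  set T : ℝ := (2 : ℝ) ^ s with hT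
  have hT0 : 0 < T := by positivity
  rw [Real.mul_rpow (by norm_num) hT0.le] at hmain
  have h2 : (1 / 4 : ℝ) ≤ 2 ^ (α - 2) := by
    calc (1 / 4 : ℝ) = 2 ^ (-2 : ℝ) := by rw [Real.rpow_neg (by norm_num)]; norm_num
      _ ≤ _ := Real.rpow_le_rpow_of_exponent_le (by norm_num) (by linarith)
  have h3 : T ^ α = T * T * T ^ (α - 2) := by
    rw [Real.rpow_sub hT0]
    have : T ^ (2 : ℝ) = T * T := by rw [Real.rpow_two]; ring
    rw [this]; field_simp
  have h5 : 0 ≤ T ^ (α - 2) := by positivity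
  have h6 : ((bd (cs s B)).card : ℝ) * (T / 2) * (T / 2 * (1 / 4 * T ^ (α - 2))) ≤ en J₁ α B := by
    refine le_trans ?_ hmain
    gcongr
  rw [h3]
  linarith

/-- coarse grained version at scale `s` -/
def XS (s : ℕ) (B : Finset ℤ) : Finset ℤ := ex s (cs s B)

lemma div_succ (s : ℕ) (x : ℤ) : x / 2 ^ (s + 1) = (x / 2 ^ s) / 2 := by
  rw [Int.ediv_ediv_of_nonneg (by positivity), pow_succ]

lemma nb_succ (s : ℕ) (B : Finset ℤ) (k : ℤ) : nb (s + 1) B k = nb s B (2 * k) + nb s B (2 * k + 1) := by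
  unfold nb
  rw [← Finset.card_union_of_disjoint]
  · congr 1
    ext x
    simp only [Finset.mem_filter, Finset.mem_union, div_succ]
    constructor
    · rintro ⟨h1, h2⟩
      have : x / 2 ^ s = 2 * k ∨ x / 2 ^ s = 2 * k + 1 := by omega
      tauto
    · rintro (⟨h1, h2⟩ | ⟨h1, h2⟩) <;> exact ⟨h1, by omega⟩
  · rw [Finset.disjoint_left]
    intro x h1 h2
    rw [Finset.mem_filter] at h1 h2
    omega

lemma XS_step_sub (s : ℕ) (B : Finset ℤ) :
    XS s B ∆ XS (s + 1) B ⊆ (bd (cs s B)).biUnion (fun j => blk s (j - 1) ∪ blk s j) := by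
  intro x hx
  have hsep : sep (cs s B) (2 * (x / 2 ^ (s + 1))) (2 * (x / 2 ^ (s + 1)) + 1) := by
    intro hiff
    rw [Finset.mem_symmDiff] at hx
    unfold XS at hx
    rw [mem_ex, mem_ex] at hx
    set k := x / 2 ^ (s + 1) with hk
    have hk2 : x / 2 ^ s = 2 * k ∨ x / 2 ^ s = 2 * k + 1 := by
      rw [hk, div_succ]; omega
    have h1 : x / 2 ^ s ∈ cs s B ↔ 2 * k ∈ cs s B := by
      rcases hk2 with h | h <;> rw [h]
      exact hiff.symm
    have h2 : k ∈ cs (s + 1) B ↔ 2 * k ∈ cs s B := by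
      rw [mem_cs] 
      rw [mem_cs, mem_cs] at hiff
      rw [mem_cs, nb_succ, pow_succ]
      constructor
      · intro h; by_contra h'
        have : ¬ 2 ^ s ≤ 2 * nb s B (2 * k + 1) := by tauto
        omega
      · intro h
        have : 2 ^ s ≤ 2 * nb s B (2 * k + 1) := by tauto
        omega
    rw [h1, h2] at hx
    tauto
  set k := x / 2 ^ (s + 1) with hk
  rw [Finset.mem_biUnion]
  refine ⟨2 * k + 1, mem_bd.2 (by simpa using hsep), ?_⟩
  rw [Finset.mem_union, mem_blk, mem_blk]
  rw [hk, div_succ]; omega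

lemma XS_card {J₁ α : ℝ} (hJ : 1 ≤ J₁) (hα : 0 < α) (hα2 : α < 3 / 5) (s : ℕ) (B : Finset ℤ) :
    ((XS s B ∆ XS (s + 1) B).card : ℝ) * ((2 : ℝ) ^ s) ^ α ≤ 32 * en J₁ α B * 2 ^ s := by
  have h1 := (Finset.card_le_card (XS_step_sub s B)).trans Finset.card_biUnion_le
  have h2 : ∑ j ∈ bd (cs s B), (blk s (j - 1) ∪ blk s j).card ≤ ∑ j ∈ bd (cs s B), 2 * 2 ^ s := by
    refine Finset.sum_le_sum fun j _ => (Finset.card_union_le _ _).trans ?_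
    rw [card_blk, card_blk]; omega
  have h3 := h1.trans h2
  rw [Finset.sum_const, smul_eq_mul] at h3
  have h4 : ((XS s B ∆ XS (s + 1) B).card : ℝ) ≤ (bd (cs s B)).card * (2 * 2 ^ s) := by exact_mod_cast h3
  have h5 := coarse_count hJ hα hα2 s B
  calc _ ≤ (bd (cs s B)).card * (2 * 2 ^ s) * ((2 : ℝ) ^ s) ^ α := by gcongr
    _ = ((bd (cs s B)).card * ((2 : ℝ) ^ s) ^ α) * (2 * 2 ^ s) := by ring
    _ ≤ 16 * en J₁ α B * (2 * 2 ^ s) := by gcongr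
    _ = _ := by ring

lemma XS_ne {J₁ α : ℝ} (hJ : 1 ≤ J₁) (hα : 0 < α) (hα2 : α < 3 / 5) (s : ℕ) (B : Finset ℤ)
    (h : XS s B ∆ XS (s + 1) B ≠ ∅) : ((2 : ℝ) ^ s) ^ α ≤ 16 * en J₁ α B := by
  obtain ⟨x, hx⟩ := Finset.nonempty_iff_ne_empty.2 h
  obtain ⟨j, hj, _⟩ := Finset.mem_biUnion.1 (XS_step_sub s B hx)
  have h1 : 1 ≤ (bd (cs s B)).card := Finset.card_pos.2 ⟨j, hj⟩
  have h2 : (1 : ℝ) ≤ (bd (cs s B)).card := by exact_mod_cast h1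
  have h3 := coarse_count hJ hα hα2 s B
  have h4 : 0 ≤ ((2 : ℝ) ^ s) ^ α := by positivity
  nlinarith

lemma XS_zero (B : Finset ℤ) : XS 0 B = B := ex_cs_zero B

lemma XS_empty {s : ℕ} {B : Finset ℤ} (h : 2 * B.card < 2 ^ s) : XS s B = ∅ := by
  unfold XS; rw [cs_empty h]; rfl

end LR

namespace LR
open scoped symmDiff ENNReal

/-- weight of a list of walls -/
def wt : ℤ → List ℤ → ℝ
  | _, [] => 0
  | p, q :: l => (Real.log 8 + 2 * Real.log (1 + |((q - p : ℤ) : ℝ)|)) + wt q l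

/-- entropy weight of a set -/
def WW (K : Finset ℤ) : ℝ := wt 0 ((bd K).sort (· ≤ ·))

lemma wt_nonneg (l : List ℤ) : ∀ p, 0 ≤ wt p l := by
  induction l with
  | nil => intro p; simp [wt]
  | cons q l ih =>
    intro p
    have h1 := ih q
    have h2 : 0 ≤ Real.log (1 + |((q - p : ℤ) : ℝ)|) := Real.log_nonneg (by
      have := abs_nonneg ((q - p : ℤ) : ℝ); linarith)
    have h3 : 0 ≤ Real.log 8 := Real.log_nonneg (by norm_num)
    simp only [wt]; linarith

lemma WW_nonneg (K : Finset ℤ) : 0 ≤ WW K := wt_nonneg _ _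

lemma WW_empty : WW ∅ = 0 := by
  unfold WW
  have : bd ∅ = ∅ := by
    rw [Finset.eq_empty_iff_forall_notMem]
    intro x hx
    rw [mem_bd] at hx
    simp [sep] at hx
  rw [this]; simp [wt]

/-- lists with bounded length -/
def LL (Q : Finset ℤ) : ℕ → Finset (List ℤ)
  | 0 => {[]}
  | n + 1 => insert [] ((Q ×ˢ LL Q n).image (fun a => a.1 :: a.2))

lemma mem_LL (Q : Finset ℤ) (n : ℕ) : ∀ l : List ℤ, l.length ≤ n → (∀ x ∈ l, x ∈ Q) → l ∈ LL Q n := by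
  induction n with
  | zero =>
    intro l hl _
    have : l = [] := by
      rw [← List.length_eq_zero_iff]; omega
    simp [LL, this]
  | succ n ih =>
    intro l hl hQ
    cases l with
    | nil => simp [LL]
    | cons a l =>
      simp only [LL, Finset.mem_insert, Finset.mem_image, Finset.mem_product]
      right
      refine ⟨(a, l), ⟨hQ a (by simp), ih l ?_ ?_⟩, rfl⟩
      · simpa using hl
      · intro x hx; exact hQ x (by simp [hx])

lemma sum_sq_nat (A : Finset ℕ) : ∑ m ∈ A, 1 / ((m : ℝ) + 1) ^ 2 ≤ 2 := by
  have hsub : A ⊆ Finset.range (A.sup id + 1) := by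
    intro m hm
    rw [Finset.mem_range]
    have : id m ≤ _ := Finset.le_sup hm
    simp only [id] at this
    exact Nat.lt_succ_of_le this
  refine (Finset.sum_le_sum_of_subset_of_nonneg hsub (fun _ _ _ => by positivity)).trans ?_
  refine (sum_inv_sq _).trans ?_
  have : (0 : ℝ) ≤ 1 / ((A.sup id + 1 : ℕ) : ℝ) := by positivity
  linarith

lemma sum_sq_int (p : ℤ) (Q : Finset ℤ) : ∑ q ∈ Q, 1 / (1 + |((q - p : ℤ) : ℝ)|) ^ 2 ≤ 4 := by
  rw [← Finset.sum_filter_add_sum_filter_not Q (fun q => p ≤ q)]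
  have h1 : ∑ q ∈ Q.filter (fun q => p ≤ q), 1 / (1 + |((q - p : ℤ) : ℝ)|) ^ 2 ≤ 2 := by
    have hinj : Set.InjOn (fun q : ℤ => (q - p).natAbs) (Q.filter (fun q => p ≤ q)) := by
      intro a ha b hb hab
      simp only [Finset.coe_filter, Set.mem_ofPred_eq] at ha hb hab
      omega
    have := sum_sq_nat ((Q.filter (fun q => p ≤ q)).image (fun q : ℤ => (q - p).natAbs))
    rw [Finset.sum_image hinj] at this
    refine le_trans (le_of_eq ?_) this
    refine Finset.sum_congr rfl fun q _ => ?_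
    rw [natAbs_cast, add_comm]
  have h2 : ∑ q ∈ Q.filter (fun q => ¬ p ≤ q), 1 / (1 + |((q - p : ℤ) : ℝ)|) ^ 2 ≤ 2 := by
    have hinj : Set.InjOn (fun q : ℤ => (q - p).natAbs) (Q.filter (fun q => ¬ p ≤ q)) := by
      intro a ha b hb hab
      simp only [Finset.coe_filter, Set.mem_ofPred_eq] at ha hb hab
      omega
    have := sum_sq_nat ((Q.filter (fun q => ¬ p ≤ q)).image (fun q : ℤ => (q - p).natAbs))
    rw [Finset.sum_image hinj] at this
    refine le_trans (le_of_eq ?_) this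
    refine Finset.sum_congr rfl fun q _ => ?_
    rw [natAbs_cast, add_comm]
  linarith

lemma exp_cost (x : ℝ) : Real.exp (-(Real.log 8 + 2 * Real.log (1 + |x|))) = 1 / 8 * (1 / (1 + |x|) ^ 2) := by
  have h : 0 < 1 + |x| := by positivity
  rw [Real.exp_neg, Real.exp_add, Real.exp_log (by norm_num), two_mul, Real.exp_add, Real.exp_log h]
  field_simp

lemma LL_sum (Q : Finset ℤ) (n : ℕ) : ∀ p, ∑ l ∈ LL Q n, Real.exp (-wt p l) ≤ 2 := by
  induction n with
  | zero => intro p; simp [LL, wt]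
  | succ n ih =>
    intro p
    simp only [LL]
    rw [Finset.sum_insert (by simp)]
    rw [Finset.sum_image (by
      rintro ⟨a, l⟩ _ ⟨b, l'⟩ _ h
      simpa using h)]
    rw [Finset.sum_product]
    have h1 : ∀ q ∈ Q, ∑ l ∈ LL Q n, Real.exp (-wt p (q :: l)) ≤
        1 / 4 * (1 / (1 + |((q - p : ℤ) : ℝ)|) ^ 2) := by
      intro q _
      have : ∀ l, Real.exp (-wt p (q :: l)) =
          1 / 8 * (1 / (1 + |((q - p : ℤ) : ℝ)|) ^ 2) * Real.exp (-wt q l) := by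
        intro l
        simp only [wt]
        rw [neg_add, Real.exp_add, exp_cost]
      simp only [this]
      rw [← Finset.mul_sum]
      have h2 := ih q
      have h3 : 0 ≤ 1 / 8 * (1 / (1 + |((q - p : ℤ) : ℝ)|) ^ 2) := by positivity
      nlinarith
    have h2 := Finset.sum_le_sum h1
    rw [← Finset.mul_sum] at h2
    have h3 := sum_sq_int p Q
    simp only [wt]
    simp only [wt] at h2
    norm_num at h2 h3 ⊢
    linarith

lemma bd_inj {K K' : Finset ℤ} (h : bd K = bd K') : K = K' := by
  by_contra hne
  have h1 : (K ∆ K').Nonempty := by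
    rw [Finset.nonempty_iff_ne_empty]
    intro h0
    exact hne (symmDiff_eq_bot.1 h0)
  obtain ⟨d, hd⟩ := bd_nonempty h1
  rw [mem_bd, sep_symmDiff, ← mem_bd, ← mem_bd, h] at hd
  exact hd Iff.rfl

lemma WW_sum (𝒦 : Finset (Finset ℤ)) : ∑ K ∈ 𝒦, Real.exp (-WW K) ≤ 2 := by
  have hinj : Set.InjOn (fun K : Finset ℤ => (bd K).sort (· ≤ ·)) 𝒦 := by
    intro K _ K' _ h
    apply bd_inj
    rw [← Finset.sort_toFinset (bd K) (· ≤ ·), ← Finset.sort_toFinset (bd K') (· ≤ ·)]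
    simp only at h
    rw [h]
  have h1 : ∑ K ∈ 𝒦, Real.exp (-WW K)
      = ∑ l ∈ 𝒦.image (fun K : Finset ℤ => (bd K).sort (· ≤ ·)), Real.exp (-wt 0 l) := by
    rw [Finset.sum_image hinj]; rfl
  rw [h1]
  refine le_trans ?_ (LL_sum (𝒦.biUnion bd) (∑ K ∈ 𝒦, (bd K).card) 0)
  refine Finset.sum_le_sum_of_subset_of_nonneg ?_ (fun _ _ _ => (Real.exp_pos _).le)
  intro l hl
  obtain ⟨K, hK, rfl⟩ := Finset.mem_image.1 hl
  apply mem_LL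
  · rw [Finset.length_sort]
    exact Finset.single_le_sum (f := fun K => (bd K).card) (fun _ _ => Nat.zero_le _) hK
  · intro x hx
    rw [Finset.mem_sort] at hx
    exact Finset.mem_biUnion.2 ⟨K, hK, hx⟩

lemma log_bound {x T : ℝ} (hx : 0 ≤ x) (hT : 1 ≤ T) :
    Real.log (1 + x) ≤ 12 * (Real.log (1 + T) + x ^ (1 / 12 : ℝ) / T) := by
  set y := x ^ (1 / 12 : ℝ) with hy
  have hy0 : 0 ≤ y := by positivity
  have hxy : x = y ^ 12 := by
    rw [hy, ← Real.rpow_natCast, ← Real.rpow_mul hx]; norm_num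
  have h1 : 1 + x ≤ (1 + y) ^ 12 := by
    rw [hxy]
    nlinarith [pow_nonneg hy0 2, pow_nonneg hy0 3, pow_nonneg hy0 4, pow_nonneg hy0 5, pow_nonneg hy0 6,
      pow_nonneg hy0 7, pow_nonneg hy0 8, pow_nonneg hy0 9, pow_nonneg hy0 10, pow_nonneg hy0 11]
  have h2 : 1 + y ≤ (1 + T) * (1 + y / T) := by
    have : (1 + T) * (1 + y / T) = 1 + y + T + y / T := by field_simp; ring
    rw [this]
    have : 0 ≤ y / T := by positivity
    linarith
  calc Real.log (1 + x) ≤ Real.log ((1 + y) ^ 12) := Real.log_le_log (by linarith) h1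
    _ = 12 * Real.log (1 + y) := by rw [Real.log_pow]; norm_num
    _ ≤ 12 * Real.log ((1 + T) * (1 + y / T)) := by
        gcongr
    _ = 12 * (Real.log (1 + T) + Real.log (1 + y / T)) := by
        rw [Real.log_mul (by positivity) (by positivity)]
    _ ≤ _ := by
        gcongr
        have := Real.log_le_sub_one_of_pos (x := 1 + y / T) (by positivity)
        linarith

/-- cost of a single step -/
lemma cost_bound (s : ℕ) {k x : ℤ} (hx : 0 ≤ x) (h : |k| * 2 ^ s ≤ x + 2 * 2 ^ s) :
    Real.log 8 + 2 * Real.log (1 + |(k : ℝ)|) ≤ 29 * (s + 1) + 24 / 2 ^ s * (x : ℝ) ^ (1 / 12 : ℝ) := by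
  have hT : (1 : ℝ) ≤ 2 ^ s := one_le_pow₀ (by norm_num)
  set T : ℝ := 2 ^ s with hTdef
  have hx' : (0 : ℝ) ≤ x := by exact_mod_cast hx
  have h1 : |(k : ℝ)| * T ≤ x + 2 * T := by
    have : ((|k| * 2 ^ s : ℤ) : ℝ) ≤ ((x + 2 * 2 ^ s : ℤ) : ℝ) := by exact_mod_cast h
    push_cast at this
    exact this
  have h2 : 1 + |(k : ℝ)| ≤ 3 * (1 + x) := by
    have : |(k : ℝ)| ≤ x / T + 2 := by
      rw [div_add' _ _ _ (by positivity), le_div_iff₀ (by positivity)]; exact h1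
    have : (x : ℝ) / T ≤ x := div_le_self hx' hT
    linarith
  have h3 : Real.log (1 + |(k : ℝ)|) ≤ Real.log 3 + Real.log (1 + x) := by
    rw [← Real.log_mul (by norm_num) (by positivity)]
    exact Real.log_le_log (by positivity) h2
  have h4 := log_bound hx' hT
  have h5 : Real.log (1 + T) ≤ s + 1 := by
    calc Real.log (1 + T) ≤ Real.log (2 ^ (s + 1)) := by
          apply Real.log_le_log (by positivity)
          rw [pow_succ]; linarith
      _ = (s + 1) * Real.log 2 := by rw [Real.log_pow]; push_cast; ring
      _ ≤ (s + 1) * 1 := by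
          gcongr
          have := Real.log_two_lt_d9; linarith
      _ = _ := by ring
  have h6 : Real.log 8 + 2 * Real.log 3 ≤ 5 := by
    have e8 : Real.log 8 = 3 * Real.log 2 := by
      rw [show (8 : ℝ) = 2 ^ 3 by norm_num, Real.log_pow]; norm_num
    have e3 : Real.log 3 ≤ 2 * Real.log 2 := by
      rw [show 2 * Real.log 2 = Real.log (2 ^ 2) by rw [Real.log_pow]; norm_num]
      exact Real.log_le_log (by norm_num) (by norm_num)
    have := Real.log_two_lt_d9
    linarith
  have h7 : (0 : ℝ) ≤ s := by positivity
  have h8 : 24 / T * (x : ℝ) ^ (1 / 12 : ℝ) = 24 * ((x : ℝ) ^ (1 / 12 : ℝ) / T) := by ring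
  rw [h8]
  linarith

lemma wt_chain (s : ℕ) (B K : Finset ℤ) (δ : ℤ → ℤ) (hδ : ∀ k ∈ K, δ k ∈ bd B)
    (hmono : ∀ k ∈ K, ∀ k' ∈ K, k ≤ k' → δ k ≤ δ k')
    (hd : ∀ k ∈ K, (k - 1) * 2 ^ s < δ k ∧ δ k < (k + 1) * 2 ^ s) (Gt : ℝ) (hG : ∀ d, GG B d ≤ Gt)
    (l : List ℤ) : ∀ p ∈ K, (∀ x ∈ l, x ∈ K) → (p :: l).Pairwise (· ≤ ·) →
    wt p l ≤ 29 * (s + 1) * l.length + 24 / 2 ^ s * (Gt - GG B (δ p)) := by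
  induction l with
  | nil =>
    intro p _ _ _
    simp only [wt, List.length_nil]
    have : 0 ≤ Gt - GG B (δ p) := by linarith [hG (δ p)]
    have : (0 : ℝ) ≤ 24 / 2 ^ s * (Gt - GG B (δ p)) := by positivity
    simpa using this
  | cons q l ih =>
    intro p hp hl hs
    have hq : q ∈ K := hl q (by simp)
    rw [List.pairwise_cons] at hs
    have hpq : p ≤ q := hs.1 q (by simp)
    have h1 := ih q hq (fun x hx => hl x (by simp [hx])) hs.2
    have h2 := hmono p hp q hq hpq
    have h3 := hd p hp
    have h4 := hd q hq
    have h5 := cost_bound s (k := q - p) (x := δ q - δ p) (by omega) (by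
      rw [abs_of_nonneg (by omega)]
      nlinarith)
    have h6 := GG_diff B (hδ p hp) (hδ q hq) h2
    have h7 : 24 / (2 : ℝ) ^ s * ((δ q - δ p : ℤ) : ℝ) ^ (1 / 12 : ℝ) ≤ 24 / 2 ^ s * (GG B (δ q) - GG B (δ p)) := by
      gcongr
    simp only [wt, List.length_cons]
    push_cast at *
    nlinarith

lemma hull_wall {B : Finset ℤ} (h0 : (0 : ℤ) ∈ B) : (∃ d ∈ bd B, d ≤ 0) ∧ ∃ d ∈ bd B, 0 < d := by
  have hne : B.Nonempty := ⟨0, h0⟩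
  constructor
  · have h2 : B.min' hne - 1 ∉ B := fun h => by
      have := B.min'_le _ h; omega
    have h3 : sep B (B.min' hne - 1) 0 := by unfold sep; tauto
    have := B.min'_le _ h0
    obtain ⟨d, hd, _, h5⟩ := exists_wall' (by omega) h3
    exact ⟨d, hd, h5⟩
  · have h2 : B.max' hne + 1 ∉ B := fun h => by
      have := B.le_max' _ h; omega
    have h3 : sep B 0 (B.max' hne + 1) := by unfold sep; tauto
    have := B.le_max' _ h0
    obtain ⟨d, hd, h5, _⟩ := exists_wall' (by omega) h3
    exact ⟨d, hd, h5⟩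

lemma WW_bound {J₁ α : ℝ} (hJ : 1 ≤ J₁) (hα : 1 / 2 < α) (hα2 : α < 3 / 5) {B : Finset ℤ}
    (hB : Irred B) (h0 : (0 : ℤ) ∈ B) (s : ℕ) :
    WW (cs s B) * ((2 : ℝ) ^ s) ^ α ≤ 4000 * en J₁ α B * (s + 1) := by
  set K := bd (cs s B) with hK
  have hE := en_nonneg J₁ α B
  have hGt := gap_sum hJ hα hα2 hB
  set Gt := ∑ d ∈ bd B, (gp B d : ℝ) ^ (1 / 12 : ℝ) with hGtd
  have hG := GG_le B
  have hwall : ∀ k ∈ K, ∃ d ∈ bd B, (k - 1) * 2 ^ s < d ∧ d < (k + 1) * 2 ^ s := by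
    intro k hk
    obtain ⟨U, V, h1, h2, h3, h4, h5⟩ := coarse_wall hk
    have hp : 0 < 2 ^ s := by positivity
    obtain ⟨x, hx⟩ := Finset.card_pos.1 (show 0 < U.card by omega)
    obtain ⟨y, hy⟩ := Finset.card_pos.1 (show 0 < V.card by omega)
    have e1 := h1 hx
    have e2 := h2 hy
    rw [blk, Finset.mem_Ico] at e1 e2
    rw [sub_add_cancel] at e2
    obtain ⟨d, hd, h6, h7⟩ := exists_wall' (show y ≤ x by omega) (sep_comm.1 (h5 x hx y hy))
    exact ⟨d, hd, by omega, by omega⟩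
  have hne : ∀ k : ℤ, k ∈ K → ((bd B).filter (fun d => (k - 1) * 2 ^ s < d)).Nonempty := by
    intro k hk
    obtain ⟨d, hd, h1, _⟩ := hwall k hk
    exact ⟨d, Finset.mem_filter.2 ⟨hd, h1⟩⟩
  set δ : ℤ → ℤ := fun k => if h : ((bd B).filter (fun d => (k - 1) * 2 ^ s < d)).Nonempty
    then ((bd B).filter (fun d => (k - 1) * 2 ^ s < d)).min' h else 0 with hδdef
  have hδe : ∀ k (hk : k ∈ K), δ k = ((bd B).filter (fun d => (k - 1) * 2 ^ s < d)).min' (hne k hk) := by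
    intro k hk; rw [hδdef]; simp only; rw [dif_pos (hne k hk)]
  have hδm : ∀ k ∈ K, δ k ∈ bd B ∧ (k - 1) * 2 ^ s < δ k := by
    intro k hk
    rw [hδe k hk]
    have := Finset.min'_mem _ (hne k hk)
    rwa [Finset.mem_filter] at this
  have hδle : ∀ k ∈ K, ∀ d ∈ bd B, (k - 1) * 2 ^ s < d → δ k ≤ d := by
    intro k hk d hd h
    rw [hδe k hk]
    exact Finset.min'_le _ _ (Finset.mem_filter.2 ⟨hd, h⟩)
  have hd : ∀ k ∈ K, (k - 1) * 2 ^ s < δ k ∧ δ k < (k + 1) * 2 ^ s := by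
    intro k hk
    refine ⟨(hδm k hk).2, ?_⟩
    obtain ⟨d, hd, h1, h2⟩ := hwall k hk
    exact (hδle k hk d hd h1).trans_lt h2
  have hp : (0 : ℤ) < 2 ^ s := by positivity
  have hmono : ∀ k ∈ K, ∀ k' ∈ K, k ≤ k' → δ k ≤ δ k' := by
    intro k hk k' hk' hkk
    apply hδle k hk _ (hδm k' hk').1
    have := (hδm k' hk').2
    nlinarith
  have hT : (1 : ℝ) ≤ 2 ^ s := one_le_pow₀ (by norm_num)
  have hN := coarse_count hJ (by linarith) hα2 s B
  rw [← hK] at hN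
  -- main bound
  have hmain : WW (cs s B) ≤ 29 * (s + 1) * K.card + 48 / 2 ^ s * (70 * en J₁ α B) := by
    unfold WW
    rw [← hK]
    have hlen : (K.sort (· ≤ ·)).length = K.card := Finset.length_sort _
    have hmem : ∀ x ∈ K.sort (· ≤ ·), x ∈ K := fun x hx => (Finset.mem_sort _).1 hx
    have hsrt : (K.sort (· ≤ ·)).Pairwise (· ≤ ·) := Finset.pairwise_sort _ _
    rw [← hlen]
    cases hl : K.sort (· ≤ ·) with
    | nil =>
      simp only [wt, List.length_nil]
      have : (0 : ℝ) ≤ 48 / 2 ^ s * (70 * en J₁ α B) := by positivity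
      simpa using this
    | cons p l =>
      rw [hl] at hmem hsrt
      have hp' : p ∈ K := hmem p (by simp)
      have h1 := wt_chain s B K δ (fun k hk => (hδm k hk).1) hmono hd Gt hG l p hp'
        (fun x hx => hmem x (by simp [hx])) hsrt
      obtain ⟨⟨a, ha, ha0⟩, ⟨b, hb, hb0⟩⟩ := hull_wall h0
      have hbdne : (bd B).Nonempty := ⟨a, ha⟩
      set dm := (bd B).min' hbdne with hdm
      set dM := (bd B).max' hbdne with hdM
      have e1 : dm ≤ a := (bd B).min'_le _ ha
      have e2 : b ≤ dM := (bd B).le_max' _ hb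
      have e3 : dm ≤ δ p := (bd B).min'_le _ (hδm p hp').1
      have e4 : δ p ≤ dM := (bd B).le_max' _ (hδm p hp').1
      have h2 := cost_bound s (k := p - 0) (x := dM - dm) (by omega) (by
        have h3 := hd p hp'
        rw [← abs_of_pos hp, ← abs_mul, abs_of_pos hp, abs_le]
        constructor <;> nlinarith)
      have h3 := GG_diff B ((bd B).min'_mem hbdne) ((bd B).max'_mem hbdne) (by omega)
      rw [← hdm, ← hdM] at h3
      have h4 : ((dM - dm : ℤ) : ℝ) ^ (1 / 12 : ℝ) ≤ 70 * en J₁ α B := by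
        have := GG_nonneg B dm
        have := hG dM
        linarith
      have h5 : 24 / (2 : ℝ) ^ s * ((dM - dm : ℤ) : ℝ) ^ (1 / 12 : ℝ) ≤ 24 / 2 ^ s * (70 * en J₁ α B) := by
        gcongr
      have h6 : 24 / (2 : ℝ) ^ s * (Gt - GG B (δ p)) ≤ 24 / 2 ^ s * (70 * en J₁ α B) := by
        gcongr
        have := GG_nonneg B (δ p)
        linarith
      have h7 : 48 / (2 : ℝ) ^ s * (70 * en J₁ α B) = 24 / 2 ^ s * (70 * en J₁ α B) + 24 / 2 ^ s * (70 * en J₁ α B) := by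
        ring
      rw [h7]
      simp only [wt, List.length_cons]
      push_cast at *
      linarith
  have hTa : ((2 : ℝ) ^ s) ^ α ≤ 2 ^ s := by
    calc ((2 : ℝ) ^ s) ^ α ≤ ((2 : ℝ) ^ s) ^ (1 : ℝ) :=
          Real.rpow_le_rpow_of_exponent_le hT (by linarith)
      _ = _ := Real.rpow_one _
  have hTa0 : 0 ≤ ((2 : ℝ) ^ s) ^ α := by positivity
  have h1 := mul_le_mul_of_nonneg_right hmain hTa0
  have h2 : 48 / (2 : ℝ) ^ s * (70 * en J₁ α B) * ((2 : ℝ) ^ s) ^ α ≤ 48 * (70 * en J₁ α B) := by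
    calc _ ≤ 48 / (2 : ℝ) ^ s * (70 * en J₁ α B) * (2 : ℝ) ^ s := by gcongr
      _ = _ := by field_simp
  have hs : (0 : ℝ) ≤ s := by positivity
  have h3 : 29 * ((s : ℝ) + 1) * K.card * ((2 : ℝ) ^ s) ^ α ≤ 29 * (s + 1) * (16 * en J₁ α B) := by
    rw [mul_assoc]; gcongr
  nlinarith [mul_nonneg hs hE]

end LR

namespace LR
open scoped symmDiff ENNReal

/-- sign attached to a set of minus sites -/
def sgn (D : Finset ℤ) (i : ℤ) : ℝ := if i ∈ D then -1 else 1

/-- field term -/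
def ff (Λ D A : Finset ℤ) : ℝ := ∑ i ∈ Λ, sgn D i * sgn A i

/-- Gibbs weight -/
def wgt (e : Finset ℤ → ℝ) (β θ : ℝ) (Λ D A : Finset ℤ) : ℝ := Real.exp (-β * (e A - θ * ff Λ D A))

/-- partition function -/
def ZZ (e : Finset ℤ → ℝ) (β θ : ℝ) (I Λ D : Finset ℤ) : ℝ := ∑ A ∈ I.powerset, wgt e β θ Λ D A

/-- log partition function -/
def LZ (e : Finset ℤ → ℝ) (β θ : ℝ) (I Λ D : Finset ℤ) : ℝ := Real.log (ZZ e β θ I Λ D)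

lemma sgn_symmDiff (D B : Finset ℤ) (i : ℤ) : sgn (D ∆ B) i = sgn D i * sgn B i := by
  unfold sgn
  simp only [Finset.mem_symmDiff]
  by_cases h1 : i ∈ D <;> by_cases h2 : i ∈ B <;> simp [h1, h2]

lemma sgn_mul_self (D : Finset ℤ) (i : ℤ) : sgn D i * sgn D i = 1 := by
  unfold sgn; split_ifs <;> norm_num

lemma abs_sgn (D : Finset ℤ) (i : ℤ) : |sgn D i| = 1 := by
  unfold sgn; split_ifs <;> norm_num

lemma ff_flip (Λ D A B : Finset ℤ) : ff Λ (D ∆ B) (A ∆ B) = ff Λ D A := by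
  unfold ff
  refine Finset.sum_congr rfl fun i _ => ?_
  rw [sgn_symmDiff, sgn_symmDiff]
  have := sgn_mul_self B i
  calc _ = sgn D i * sgn A i * (sgn B i * sgn B i) := by ring
    _ = _ := by rw [this, mul_one]

lemma wgt_pos (e : Finset ℤ → ℝ) (β θ : ℝ) (Λ D A : Finset ℤ) : 0 < wgt e β θ Λ D A := Real.exp_pos _

lemma ZZ_pos (e : Finset ℤ → ℝ) (β θ : ℝ) (I Λ D : Finset ℤ) : 0 < ZZ e β θ I Λ D :=
  Finset.sum_pos (fun _ _ => wgt_pos _ _ _ _ _ _) ⟨∅, by simp⟩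

lemma ff_single (Λ D A : Finset ℤ) (i : ℤ) : |ff Λ (D ∆ {i}) A - ff Λ D A| ≤ 2 := by
  unfold ff
  rw [← Finset.sum_sub_distrib]
  have h : ∀ j, sgn (D ∆ {i}) j * sgn A j - sgn D j * sgn A j =
      if j = i then -2 * (sgn D j * sgn A j) else 0 := by
    intro j
    rw [sgn_symmDiff]
    by_cases hj : j = i
    · rw [if_pos hj]
      have : sgn {i} j = -1 := by simp [sgn, hj]
      rw [this]; ring
    · rw [if_neg hj]
      have : sgn {i} j = 1 := by simp [sgn, hj]
      rw [this]; ring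
  simp only [h]
  rw [Finset.sum_ite_eq']
  split_ifs
  · rw [abs_mul, abs_mul, abs_sgn, abs_sgn]; norm_num
  · norm_num

lemma LZ_single_le (e : Finset ℤ → ℝ) {β θ : ℝ} (hβ : 0 ≤ β) (hθ : 0 ≤ θ) (I Λ D : Finset ℤ) (i : ℤ) :
    LZ e β θ I Λ (D ∆ {i}) ≤ LZ e β θ I Λ D + 2 * β * θ := by
  unfold LZ
  have h1 : ZZ e β θ I Λ (D ∆ {i}) ≤ Real.exp (2 * β * θ) * ZZ e β θ I Λ D := by
    unfold ZZ
    rw [Finset.mul_sum]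
    refine Finset.sum_le_sum fun A _ => ?_
    unfold wgt
    rw [← Real.exp_add]
    apply Real.exp_le_exp.2
    have h2 := (abs_le.1 (ff_single Λ D A i)).2
    have h3 : β * θ * (ff Λ (D ∆ {i}) A - ff Λ D A) ≤ β * θ * 2 :=
      mul_le_mul_of_nonneg_left h2 (by positivity)
    nlinarith
  have h2 := Real.log_le_log (ZZ_pos _ _ _ _ _ _) h1
  rw [Real.log_mul (Real.exp_pos _).ne' (ZZ_pos _ _ _ _ _ _).ne', Real.log_exp] at h2
  linarith

lemma LZ_single (e : Finset ℤ → ℝ) {β θ : ℝ} (hβ : 0 ≤ β) (hθ : 0 ≤ θ) (I Λ D : Finset ℤ) (i : ℤ) :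
    |LZ e β θ I Λ (D ∆ {i}) - LZ e β θ I Λ D| ≤ 2 * β * θ := by
  have h1 := LZ_single_le e hβ hθ I Λ D i
  have h2 := LZ_single_le e hβ hθ I Λ (D ∆ {i}) i
  rw [symmDiff_symmDiff_cancel_right] at h2
  rw [abs_le]; constructor <;> linarith

lemma two_exp {a b c : ℝ} (h : |a - b| ≤ c) :
    Real.exp a + Real.exp b ≤ 2 * Real.exp (c ^ 2 / 8) * Real.exp ((a + b) / 2) := by
  have h1 : Real.exp a + Real.exp b = 2 * Real.cosh ((a - b) / 2) * Real.exp ((a + b) / 2) := by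
    rw [Real.cosh_eq]
    have e1 : Real.exp a = Real.exp ((a - b) / 2) * Real.exp ((a + b) / 2) := by
      rw [← Real.exp_add]; congr 1; ring
    have e2 : Real.exp b = Real.exp (-((a - b) / 2)) * Real.exp ((a + b) / 2) := by
      rw [← Real.exp_add]; congr 1; ring
    rw [e1, e2]; ring
  rw [h1]
  gcongr
  refine (Real.cosh_le_exp_half_sq _).trans ?_
  apply Real.exp_le_exp.2
  have : (a - b) ^ 2 ≤ c ^ 2 := by
    rw [← sq_abs]; gcongr
  nlinarith

lemma subgauss (c : ℝ) (V : Finset ℤ) : ∀ φ : Finset ℤ → ℝ,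
    (∀ S, ∀ i ∈ V, i ∉ S → |φ S - φ (insert i S)| ≤ c) →
    ∑ S ∈ V.powerset, Real.exp (φ S) ≤
      2 ^ V.card * Real.exp ((∑ S ∈ V.powerset, φ S) / 2 ^ V.card + c ^ 2 * V.card / 8) := by
  induction V using Finset.induction_on with
  | empty => intro φ _; simp
  | insert i V hi ih =>
    intro φ hφ
    rw [Finset.sum_powerset_insert hi, Finset.sum_powerset_insert hi, ← Finset.sum_add_distrib,
      ← Finset.sum_add_distrib, Finset.card_insert_of_notMem hi]
    have h1 : ∀ S ∈ V.powerset, Real.exp (φ S) + Real.exp (φ (insert i S)) ≤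
        2 * Real.exp (c ^ 2 / 8) * Real.exp ((φ S + φ (insert i S)) / 2) := by
      intro S hS
      apply two_exp
      apply hφ S i (Finset.mem_insert_self _ _)
      intro h
      exact hi (Finset.mem_powerset.1 hS h)
    refine (Finset.sum_le_sum h1).trans ?_
    rw [← Finset.mul_sum]
    have h2 := ih (fun S => (φ S + φ (insert i S)) / 2) (by
      intro S j hj hjS
      have hji : j ≠ i := fun h => hi (h ▸ hj)
      have h3 := hφ S j (Finset.mem_insert_of_mem hj) hjS
      have h4 := hφ (insert i S) j (Finset.mem_insert_of_mem hj) (by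
        rw [Finset.mem_insert]; tauto)
      rw [Finset.insert_comm] at h4
      rw [abs_le] at *
      constructor <;> linarith [h3.1, h3.2, h4.1, h4.2])
    refine (mul_le_mul_of_nonneg_left h2 (by positivity)).trans (le_of_eq ?_)
    rw [← Finset.sum_div]
    have : (2 : ℝ) * Real.exp (c ^ 2 / 8) * (2 ^ V.card * Real.exp ((∑ S ∈ V.powerset, (φ S + φ (insert i S))) / 2 / 2 ^ V.card + c ^ 2 * V.card / 8))
      = 2 ^ (V.card + 1) * (Real.exp (c ^ 2 / 8) * Real.exp ((∑ S ∈ V.powerset, (φ S + φ (insert i S))) / 2 / 2 ^ V.card + c ^ 2 * V.card / 8)) := by ring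
    rw [this, ← Real.exp_add]
    congr 2
    push_cast
    rw [pow_succ]
    field_simp
    ring

lemma sum_symm (Λ V : Finset ℤ) (hV : V ⊆ Λ) (g : Finset ℤ → ℝ) :
    ∑ D ∈ Λ.powerset, g (D ∆ V) = ∑ D ∈ Λ.powerset, g D := by
  have hm : ∀ D ∈ Λ.powerset, D ∆ V ∈ Λ.powerset := by
    intro D hD
    rw [Finset.mem_powerset] at *
    intro x hx
    rw [Finset.mem_symmDiff] at hx
    rcases hx with h | h
    · exact hD h.1
    · exact hV h.1
  refine Finset.sum_nbij' (fun D => D ∆ V) (fun D => D ∆ V) hm hm ?_ ?_ ?_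
  · intro D _; exact symmDiff_symmDiff_cancel_right _ _
  · intro D _; exact symmDiff_symmDiff_cancel_right _ _
  · intro D _; rfl

/-- exponential moment of the increment of an observable with bounded differences -/
lemma exp_moment (c : ℝ) (Λ V : Finset ℤ) (hV : V ⊆ Λ) (F : Finset ℤ → ℝ)
    (hF : ∀ D i, |F (D ∆ {i}) - F D| ≤ c) (hodd : ∀ D, F (D ∆ V) = -F D) :
    ∑ D ∈ Λ.powerset, Real.exp (F D) ≤ 2 ^ Λ.card * Real.exp (c ^ 2 * V.card / 8) := by
  have h1 : ∀ D, ∑ S ∈ V.powerset, Real.exp (F (D ∆ S)) ≤ 2 ^ V.card * Real.exp (c ^ 2 * V.card / 8) := by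
    intro D
    have h2 := subgauss c V (fun S => F (D ∆ S)) (by
      intro S i _ hi
      have : insert i S = S ∆ {i} := by
        ext x
        rw [Finset.mem_insert, Finset.mem_symmDiff, Finset.mem_singleton]
        constructor
        · rintro (rfl | h)
          · exact Or.inr ⟨rfl, hi⟩
          · refine Or.inl ⟨h, ?_⟩
            rintro rfl; exact hi h
        · tauto
      rw [this, ← symmDiff_assoc, abs_sub_comm]
      exact hF _ i)
    have h3 : ∑ S ∈ V.powerset, F (D ∆ S) = 0 := by
      have h4 := sum_symm V V subset_rfl (fun S => F (D ∆ S))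
      simp only [← symmDiff_assoc, hodd] at h4
      rw [Finset.sum_neg_distrib] at h4
      linarith
    rw [h3, zero_div, zero_add] at h2
    exact h2
  have h2 : (2 : ℝ) ^ V.card * ∑ D ∈ Λ.powerset, Real.exp (F D) =
      ∑ D ∈ Λ.powerset, ∑ S ∈ V.powerset, Real.exp (F (D ∆ S)) := by
    rw [Finset.sum_comm]
    rw [Finset.sum_congr rfl (fun S hS => sum_symm Λ S ((Finset.mem_powerset.1 hS).trans hV) (fun D => Real.exp (F D)))]
    rw [Finset.sum_const, Finset.card_powerset, nsmul_eq_mul]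
    push_cast; rfl
  have h3 : ∑ D ∈ Λ.powerset, ∑ S ∈ V.powerset, Real.exp (F (D ∆ S)) ≤
      ∑ D ∈ Λ.powerset, 2 ^ V.card * Real.exp (c ^ 2 * V.card / 8) := Finset.sum_le_sum fun D _ => h1 D
  rw [← h2, Finset.sum_const, Finset.card_powerset, nsmul_eq_mul] at h3
  push_cast at h3
  have h4 : (0 : ℝ) < 2 ^ V.card := by positivity
  refine le_of_mul_le_mul_left ?_ h4
  linarith

lemma LZ_inter (e : Finset ℤ → ℝ) (β θ : ℝ) (I Λ D X : Finset ℤ) :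
    LZ e β θ I Λ (D ∆ X) = LZ e β θ I Λ (D ∆ (X ∩ Λ)) := by
  unfold LZ ZZ wgt ff
  congr 1
  refine Finset.sum_congr rfl fun A _ => ?_
  congr 4
  refine Finset.sum_congr rfl fun i hi => ?_
  rw [sgn_symmDiff, sgn_symmDiff]
  have : sgn (X ∩ Λ) i = sgn X i := by simp [sgn, hi]
  rw [this]

lemma tail {e : Finset ℤ → ℝ} {β θ : ℝ} (hβ : 0 < β) (hθ : 0 < θ) (I Λ X Y : Finset ℤ) {t : ℝ}
    (ht : 0 ≤ t) (hXY : X ∆ Y ≠ ∅) :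
    ((Λ.powerset.filter (fun D => β * t < LZ e β θ I Λ (D ∆ X) - LZ e β θ I Λ (D ∆ Y))).card : ℝ) ≤
      2 ^ Λ.card * Real.exp (-(t ^ 2 / (8 * θ ^ 2 * (X ∆ Y).card))) := by
  set v : ℝ := ((X ∆ Y).card : ℝ) with hv
  have hv0 : 0 < v := by
    have : 0 < (X ∆ Y).card := Finset.card_pos.2 (Finset.nonempty_iff_ne_empty.2 hXY)
    rw [hv]; exact_mod_cast this
  set V := (X ∩ Λ) ∆ (Y ∩ Λ) with hVdef
  have hVΛ : V ⊆ Λ := by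
    intro x hx
    rw [hVdef, Finset.mem_symmDiff] at hx
    simp only [Finset.mem_inter] at hx
    tauto
  have hVX : (V.card : ℝ) ≤ v := by
    rw [hv]
    have : V ⊆ X ∆ Y := by
      intro x hx
      rw [hVdef, Finset.mem_symmDiff] at hx
      rw [Finset.mem_symmDiff]
      simp only [Finset.mem_inter] at hx
      tauto
    exact_mod_cast Finset.card_le_card this
  set lam : ℝ := t / (4 * β * θ ^ 2 * v) with hlam
  have hlam0 : 0 ≤ lam := by positivity
  set F : Finset ℤ → ℝ := fun D => lam * (LZ e β θ I Λ (D ∆ (X ∩ Λ)) - LZ e β θ I Λ (D ∆ (Y ∩ Λ))) with hF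
  have h1 := exp_moment (lam * (4 * β * θ)) Λ V hVΛ F (by
    intro D i
    rw [hF]
    simp only
    have e1 : (D ∆ {i}) ∆ (X ∩ Λ) = (D ∆ (X ∩ Λ)) ∆ {i} := symmDiff_right_comm _ _ _
    have e2 : (D ∆ {i}) ∆ (Y ∩ Λ) = (D ∆ (Y ∩ Λ)) ∆ {i} := symmDiff_right_comm _ _ _
    rw [e1, e2, ← mul_sub, abs_mul, abs_of_nonneg hlam0]
    have h2 := LZ_single e hβ.le hθ.le I Λ (D ∆ (X ∩ Λ)) i
    have h3 := LZ_single e hβ.le hθ.le I Λ (D ∆ (Y ∩ Λ)) i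
    gcongr
    rw [abs_le] at *
    constructor <;> linarith [h2.1, h2.2, h3.1, h3.2]) (by
    intro D
    rw [hF]
    simp only
    have e1 : (D ∆ V) ∆ (X ∩ Λ) = D ∆ (Y ∩ Λ) := by
      rw [hVdef, symmDiff_assoc]
      congr 1
      rw [symmDiff_comm, symmDiff_symmDiff_cancel_left]
    have e2 : (D ∆ V) ∆ (Y ∩ Λ) = D ∆ (X ∩ Λ) := by
      rw [hVdef, symmDiff_assoc]
      congr 1
      rw [symmDiff_symmDiff_cancel_right]
    rw [e1, e2]; ring)
  have h2 : ((Λ.powerset.filter (fun D => β * t < LZ e β θ I Λ (D ∆ X) - LZ e β θ I Λ (D ∆ Y))).card : ℝ)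
      * Real.exp (lam * (β * t)) ≤ ∑ D ∈ Λ.powerset, Real.exp (F D) := by
    rw [← nsmul_eq_mul, ← Finset.sum_const]
    refine le_trans ?_ (Finset.sum_le_sum_of_subset_of_nonneg (Finset.filter_subset (fun D => β * t < LZ e β θ I Λ (D ∆ X) - LZ e β θ I Λ (D ∆ Y)) _) (fun _ _ _ => (Real.exp_pos _).le))
    refine Finset.sum_le_sum fun D hD => ?_
    apply Real.exp_le_exp.2
    have h3 := (Finset.mem_filter.1 hD).2
    rw [LZ_inter e β θ I Λ D X, LZ_inter e β θ I Λ D Y] at h3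
    rw [hF]
    simp only
    gcongr
  have h3 := h2.trans h1
  rw [← le_div_iff₀ (Real.exp_pos _), mul_div_assoc, ← Real.exp_sub] at h3
  refine h3.trans ?_
  gcongr
  have h5 : (lam * (4 * β * θ)) ^ 2 * V.card / 8 ≤ (lam * (4 * β * θ)) ^ 2 * v / 8 := by gcongr
  have h6 : (lam * (4 * β * θ)) ^ 2 * v / 8 - lam * (β * t) = -(t ^ 2 / (8 * θ ^ 2 * v)) := by
    rw [hlam]; field_simp; ring
  linarith

end LR

namespace LR
open scoped symmDiff ENNReal

/-- entropy weight at scale s -/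
def MM (θ : ℝ) (s : ℕ) (K K' : Finset ℤ) : ℝ := WW K + WW K' + s + 3 + 1 / θ ^ 2

/-- threshold -/
def tt (θ : ℝ) (s : ℕ) (K K' : Finset ℤ) : ℝ :=
  θ * Real.sqrt (8 * ((ex s K ∆ ex (s + 1) K').card : ℝ) * MM θ s K K')

lemma MM_nonneg (θ : ℝ) (s : ℕ) (K K' : Finset ℤ) : 0 ≤ MM θ s K K' := by
  unfold MM
  have := WW_nonneg K
  have := WW_nonneg K'
  positivity

lemma J_le_en {J₁ α : ℝ} (hJ : 0 ≤ J₁) (hα2 : α < 3 / 5) {B : Finset ℤ} (h0 : (0 : ℤ) ∈ B) :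
    J₁ ≤ en J₁ α B := by
  obtain ⟨d, hd, -⟩ := (hull_wall h0).1
  have h1 : (1 : ℝ) ≤ (bd B).card := by exact_mod_cast Finset.card_pos.2 ⟨d, hd⟩
  have := bd_le_en hJ hα2 B
  nlinarith

lemma frac_pow {κ α T J ε : ℝ} (hκ : 0 < κ) (hκ1 : κ < 1) (hT : 1 ≤ T) (hJ : 0 < J) (hε : J ≤ ε)
    (h : T ^ α ≤ 16 * ε) : T ^ α / ε ≤ 16 * (T ^ (α * κ) * J ^ (-κ)) := by
  have hε0 : 0 < ε := by linarith
  have hTp : 0 < T ^ α := by positivity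
  have hx : 0 < T ^ α / ε := by positivity
  have h1 : T ^ α / ε = (T ^ α / ε) ^ (1 - κ) * (T ^ α / ε) ^ κ := by
    rw [← Real.rpow_add hx]; simp
  have h2 : (T ^ α / ε) ^ (1 - κ) ≤ 16 := by
    calc (T ^ α / ε) ^ (1 - κ) ≤ (16 : ℝ) ^ (1 - κ) := by
          apply Real.rpow_le_rpow hx.le _ (by linarith)
          rw [div_le_iff₀ hε0]; exact h
      _ ≤ (16 : ℝ) ^ (1 : ℝ) := Real.rpow_le_rpow_of_exponent_le (by norm_num) (by linarith)
      _ = 16 := by norm_num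
  have h3 : (T ^ α / ε) ^ κ ≤ T ^ (α * κ) * J ^ (-κ) := by
    rw [Real.div_rpow hTp.le hε0.le, ← Real.rpow_mul (by linarith), Real.rpow_neg hJ.le, div_eq_mul_inv]
    gcongr
  rw [h1]
  exact mul_le_mul h2 h3 (by positivity) (by norm_num)

lemma main_alg {θ ε T s M v P R U j Q : ℝ} (hε : 0 ≤ ε) (hT : 0 ≤ T) (hs0 : 0 ≤ s) (hM : 0 ≤ M) (hv : 0 ≤ v)
    (hP0 : 0 < P) (hR : 0 ≤ R) (hU : 0 ≤ U) (hj : 0 ≤ j) (hv1 : v * P ≤ 32 * ε * T)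
    (hM1 : θ ^ 2 * M * P ≤ 12048 * θ ^ 2 * (s + 1) * ε + P) (hTa : P ≤ 16 * (R * j) * ε)
    (hTT : T * R ≤ U * (P * P)) (hTT1 : T ≤ U * (P * P)) (hQ : Q ^ 2 = U) :
    θ ^ 2 * (8 * v * M) ≤ (2000 * ε * (s + 1) * Q) ^ 2 * (θ ^ 2 + j) := by
  have hP : 0 < P * P := by positivity
  refine le_of_mul_le_mul_right ?_ hP
  calc θ ^ 2 * (8 * v * M) * (P * P) = 8 * (v * P) * (θ ^ 2 * M * P) := by ring
    _ ≤ 8 * (32 * ε * T) * (12048 * θ ^ 2 * (s + 1) * ε + P) := by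
        apply mul_le_mul _ hM1 (by positivity) (by positivity)
        linarith
    _ ≤ 8 * (32 * ε * T) * (12048 * θ ^ 2 * (s + 1) * ε + 16 * (R * j) * ε) := by gcongr
    _ = 3084288 * (ε ^ 2 * θ ^ 2 * (s + 1)) * T + 4096 * (ε ^ 2 * j) * (T * R) := by ring
    _ ≤ 3084288 * (ε ^ 2 * θ ^ 2 * (s + 1)) * (U * (P * P)) +
        4096 * (ε ^ 2 * j) * (U * (P * P)) := by gcongr
    _ = (3084288 * (θ ^ 2 * (s + 1)) + 4096 * j) * (ε ^ 2 * U * (P * P)) := by ring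
    _ ≤ (4000000 * (s + 1) ^ 2 * (θ ^ 2 + j)) * (ε ^ 2 * U * (P * P)) := by
        apply mul_le_mul_of_nonneg_right _ (by positivity)
        have a1 : (1 : ℝ) ≤ (s + 1) ^ 2 := by nlinarith
        have a2 : (s + 1 : ℝ) ≤ (s + 1) ^ 2 := by nlinarith
        have a3 := mul_le_mul_of_nonneg_left a2 (sq_nonneg θ)
        have a4 := mul_le_mul_of_nonneg_left a1 hj
        have a5 : 0 ≤ θ ^ 2 * (s + 1) := by positivity
        have a6 : 0 ≤ θ ^ 2 * (s + 1) ^ 2 := by positivity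
        have a7 : 0 ≤ j * (s + 1) ^ 2 := by positivity
        have : 4000000 * (s + 1) ^ 2 * (θ ^ 2 + j) = 4000000 * (θ ^ 2 * (s + 1) ^ 2) + 4000000 * (j * (s + 1) ^ 2) := by ring
        rw [this]
        linarith
    _ = (2000 * ε * (s + 1) * Q) ^ 2 * (θ ^ 2 + j) * (P * P) := by
        rw [← hQ]; ring

lemma tt_bound {J₁ α θ κ : ℝ} (hJ : 1 ≤ J₁) (hα : 1 / 2 < α) (hα2 : α < 3 / 5) (hθ : 0 < θ)
    (hκ : κ = (2 * α - 1) / 2) {B : Finset ℤ} (hB : Irred B) (h0 : (0 : ℤ) ∈ B) (s : ℕ) :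
    tt θ s (cs s B) (cs (s + 1) B) ≤
      2000 * en J₁ α B * (s + 1) * ((2 : ℝ) ^ (-κ / 2)) ^ s * Real.sqrt (θ ^ 2 + J₁ ^ (-κ)) := by
  set ε := en J₁ α B with hε
  have hJε : J₁ ≤ ε := J_le_en (by linarith) hα2 h0
  have hε0 : 0 < ε := by linarith
  have hJ0 : 0 < J₁ := by linarith
  by_cases hv : XS s B ∆ XS (s + 1) B = ∅
  · have : tt θ s (cs s B) (cs (s + 1) B) = 0 := by
      unfold tt; unfold XS at hv; rw [hv]; simp
    rw [this]; positivity
  set T : ℝ := (2 : ℝ) ^ s with hTdef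
  have hT : 1 ≤ T := one_le_pow₀ (by norm_num)
  have hT0 : 0 < T := by linarith
  have hTε : T ^ α ≤ 16 * ε := XS_ne hJ (by linarith) hα2 s B hv
  have hTp : 0 < T ^ α := by positivity
  set v : ℝ := ((XS s B ∆ XS (s + 1) B).card : ℝ) with hvdef
  have hv1 : v * T ^ α ≤ 32 * ε * T := XS_card hJ (by linarith) hα2 s B
  have hW1 : WW (cs s B) * T ^ α ≤ 4000 * ε * (s + 1) := WW_bound hJ hα hα2 hB h0 s
  have hW2 : WW (cs (s + 1) B) * T ^ α ≤ 4000 * ε * (s + 2) := by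
    have h := WW_bound hJ hα hα2 hB h0 (s + 1)
    have h2 : T ^ α ≤ ((2 : ℝ) ^ (s + 1)) ^ α := by
      apply Real.rpow_le_rpow hT0.le _ (by linarith)
      rw [pow_succ, ← hTdef]; linarith
    have h3 : WW (cs (s + 1) B) * T ^ α ≤ WW (cs (s + 1) B) * ((2 : ℝ) ^ (s + 1)) ^ α :=
      mul_le_mul_of_nonneg_left h2 (WW_nonneg _)
    push_cast at h
    linarith
  set M := MM θ s (cs s B) (cs (s + 1) B) with hM
  have hM0 : 0 ≤ M := MM_nonneg _ _ _ _
  have hs0 : (0 : ℝ) ≤ s := Nat.cast_nonneg s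
  have hM1 : θ ^ 2 * M * T ^ α ≤ 12048 * θ ^ 2 * (s + 1) * ε + T ^ α := by
    have e1 : θ ^ 2 * M * T ^ α = θ ^ 2 * (WW (cs s B) * T ^ α + WW (cs (s + 1) B) * T ^ α + (s + 3) * T ^ α) + T ^ α := by
      rw [hM]; unfold MM; field_simp; ring
    rw [e1]
    have h5 : ((s : ℝ) + 3) * T ^ α ≤ (s + 3) * (16 * ε) := by gcongr
    have h6 : WW (cs s B) * T ^ α + WW (cs (s + 1) B) * T ^ α + (s + 3) * T ^ α ≤ 12048 * (s + 1) * ε := by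
      nlinarith [mul_nonneg hs0 hε0.le]
    have := mul_le_mul_of_nonneg_left h6 (sq_nonneg θ)
    linarith
  have hfr := frac_pow (κ := κ) (by rw [hκ]; linarith) (by rw [hκ]; linarith) hT hJ0 hJε hTε
  set q := (2 : ℝ) ^ (-κ / 2) with hq
  have hκ0 : 0 < κ := by rw [hκ]; linarith
  have hqT : (q ^ s) ^ 2 = T ^ (-κ) := by
    rw [hq, hTdef, ← pow_mul, ← Real.rpow_natCast, ← Real.rpow_mul (by norm_num), ← Real.rpow_natCast 2 s,
      ← Real.rpow_mul (by norm_num)]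
    congr 1; push_cast; ring
  have hTT : T * T ^ (α * κ) ≤ T ^ (-κ) * (T ^ α * T ^ α) := by
    rw [← Real.rpow_add hT0, ← Real.rpow_add hT0]
    nth_rw 1 [← Real.rpow_one T]
    rw [← Real.rpow_add hT0]
    apply Real.rpow_le_rpow_of_exponent_le hT
    have : κ * α ≤ κ := by nlinarith
    nlinarith
  have hTT1 : T ≤ T ^ (-κ) * (T ^ α * T ^ α) := by
    refine le_trans ?_ hTT
    have : 1 ≤ T ^ (α * κ) := Real.one_le_rpow hT (by nlinarith)
    nlinarith
  have hTa : T ^ α ≤ 16 * (T ^ (α * κ) * J₁ ^ (-κ)) * ε := by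
    rwa [div_le_iff₀ hε0] at hfr
  have hJk : 0 < J₁ ^ (-κ) := by positivity
  have main : θ ^ 2 * (8 * v * M) ≤ (2000 * ε * (s + 1) * q ^ s) ^ 2 * (θ ^ 2 + J₁ ^ (-κ)) := by
    exact main_alg hε0.le hT0.le hs0 hM0 (Nat.cast_nonneg _) hTp (by positivity) (by positivity) hJk.le hv1 hM1 hTa hTT hTT1 hqT
  have hq0 : 0 < q := by positivity
  have e2 : tt θ s (cs s B) (cs (s + 1) B) = Real.sqrt (θ ^ 2 * (8 * v * M)) := by
    rw [Real.sqrt_mul (sq_nonneg θ), Real.sqrt_sq hθ.le]; rfl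
  rw [e2]
  refine (Real.sqrt_le_sqrt main).trans (le_of_eq ?_)
  rw [Real.sqrt_mul (sq_nonneg _), Real.sqrt_sq (by positivity)]

lemma sum_q {q : ℝ} (hq0 : 0 < q) (hq1 : q < 1) (S : ℕ) :
    ∑ s ∈ Finset.range S, ((s : ℝ) + 1) * q ^ s ≤ 1 / (1 - q) ^ 2 := by
  have h1 : 0 < 1 - q := by linarith
  have key : ∀ S : ℕ, (∑ s ∈ Finset.range S, ((s : ℝ) + 1) * q ^ s) * (1 - q) ^ 2 =
      1 - (S + 1) * q ^ S + S * q ^ (S + 1) := by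
    intro S
    induction S with
    | zero => simp
    | succ n ih => rw [Finset.sum_range_succ, add_mul, ih]; push_cast; ring
  rw [le_div_iff₀ (by positivity), key]
  have : 0 < q ^ S := by positivity
  have h2 : (S : ℝ) * q ^ (S + 1) ≤ S * q ^ S := by
    apply mul_le_mul_of_nonneg_left _ (Nat.cast_nonneg S)
    rw [pow_succ]; nlinarith
  linarith

lemma tt_sum {J₁ α θ κ : ℝ} (hJ : 1 ≤ J₁) (hα : 1 / 2 < α) (hα2 : α < 3 / 5) (hθ : 0 < θ)
    (hκ : κ = (2 * α - 1) / 2) (hsm : Real.sqrt (θ ^ 2 + J₁ ^ (-κ)) ≤ (1 - (2 : ℝ) ^ (-κ / 2)) ^ 2 / 8000)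
    {B : Finset ℤ} (hB : Irred B) (h0 : (0 : ℤ) ∈ B) (S : ℕ) :
    ∑ s ∈ Finset.range S, tt θ s (cs s B) (cs (s + 1) B) ≤ en J₁ α B / 4 := by
  have hε := en_nonneg J₁ α B
  set q := (2 : ℝ) ^ (-κ / 2) with hq
  have hq0 : 0 < q := by positivity
  have hq1 : q < 1 := Real.rpow_lt_one_of_one_lt_of_neg (by norm_num) (by rw [hκ]; linarith)
  have h1 : 0 < (1 - q) ^ 2 := by have : 0 < 1 - q := by linarith
                                  positivity
  calc _ ≤ ∑ s ∈ Finset.range S, 2000 * en J₁ α B * Real.sqrt (θ ^ 2 + J₁ ^ (-κ)) * (((s : ℝ) + 1) * q ^ s) := by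
        refine Finset.sum_le_sum fun s _ => (tt_bound hJ hα hα2 hθ hκ hB h0 s).trans (le_of_eq ?_)
        rw [← hq]; ring
    _ = 2000 * en J₁ α B * Real.sqrt (θ ^ 2 + J₁ ^ (-κ)) * ∑ s ∈ Finset.range S, (((s : ℝ) + 1) * q ^ s) := by
        rw [Finset.mul_sum]
    _ ≤ 2000 * en J₁ α B * ((1 - q) ^ 2 / 8000) * (1 / (1 - q) ^ 2) := by
        have := sum_q hq0 hq1 S
        gcongr
    _ = 2000 * en J₁ α B / 8000 * ((1 - q) ^ 2 * (1 / (1 - q) ^ 2)) := by ring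
    _ = en J₁ α B / 4 := by rw [mul_one_div_cancel h1.ne']; ring

end LR

namespace LR
open scoped symmDiff ENNReal

/-- contours in the interval -/
def BB (I : Finset ℤ) : Finset (Finset ℤ) := I.powerset.filter (fun B => Irred B ∧ (0 : ℤ) ∈ B)

/-- good fields -/
def Good (e : Finset ℤ → ℝ) (β θ : ℝ) (I Λ D : Finset ℤ) : Prop :=
  ∀ B ∈ BB I, ∀ s < 2 * I.card,
    LZ e β θ I Λ (D ∆ XS s B) - LZ e β θ I Λ (D ∆ XS (s + 1) B) ≤ β * tt θ s (cs s B) (cs (s + 1) B)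

lemma tail_tt {e : Finset ℤ → ℝ} {β θ : ℝ} (hβ : 0 < β) (hθ : 0 < θ) (I Λ : Finset ℤ) (s : ℕ) (K K' : Finset ℤ) :
    ((Λ.powerset.filter (fun D => β * tt θ s K K' <
      LZ e β θ I Λ (D ∆ ex s K) - LZ e β θ I Λ (D ∆ ex (s + 1) K'))).card : ℝ) ≤
      2 ^ Λ.card * Real.exp (-MM θ s K K') := by
  by_cases h : ex s K ∆ ex (s + 1) K' = ∅
  · have h1 : ex s K = ex (s + 1) K' := symmDiff_eq_bot.1 h
    have h2 : tt θ s K K' = 0 := by unfold tt; rw [h]; simp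
    rw [h2, h1]
    simp only [mul_zero, sub_self, lt_irrefl, Finset.filter_false, Finset.card_empty, Nat.cast_zero]
    positivity
  · have ht : 0 ≤ tt θ s K K' := by unfold tt; positivity
    refine (tail hβ hθ I Λ _ _ ht h).trans (le_of_eq ?_)
    have hc : (0 : ℝ) < (ex s K ∆ ex (s + 1) K').card := by
      exact_mod_cast Finset.card_pos.2 (Finset.nonempty_iff_ne_empty.2 h)
    have : tt θ s K K' ^ 2 = θ ^ 2 * (8 * ((ex s K ∆ ex (s + 1) K').card : ℝ) * MM θ s K K') := by
      unfold tt
      rw [mul_pow, Real.sq_sqrt]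
      have := MM_nonneg θ s K K'
      positivity
    rw [this]
    congr 3
    field_simp

lemma exp_neg_one_le : Real.exp (-1) ≤ 1 / 2 := by
  rw [Real.exp_neg, inv_eq_one_div]
  apply one_div_le_one_div_of_le (by norm_num)
  have := Real.add_one_le_exp (1 : ℝ)
  linarith

lemma sum_exp_nat (S : ℕ) : ∑ s ∈ Finset.range S, Real.exp (-(s : ℝ)) ≤ 2 := by
  have h : ∀ s : ℕ, Real.exp (-(s : ℝ)) ≤ (1 / 2) ^ s := by
    intro s
    have : Real.exp (-(s : ℝ)) = Real.exp (-1) ^ s := by rw [← Real.exp_nat_mul]; congr 1; ring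
    rw [this]
    exact pow_le_pow_left₀ (Real.exp_pos _).le exp_neg_one_le s
  calc _ ≤ ∑ s ∈ Finset.range S, (1 / 2 : ℝ) ^ s := Finset.sum_le_sum fun s _ => h s
    _ ≤ 2 := by
      rw [geom_sum_eq (by norm_num)]
      have : (0 : ℝ) ≤ (1 / 2) ^ S := by positivity
      rw [div_le_iff_of_neg (by norm_num)]
      linarith

lemma bad_card {e : Finset ℤ → ℝ} {β θ : ℝ} (hβ : 0 < β) (hθ : 0 < θ) (I Λ : Finset ℤ) :
    ((Λ.powerset.filter (fun D => ¬ Good e β θ I Λ D)).card : ℝ) ≤ 2 ^ Λ.card * Real.exp (-(1 / θ ^ 2)) := by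
  let 𝒦 : ℕ → Finset (Finset ℤ) := fun s => I.powerset.image (cs s)
  let F : ℕ → Finset ℤ → Finset ℤ → Finset (Finset ℤ) := fun s K K' =>
    Λ.powerset.filter (fun D => β * tt θ s K K' <
      LZ e β θ I Λ (D ∆ ex s K) - LZ e β θ I Λ (D ∆ ex (s + 1) K'))
  have hsub : Λ.powerset.filter (fun D => ¬ Good e β θ I Λ D) ⊆
      (Finset.range (2 * I.card)).biUnion (fun s => (𝒦 s).biUnion (fun K => (𝒦 (s + 1)).biUnion (fun K' => F s K K'))) := by
    intro D hD
    rw [Finset.mem_filter] at hD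
    obtain ⟨hD, hb⟩ := hD
    unfold Good at hb
    push Not at hb
    obtain ⟨B, hB, s, hs, hlt⟩ := hb
    have hBI : B ∈ I.powerset := (Finset.mem_filter.1 hB).1
    simp only [Finset.mem_biUnion]
    refine ⟨s, Finset.mem_range.2 hs, cs s B, Finset.mem_image_of_mem _ hBI, cs (s + 1) B,
      Finset.mem_image_of_mem _ hBI, Finset.mem_filter.2 ⟨hD, hlt⟩⟩
  have h1 : ((Λ.powerset.filter (fun D => ¬ Good e β θ I Λ D)).card : ℝ) ≤
      ∑ s ∈ Finset.range (2 * I.card), ∑ K ∈ 𝒦 s, ∑ K' ∈ 𝒦 (s + 1), ((F s K K').card : ℝ) := by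
    have := (Finset.card_le_card hsub).trans (Finset.card_biUnion_le)
    have h2 := this.trans (Finset.sum_le_sum fun s _ => (Finset.card_biUnion_le).trans
      (Finset.sum_le_sum fun K _ => Finset.card_biUnion_le))
    exact_mod_cast h2
  refine h1.trans ?_
  have h2 : ∀ s, ∑ K ∈ 𝒦 s, ∑ K' ∈ 𝒦 (s + 1), ((F s K K').card : ℝ) ≤
      2 ^ Λ.card * Real.exp (-(1 / θ ^ 2)) * (1 / 2) * Real.exp (-(s : ℝ)) := by
    intro s
    have h3 : ∀ K K', ((F s K K').card : ℝ) ≤ 2 ^ Λ.card * Real.exp (-(1 / θ ^ 2)) * Real.exp (-3) * Real.exp (-(s : ℝ)) *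
        (Real.exp (-WW K) * Real.exp (-WW K')) := by
      intro K K'
      refine (tail_tt hβ hθ I Λ s K K').trans (le_of_eq ?_)
      have : Real.exp (-MM θ s K K') = Real.exp (-(1 / θ ^ 2)) * Real.exp (-3) * Real.exp (-(s : ℝ)) *
          (Real.exp (-WW K) * Real.exp (-WW K')) := by
        simp only [← Real.exp_add]; congr 1; unfold MM; ring
      rw [this]; ring
    have e3 : Real.exp (-3) ≤ 1 / 8 := by
      have : Real.exp (-3) = Real.exp (-1) ^ 3 := by rw [← Real.exp_nat_mul]; norm_num
      rw [this]
      calc _ ≤ (1 / 2 : ℝ) ^ 3 := pow_le_pow_left₀ (Real.exp_pos _).le exp_neg_one_le 3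
        _ = _ := by norm_num
    calc _ ≤ ∑ K ∈ 𝒦 s, ∑ K' ∈ 𝒦 (s + 1), 2 ^ Λ.card * Real.exp (-(1 / θ ^ 2)) * Real.exp (-3) * Real.exp (-(s : ℝ)) *
        (Real.exp (-WW K) * Real.exp (-WW K')) := Finset.sum_le_sum fun K _ => Finset.sum_le_sum fun K' _ => h3 K K'
      _ = 2 ^ Λ.card * Real.exp (-(1 / θ ^ 2)) * Real.exp (-3) * Real.exp (-(s : ℝ)) *
          ((∑ K ∈ 𝒦 s, Real.exp (-WW K)) * ∑ K' ∈ 𝒦 (s + 1), Real.exp (-WW K')) := by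
          rw [Finset.sum_mul_sum]; simp only [Finset.mul_sum]
      _ ≤ 2 ^ Λ.card * Real.exp (-(1 / θ ^ 2)) * (1 / 8) * Real.exp (-(s : ℝ)) * (2 * 2) := by
          have a1 := WW_sum (𝒦 s)
          have a2 := WW_sum (𝒦 (s + 1))
          have a0 : 0 ≤ ∑ K' ∈ 𝒦 (s + 1), Real.exp (-WW K') := Finset.sum_nonneg fun _ _ => (Real.exp_pos _).le
          gcongr
      _ = _ := by ring
  calc _ ≤ ∑ s ∈ Finset.range (2 * I.card), 2 ^ Λ.card * Real.exp (-(1 / θ ^ 2)) * (1 / 2) * Real.exp (-(s : ℝ)) :=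
        Finset.sum_le_sum fun s _ => h2 s
    _ = 2 ^ Λ.card * Real.exp (-(1 / θ ^ 2)) * (1 / 2) * ∑ s ∈ Finset.range (2 * I.card), Real.exp (-(s : ℝ)) := by
        rw [Finset.mul_sum]
    _ ≤ 2 ^ Λ.card * Real.exp (-(1 / θ ^ 2)) * (1 / 2) * 2 := by
        have := sum_exp_nat (2 * I.card)
        gcongr
    _ = _ := by ring

lemma good_LZ {J₁ α θ κ β : ℝ} (hJ : 1 ≤ J₁) (hα : 1 / 2 < α) (hα2 : α < 3 / 5) (hθ : 0 < θ) (hβ : 0 < β)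
    (hκ : κ = (2 * α - 1) / 2) (hsm : Real.sqrt (θ ^ 2 + J₁ ^ (-κ)) ≤ (1 - (2 : ℝ) ^ (-κ / 2)) ^ 2 / 8000)
    {I Λ D B : Finset ℤ} (hD : Good (en J₁ α) β θ I Λ D) (hB : B ∈ BB I) :
    LZ (en J₁ α) β θ I Λ (D ∆ B) ≤ LZ (en J₁ α) β θ I Λ D + β * (en J₁ α B / 4) := by
  obtain ⟨hBI, hirr, h0⟩ := Finset.mem_filter.1 hB
  have tel : ∀ S ≤ 2 * I.card, LZ (en J₁ α) β θ I Λ (D ∆ B) ≤ LZ (en J₁ α) β θ I Λ (D ∆ XS S B) +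
      β * ∑ s ∈ Finset.range S, tt θ s (cs s B) (cs (s + 1) B) := by
    intro S
    induction S with
    | zero => intro _; simp [XS_zero]
    | succ n ih =>
      intro hn
      have h1 := ih (by omega)
      have h2 := hD B hB n (by omega)
      rw [Finset.sum_range_succ, mul_add]
      linarith
  have h1 := tel _ le_rfl
  have hX : XS (2 * I.card) B = ∅ := by
    apply XS_empty
    have := Finset.card_le_card (Finset.mem_powerset.1 hBI)
    exact lt_of_le_of_lt (by omega) (Nat.lt_two_pow_self (n := 2 * I.card))
  have hDe : D ∆ (∅ : Finset ℤ) = D := symmDiff_bot D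
  rw [hX, hDe] at h1
  have h2 := mul_le_mul_of_nonneg_left (tt_sum hJ hα hα2 hθ hκ hsm hirr h0 (2 * I.card)) hβ.le
  linarith

lemma good_num {J₁ α θ κ β : ℝ} (hJ : 1 ≤ J₁) (hJ' : 16 * C0 ≤ ENNReal.ofReal J₁) (hα : 1 / 2 < α) (hα2 : α < 3 / 5) (hθ : 0 < θ)
    (hβ : 32000 ≤ β)
    (hκ : κ = (2 * α - 1) / 2) (hsm : Real.sqrt (θ ^ 2 + J₁ ^ (-κ)) ≤ (1 - (2 : ℝ) ^ (-κ / 2)) ^ 2 / 8000)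
    {p q : ℤ} {Λ D : Finset ℤ} (hD : Good (en J₁ α) β θ (Finset.Icc p q) Λ D) :
    ∑ A ∈ (Finset.Icc p q).powerset.filter (fun A => (0 : ℤ) ∈ A), wgt (en J₁ α) β θ Λ D A ≤
      ZZ (en J₁ α) β θ (Finset.Icc p q) Λ D * (2 * Real.exp (-(β * J₁ / 8))) := by
  set I := Finset.Icc p q with hI
  have hβ0 : 0 < β := by linarith
  have step1 : ∀ A ∈ I.powerset.filter (fun A => (0 : ℤ) ∈ A), wgt (en J₁ α) β θ Λ D A ≤
      ∑ B ∈ BB I, Real.exp (-(β * (en J₁ α B / 2))) * wgt (en J₁ α) β θ Λ (D ∆ B) (A ∆ B) := by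
    intro A hA
    obtain ⟨hAI, h0⟩ := Finset.mem_filter.1 hA
    obtain ⟨B, hirr, hB0, hBI, hen⟩ := contour (by linarith) hα2 hJ' h0 (Finset.mem_powerset.1 hAI)
    have hB : B ∈ BB I := Finset.mem_filter.2 ⟨Finset.mem_powerset.2 hBI, hirr, hB0⟩
    refine le_trans ?_ (Finset.single_le_sum (f := fun B => Real.exp (-(β * (en J₁ α B / 2))) * wgt (en J₁ α) β θ Λ (D ∆ B) (A ∆ B))
      (fun B _ => mul_nonneg (Real.exp_pos _).le (wgt_pos _ _ _ _ _ _).le) hB)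
    show _ ≤ Real.exp (-(β * (en J₁ α B / 2))) * wgt (en J₁ α) β θ Λ (D ∆ B) (A ∆ B)
    unfold wgt
    rw [ff_flip, ← Real.exp_add, Real.exp_le_exp]
    have := mul_le_mul_of_nonneg_left hen hβ0.le
    linarith
  have hZ : 0 < ZZ (en J₁ α) β θ I Λ D := ZZ_pos _ _ _ _ _ _
  calc _ ≤ ∑ A ∈ I.powerset.filter (fun A => (0 : ℤ) ∈ A),
        ∑ B ∈ BB I, Real.exp (-(β * (en J₁ α B / 2))) * wgt (en J₁ α) β θ Λ (D ∆ B) (A ∆ B) := Finset.sum_le_sum step1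
    _ ≤ ∑ A ∈ I.powerset,
        ∑ B ∈ BB I, Real.exp (-(β * (en J₁ α B / 2))) * wgt (en J₁ α) β θ Λ (D ∆ B) (A ∆ B) := by
        apply Finset.sum_le_sum_of_subset_of_nonneg (Finset.filter_subset _ _)
        intro A _ _
        exact Finset.sum_nonneg fun B _ => mul_nonneg (Real.exp_pos _).le (wgt_pos _ _ _ _ _ _).le
    _ = ∑ B ∈ BB I, Real.exp (-(β * (en J₁ α B / 2))) * ZZ (en J₁ α) β θ I Λ (D ∆ B) := by
        rw [Finset.sum_comm]
        refine Finset.sum_congr rfl fun B hB => ?_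
        rw [← Finset.mul_sum]
        congr 1
        exact sum_symm I B (Finset.mem_powerset.1 (Finset.mem_filter.1 hB).1) (fun A => wgt (en J₁ α) β θ Λ (D ∆ B) A)
    _ ≤ ∑ B ∈ BB I, ZZ (en J₁ α) β θ I Λ D * Real.exp (-(β * J₁ / 8)) * Real.exp (-WW (cs 0 B)) := by
        refine Finset.sum_le_sum fun B hB => ?_
        obtain ⟨hBI, hirr, h0⟩ := Finset.mem_filter.1 hB
        have hL := good_LZ hJ hα hα2 hθ hβ0 hκ hsm hD hB
        have hZB : ZZ (en J₁ α) β θ I Λ (D ∆ B) = Real.exp (LZ (en J₁ α) β θ I Λ (D ∆ B)) :=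
          (Real.exp_log (ZZ_pos _ _ _ _ _ _)).symm
        have hZD : ZZ (en J₁ α) β θ I Λ D = Real.exp (LZ (en J₁ α) β θ I Λ D) :=
          (Real.exp_log (ZZ_pos _ _ _ _ _ _)).symm
        rw [hZB, hZD, ← Real.exp_add, ← Real.exp_add, ← Real.exp_add, Real.exp_le_exp]
        have hW : WW (cs 0 B) ≤ 4000 * en J₁ α B := by
          have := WW_bound hJ hα hα2 hirr h0 0
          simpa using this
        have hJe : J₁ ≤ en J₁ α B := J_le_en (by linarith) hα2 h0
        have h1 := mul_le_mul_of_nonneg_left hJe hβ0.le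
        have h2 := mul_le_mul_of_nonneg_right hβ (en_nonneg J₁ α B)
        linarith
    _ = ZZ (en J₁ α) β θ I Λ D * Real.exp (-(β * J₁ / 8)) * ∑ K ∈ (BB I).image (cs 0), Real.exp (-WW K) := by
        rw [← Finset.mul_sum, Finset.sum_image]
        intro B _ B' _ h
        rw [← XS_zero B, ← XS_zero B']
        unfold XS
        rw [h]
    _ ≤ ZZ (en J₁ α) β θ I Λ D * Real.exp (-(β * J₁ / 8)) * 2 := by
        have := WW_sum ((BB I).image (cs 0))
        gcongr
    _ = _ := by ring

end LR

namespace LR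
open scoped symmDiff ENNReal

lemma en_submod {J₁ α : ℝ} (hα2 : α < 3 / 5) (a b : Finset ℤ) :
    en J₁ α (a ∩ b) + en J₁ α (a ∪ b) ≤ en J₁ α a + en J₁ α b := by
  unfold en
  have f := fun B => (En_lt_top (J₁ := J₁) hα2 B).ne
  rw [← ENNReal.toReal_add (f _) (f _), ← ENNReal.toReal_add (f _) (f _)]
  apply ENNReal.toReal_mono (ENNReal.add_ne_top.2 ⟨f _, f _⟩)
  unfold En ph
  simp only [← ENNReal.tsum_add]
  refine ENNReal.tsum_le_tsum fun i => ENNReal.tsum_le_tsum fun j => ?_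
  simp only [sep, Finset.mem_inter, Finset.mem_union]
  by_cases h1 : i ∈ a <;> by_cases h2 : j ∈ a <;> by_cases h3 : i ∈ b <;> by_cases h4 : j ∈ b <;>
    simp [h1, h2, h3, h4]

lemma ff_mod (Λ D a b : Finset ℤ) : ff Λ D (a ∩ b) + ff Λ D (a ∪ b) = ff Λ D a + ff Λ D b := by
  unfold ff
  rw [← Finset.sum_add_distrib, ← Finset.sum_add_distrib]
  refine Finset.sum_congr rfl fun i _ => ?_
  rw [← mul_add, ← mul_add]
  congr 1
  unfold sgn
  simp only [Finset.mem_inter, Finset.mem_union]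
  by_cases h1 : i ∈ a <;> by_cases h3 : i ∈ b <;> simp [h1, h3]

lemma fkg {J₁ α β θ : ℝ} (hα2 : α < 3 / 5) (hβ : 0 ≤ β) {I Λ : Finset ℤ} (hΛ : Λ ⊆ I) (D : Finset ℤ) :
    (∑ A ∈ Λ.powerset.filter (fun A => (0 : ℤ) ∈ A), wgt (en J₁ α) β θ Λ D A) * ZZ (en J₁ α) β θ I Λ D ≤
      (∑ A ∈ I.powerset.filter (fun A => (0 : ℤ) ∈ A), wgt (en J₁ α) β θ Λ D A) * ZZ (en J₁ α) β θ Λ Λ D := by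
  have hw : (0 : Finset ℤ → ℝ) ≤ wgt (en J₁ α) β θ Λ D := fun A => (wgt_pos _ _ _ _ _ _).le
  have key := Finset.four_functions_theorem (f₁ := wgt (en J₁ α) β θ Λ D) (f₂ := wgt (en J₁ α) β θ Λ D)
    (f₃ := wgt (en J₁ α) β θ Λ D) (f₄ := wgt (en J₁ α) β θ Λ D) I hw hw hw hw
    (by
      intro s _ t _
      unfold wgt
      rw [← Real.exp_add, ← Real.exp_add, Real.exp_le_exp]
      have h1 := mul_le_mul_of_nonneg_left (en_submod (J₁ := J₁) hα2 s t) hβ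
      have h2 := congrArg (fun x => β * θ * x) (ff_mod Λ D s t)
      simp only [mul_add] at h1 h2
      linarith)
    (𝒜 := Λ.powerset.filter (fun A => (0 : ℤ) ∈ A)) (ℬ := I.powerset)
    ((Finset.filter_subset _ _).trans (Finset.powerset_mono.2 hΛ)) (Finset.Subset.refl _)
  refine key.trans ?_
  rw [mul_comm]
  apply mul_le_mul
  · apply Finset.sum_le_sum_of_subset_of_nonneg
    · intro c hc
      obtain ⟨a, ha, b, hb, rfl⟩ := Finset.mem_sups.1 hc
      obtain ⟨ha, h0⟩ := Finset.mem_filter.1 ha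
      rw [Finset.mem_powerset] at ha hb
      exact Finset.mem_filter.2 ⟨Finset.mem_powerset.2 (Finset.union_subset (ha.trans hΛ) hb), Finset.mem_union_left _ h0⟩
    · exact fun _ _ _ => hw _
  · apply Finset.sum_le_sum_of_subset_of_nonneg
    · intro c hc
      obtain ⟨a, ha, b, hb, rfl⟩ := Finset.mem_infs.1 hc
      obtain ⟨ha, h0⟩ := Finset.mem_filter.1 ha
      rw [Finset.mem_powerset] at ha hb
      exact Finset.mem_powerset.2 (Finset.inter_subset_left.trans ha)
    · exact fun _ _ _ => hw _
  · exact Finset.sum_nonneg fun _ _ => hw _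
  · exact Finset.sum_nonneg fun _ _ => hw _

lemma Jcoup_nonneg {J₁ α : ℝ} (hJ : 0 ≤ J₁) (n : ℕ) : 0 ≤ Jcoup J₁ α n := by
  unfold Jcoup; split_ifs
  · exact hJ
  · positivity

lemma En_out (J₁ α : ℝ) (A : Finset ℤ) :
    En J₁ α A = 2 * ∑ i ∈ A, ∑' j : ℤ, if j ∈ A then 0 else Jn J₁ α i j := by
  have h : ∀ i j, (if sep A i j then Jn J₁ α i j else 0) =
      (if i ∈ A then (if j ∈ A then 0 else Jn J₁ α i j) else 0) +
      (if j ∈ A then (if i ∈ A then 0 else Jn J₁ α j i) else 0) := by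
    intro i j
    by_cases h1 : i ∈ A <;> by_cases h2 : j ∈ A <;> simp [sep, h1, h2, Jn_comm]
  unfold En ph
  simp only [h, ENNReal.tsum_add]
  rw [ENNReal.tsum_comm (f := fun i j => if j ∈ A then (if i ∈ A then 0 else Jn J₁ α j i) else 0), ← two_mul,
    ← tsum_ite_mem]
  congr 2; ext i
  by_cases hi : i ∈ A <;> simp [hi]

lemma en_real {J₁ α : ℝ} (hJ : 0 ≤ J₁) (hα2 : α < 3 / 5) {A Λ : Finset ℤ} (hA : A ⊆ Λ) :
    en J₁ α A = 2 * ∑ i ∈ A, (∑ j ∈ Λ, (if j ∈ A then 0 else Jcoup J₁ α (i - j).natAbs) +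
      ∑' j : ℤ, if j ∈ Λ then 0 else Jcoup J₁ α (i - j).natAbs) := by
  have hsplit : ∀ i, (∑' j : ℤ, if j ∈ A then 0 else Jn J₁ α i j) =
      (∑ j ∈ Λ, if j ∈ A then 0 else Jn J₁ α i j) + ∑' j : ℤ, if j ∈ Λ then 0 else Jn J₁ α i j := by
    intro i
    rw [← tsum_ite_mem, ← ENNReal.tsum_add]
    congr 1; ext j
    by_cases h1 : j ∈ A
    · simp [h1, hA h1]
    · by_cases h2 : j ∈ Λ <;> simp [h1, h2]
  have hE := En_lt_top (J₁ := J₁) hα2 A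
  have hO := En_out J₁ α A
  simp only [hsplit] at hO
  have hJr : ∀ i j, (Jn J₁ α i j).toReal = Jcoup J₁ α (i - j).natAbs := fun i j =>
    ENNReal.toReal_ofReal (Jcoup_nonneg hJ _)
  have hJt : ∀ i j, Jn J₁ α i j ≠ ⊤ := fun i j => ENNReal.ofReal_ne_top
  have hfin : ∀ i ∈ A, (∑ j ∈ Λ, (if j ∈ A then 0 else Jn J₁ α i j)) + (∑' j : ℤ, if j ∈ Λ then 0 else Jn J₁ α i j) ≠ ⊤ := by
    intro i hi htop
    have : En J₁ α A = ⊤ := by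
      rw [hO, ENNReal.sum_eq_top.2 ⟨i, hi, htop⟩]; simp
    exact hE.ne this
  unfold en
  rw [hO, ENNReal.toReal_mul, ENNReal.toReal_sum hfin]
  congr 1
  refine Finset.sum_congr rfl fun i hi => ?_
  obtain ⟨h1, h2⟩ := ENNReal.add_ne_top.1 (hfin i hi)
  rw [ENNReal.toReal_add h1 h2, ENNReal.toReal_sum, ENNReal.tsum_toReal_eq]
  · congr 1
    · refine Finset.sum_congr rfl fun j _ => ?_
      split_ifs
      · rfl
      · exact hJr i j
    · congr 1; ext j
      split_ifs
      · rfl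
      · exact hJr i j
  · intro j; split_ifs
    · simp
    · exact hJt i j
  · intro j _; split_ifs
    · simp
    · exact hJt i j

/-- minus set of a configuration -/
def ms (Λ : Finset ℤ) (σ : Λ → Bool) : Finset ℤ := Λ.filter (fun i => ∃ h : i ∈ Λ, σ ⟨i, h⟩ = false)

lemma mem_ms {Λ : Finset ℤ} {σ : Λ → Bool} (i : Λ) : (i : ℤ) ∈ ms Λ σ ↔ σ i = false := by
  unfold ms
  rw [Finset.mem_filter]
  constructor
  · rintro ⟨_, h, h'⟩; exact h'
  · intro h; exact ⟨i.2, i.2, h⟩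

lemma ms_sub (Λ : Finset ℤ) (σ : Λ → Bool) : ms Λ σ ⊆ Λ := Finset.filter_subset _ _

lemma spin_ms {Λ : Finset ℤ} (σ : Λ → Bool) (i : Λ) : spin (σ i) = sgn (ms Λ σ) i := by
  have h := mem_ms (σ := σ) i
  unfold spin sgn
  cases hs : σ i <;> simp_all

lemma sum_ms (Λ : Finset ℤ) (g : Finset ℤ → ℝ) : ∑ σ : Λ → Bool, g (ms Λ σ) = ∑ A ∈ Λ.powerset, g A := by
  refine Finset.sum_bij (fun σ _ => ms Λ σ) (fun σ _ => Finset.mem_powerset.2 (ms_sub Λ σ)) ?_ ?_ (fun _ _ => rfl)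
  · intro σ _ σ' _ h
    ext i
    have := mem_ms (σ := σ) i
    rw [h, mem_ms] at this
    cases h1 : σ i <;> cases h2 : σ' i <;> simp_all
  · intro A hA
    rw [Finset.mem_powerset] at hA
    refine ⟨fun i => decide ((i : ℤ) ∉ A), Finset.mem_univ _, ?_⟩
    ext i
    by_cases hi : i ∈ Λ
    · rw [mem_ms (Λ := Λ) ⟨i, hi⟩]; simp
    · exact ⟨fun h => (hi (ms_sub _ _ h)).elim, fun h => (hi (hA h)).elim⟩

lemma Ham_plus {J₁ α θ : ℝ} (hJ : 0 ≤ J₁) (hα2 : α < 3 / 5) {Λ : Finset ℤ} {h : ℤ → ℝ} {D : Finset ℤ}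
    (hD : ∀ i ∈ Λ, h i = sgn D i) (σ : Λ → Bool) :
    Ham J₁ α θ 1 Λ h σ = en J₁ α (ms Λ σ) - θ * ff Λ D (ms Λ σ) := by
  set A := ms Λ σ with hAdef
  have hA : A ⊆ Λ := ms_sub Λ σ
  have e1 : Ham J₁ α θ 1 Λ h σ = (1 / 2) * ∑ i ∈ Λ, ∑ j ∈ Λ, (if i = j then 0 else
      Jcoup J₁ α (i - j).natAbs * (1 - sgn A i * sgn A j))
      + ∑ i ∈ Λ, (∑' j : ℤ, if j ∈ Λ then 0 else Jcoup J₁ α (i - j).natAbs) * (1 - sgn A i)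
      - θ * ∑ i ∈ Λ, h i * sgn A i := by
    unfold Ham
    simp only [spin_ms, ← hAdef, one_mul]
    rw [← Finset.sum_coe_sort Λ (fun i => ∑ j ∈ Λ, (if i = j then 0 else
      Jcoup J₁ α (i - j).natAbs * (1 - sgn A i * sgn A j))),
      ← Finset.sum_coe_sort Λ (fun i => (∑' j : ℤ, if j ∈ Λ then 0 else Jcoup J₁ α (i - j).natAbs) * (1 - sgn A i)),
      ← Finset.sum_coe_sort Λ (fun i => h i * sgn A i)]
    congr 3
    refine Finset.sum_congr rfl fun i _ => ?_
    rw [← Finset.sum_coe_sort Λ (fun j => (if (i : ℤ) = j then 0 else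
      Jcoup J₁ α (i - j).natAbs * (1 - sgn A i * sgn A j)))]
    refine Finset.sum_congr rfl fun j _ => ?_
    simp only [Subtype.ext_iff]
  rw [e1, en_real hJ hα2 hA]
  have e2 : ∑ i ∈ Λ, h i * sgn A i = ff Λ D A := by
    unfold ff
    exact Finset.sum_congr rfl fun i hi => by rw [hD i hi]
  rw [e2]
  congr 1
  have e3 : ∑ i ∈ Λ, (∑' j : ℤ, if j ∈ Λ then 0 else Jcoup J₁ α (i - j).natAbs) * (1 - sgn A i) =
      2 * ∑ i ∈ A, ∑' j : ℤ, if j ∈ Λ then 0 else Jcoup J₁ α (i - j).natAbs := by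
    rw [Finset.mul_sum, ← Finset.sum_subset hA]
    · refine Finset.sum_congr rfl fun i hi => ?_
      have : sgn A i = -1 := by simp [sgn, hi]
      rw [this]; ring
    · intro i _ hi
      have : sgn A i = 1 := by simp [sgn, hi]
      rw [this]; ring
  set G := ∑ i ∈ Λ, ∑ j ∈ Λ, (if i ∈ A then (if j ∈ A then 0 else Jcoup J₁ α (i - j).natAbs) else 0) with hG
  have e4 : ∑ i ∈ Λ, ∑ j ∈ Λ, (if i = j then 0 else
      Jcoup J₁ α (i - j).natAbs * (1 - sgn A i * sgn A j)) = 4 * G := by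
    have hG2 : G = ∑ i ∈ Λ, ∑ j ∈ Λ, (if j ∈ A then (if i ∈ A then 0 else Jcoup J₁ α (j - i).natAbs) else 0) := by
      rw [Finset.sum_comm]
    have : 4 * G = 2 * G + 2 * G := by ring
    rw [this]
    nth_rw 2 [hG2]
    rw [hG]
    simp only [Finset.mul_sum, ← Finset.sum_add_distrib]
    refine Finset.sum_congr rfl fun i _ => Finset.sum_congr rfl fun j _ => ?_
    have hc : (j - i).natAbs = (i - j).natAbs := by rw [← Int.natAbs_neg, neg_sub]
    rw [hc]
    by_cases hij : i = j
    · subst hij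
      by_cases h1 : i ∈ A <;> simp [h1]
    · by_cases h1 : i ∈ A <;> by_cases h2 : j ∈ A <;> simp [h1, h2, hij, sgn] <;> ring
  have e5 : G = ∑ i ∈ A, ∑ j ∈ Λ, (if j ∈ A then 0 else Jcoup J₁ α (i - j).natAbs) := by
    rw [hG, ← Finset.sum_subset hA]
    · refine Finset.sum_congr rfl fun i hi => Finset.sum_congr rfl fun j _ => ?_
      rw [if_pos hi]
    · intro i _ hi
      exact Finset.sum_eq_zero fun j _ => if_neg hi
  rw [e3, e4, e5, Finset.sum_add_distrib]
  ring

lemma gibbs_plus {J₁ α θ β : ℝ} (hJ : 0 ≤ J₁) (hα2 : α < 3 / 5) {Λ : Finset ℤ} {h : ℤ → ℝ} {D : Finset ℤ}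
    (hD : ∀ i ∈ Λ, h i = sgn D i) (h0 : (0 : ℤ) ∈ Λ) :
    gibbs J₁ α θ 1 β Λ h (fun σ => spin (σ ⟨0, h0⟩) = 1) = 1 -
      (∑ A ∈ Λ.powerset.filter (fun A => (0 : ℤ) ∈ A), wgt (en J₁ α) β θ Λ D A) / ZZ (en J₁ α) β θ Λ Λ D := by
  have hw : ∀ σ, Real.exp (-β * Ham J₁ α θ 1 Λ h σ) = wgt (en J₁ α) β θ Λ D (ms Λ σ) := by
    intro σ; rw [Ham_plus hJ hα2 hD]; rfl
  have hs : ∀ σ : Λ → Bool, spin (σ ⟨0, h0⟩) = 1 ↔ (0 : ℤ) ∉ ms Λ σ := by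
    intro σ
    have := mem_ms (σ := σ) ⟨0, h0⟩
    simp only at this
    rw [this]
    unfold spin
    cases σ ⟨0, h0⟩ <;> norm_num
  unfold gibbs
  simp only [hw, hs]
  rw [sum_ms Λ (fun A => if (0 : ℤ) ∉ A then wgt (en J₁ α) β θ Λ D A else 0), sum_ms Λ (wgt (en J₁ α) β θ Λ D)]
  have hZ := ZZ_pos (en J₁ α) β θ Λ Λ D
  have hsp : ZZ (en J₁ α) β θ Λ Λ D = ∑ A ∈ Λ.powerset.filter (fun A => (0 : ℤ) ∈ A), wgt (en J₁ α) β θ Λ D A +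
      ∑ A ∈ Λ.powerset, (if (0 : ℤ) ∉ A then wgt (en J₁ α) β θ Λ D A else 0) := by
    rw [← Finset.sum_filter]
    exact (Finset.sum_filter_add_sum_filter_not _ _ _).symm
  have hZ' : ∑ A ∈ Λ.powerset, wgt (en J₁ α) β θ Λ D A = ZZ (en J₁ α) β θ Λ Λ D := rfl
  rw [hZ', eq_sub_iff_add_eq, ← add_div, add_comm, ← hsp]
  exact div_self hZ.ne'

lemma gibbs_minus {J₁ α θ β : ℝ} {Λ : Finset ℤ} {h : ℤ → ℝ} (h0 : (0 : ℤ) ∈ Λ) :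
    gibbs J₁ α θ (-1) β Λ h (fun σ => spin (σ ⟨0, h0⟩) = -1) =
    gibbs J₁ α θ 1 β Λ (fun i => - h i) (fun σ => spin (σ ⟨0, h0⟩) = 1) := by
  have hsp : ∀ b, spin (!b) = - spin b := by intro b; cases b <;> simp [spin]
  let ν : (Λ → Bool) ≃ (Λ → Bool) := Equiv.arrowCongr (Equiv.refl _) Equiv.boolNot
  have hν : ∀ σ i, ν σ i = !(σ i) := fun _ _ => rfl
  have hH : ∀ σ, Ham J₁ α θ (-1) Λ h σ = Ham J₁ α θ 1 Λ (fun i => - h i) (ν σ) := by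
    intro σ
    unfold Ham
    simp only [hν, hsp, neg_mul, one_mul, mul_neg, neg_neg]
  unfold gibbs
  simp only [hH]
  rw [← Equiv.sum_comp ν (fun σ => Real.exp (-β * Ham J₁ α θ 1 Λ (fun i => - h i) σ)),
    ← Equiv.sum_comp ν (fun σ => if spin (σ ⟨0, h0⟩) = 1 then Real.exp (-β * Ham J₁ α θ 1 Λ (fun i => - h i) σ) else 0)]
  simp only [hν, hsp, neg_eq_iff_eq_neg]

end LR

namespace LR
open scoped symmDiff ENNReal

lemma plus_good {J₁ α θ κ β : ℝ} (hJ : 1 ≤ J₁) (hJ' : 16 * C0 ≤ ENNReal.ofReal J₁) (hα : 1 / 2 < α) (hα2 : α < 3 / 5) (hθ : 0 < θ)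
    (hβ : 32000 ≤ β)
    (hκ : κ = (2 * α - 1) / 2) (hsm : Real.sqrt (θ ^ 2 + J₁ ^ (-κ)) ≤ (1 - (2 : ℝ) ^ (-κ / 2)) ^ 2 / 8000)
    {p q : ℤ} {Λ D : Finset ℤ} (hΛ : Λ ⊆ Finset.Icc p q) (hg : Good (en J₁ α) β θ (Finset.Icc p q) Λ D)
    {h : ℤ → ℝ} (hD : ∀ i ∈ Λ, h i = sgn D i) (h0 : (0 : ℤ) ∈ Λ) :
    1 - 2 * Real.exp (-(β * J₁ / 8)) ≤ gibbs J₁ α θ 1 β Λ h (fun σ => spin (σ ⟨0, h0⟩) = 1) := by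
  rw [gibbs_plus (by linarith) hα2 hD h0]
  have h1 := fkg (J₁ := J₁) (β := β) (θ := θ) hα2 (by linarith) hΛ D
  have h2 := good_num hJ hJ' hα hα2 hθ hβ hκ hsm hg
  have hZ := ZZ_pos (en J₁ α) β θ Λ Λ D
  have hZI := ZZ_pos (en J₁ α) β θ (Finset.Icc p q) Λ D
  have h3 := mul_le_mul_of_nonneg_right h2 hZ.le
  have h4 : (∑ A ∈ Λ.powerset.filter (fun A => (0 : ℤ) ∈ A), wgt (en J₁ α) β θ Λ D A) / ZZ (en J₁ α) β θ Λ Λ D ≤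
      2 * Real.exp (-(β * J₁ / 8)) := by
    rw [div_le_iff₀ hZ]
    refine le_of_mul_le_mul_right ?_ hZI
    linarith
  linarith

lemma alpha_bounds {α : ℝ} (hα₂ : α < Real.log 3 / Real.log 2 - 1) : α < 3 / 5 ∧ (2 : ℝ) ^ α < 3 / 2 := by
  have hl2 : 0 < Real.log 2 := Real.log_pos (by norm_num)
  have h1 : (α + 1) * Real.log 2 < Real.log 3 := by
    rw [← lt_div_iff₀ hl2]; linarith
  constructor
  · have h2 : 5 * Real.log 3 < 8 * Real.log 2 := by
      have e1 : 5 * Real.log 3 = Real.log (3 ^ 5) := by rw [Real.log_pow]; norm_num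
      have e2 : 8 * Real.log 2 = Real.log (2 ^ 8) := by rw [Real.log_pow]; norm_num
      rw [e1, e2]
      exact Real.log_lt_log (by norm_num) (by norm_num)
    by_contra hc
    push Not at hc
    nlinarith
  · have h3 : (2 : ℝ) ^ α = Real.exp (Real.log 2 * α) := Real.rpow_def_of_pos (by norm_num) α
    have h4 : (3 / 2 : ℝ) = Real.exp (Real.log 3 - Real.log 2) := by
      rw [Real.exp_sub, Real.exp_log (by norm_num), Real.exp_log (by norm_num)]
    rw [h3, h4, Real.exp_lt_exp]
    linarith

lemma field_count {Λ : Finset ℤ} {G : Finset ℤ → Prop} {f : (ℤ → ℝ) → ℝ} {δ : ℝ}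
    (hb : ((Λ.powerset.filter (fun D => ¬ G D)).card : ℝ) ≤ 2 ^ Λ.card * δ) (hf0 : ∀ h, 0 ≤ f h)
    (hf : ∀ (h : ℤ → ℝ) (D D' : Finset ℤ), (∀ i ∈ Λ, h i = sgn D i) → (∀ i ∈ Λ, - h i = sgn D' i) → G D → G D' → f h = 1) :
    1 - 2 * δ ≤ fieldE Λ f := by
  let ν : (Λ → Bool) ≃ (Λ → Bool) := Equiv.arrowCongr (Equiv.refl _) Equiv.boolNot
  have hν : ∀ σ i, ν σ i = !(σ i) := fun _ _ => rfl
  have hsp : ∀ b, spin (!b) = - spin b := by intro b; cases b <;> simp [spin]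
  have hcount : ∑ η : Λ → Bool, (if G (ms Λ η) then (0 : ℝ) else 1) = ((Λ.powerset.filter (fun D => ¬ G D)).card : ℝ) := by
    rw [sum_ms Λ (fun D => if G D then (0 : ℝ) else 1), Finset.card_filter]
    push_cast
    refine Finset.sum_congr rfl fun D _ => ?_
    by_cases h : G D <;> simp [h]
  have hcount2 : ∑ η : Λ → Bool, (if G (ms Λ (ν η)) then (0 : ℝ) else 1) = ((Λ.powerset.filter (fun D => ¬ G D)).card : ℝ) := by
    rw [← hcount]
    exact Equiv.sum_comp ν (fun η => if G (ms Λ η) then (0 : ℝ) else 1)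
  have hpt : ∀ η : Λ → Bool, 1 - (if G (ms Λ η) then (0 : ℝ) else 1) - (if G (ms Λ (ν η)) then (0 : ℝ) else 1) ≤
      f (fun i => if hi : i ∈ Λ then spin (η ⟨i, hi⟩) else 1) := by
    intro η
    set h : ℤ → ℝ := fun i => if hi : i ∈ Λ then spin (η ⟨i, hi⟩) else 1 with hh
    have := hf0 h
    by_cases h1 : G (ms Λ η)
    · by_cases h2 : G (ms Λ (ν η))
      · rw [hf h (ms Λ η) (ms Λ (ν η)) ?_ ?_ h1 h2]
        · simp [h1, h2]
        · intro i hi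
          have e : h i = spin (η ⟨i, hi⟩) := by rw [hh]; simp only [dif_pos hi]
          rw [e, spin_ms]
        · intro i hi
          have e : h i = spin (η ⟨i, hi⟩) := by rw [hh]; simp only [dif_pos hi]
          rw [e, ← hsp, ← hν, spin_ms]
      · rw [if_pos h1, if_neg h2]; linarith
    · rw [if_neg h1]; split_ifs <;> linarith
  have hsum := Finset.sum_le_sum (s := Finset.univ) (fun η _ => hpt η)
  rw [Finset.sum_sub_distrib, Finset.sum_sub_distrib, hcount, hcount2] at hsum
  have hc : ∑ _η : Λ → Bool, (1 : ℝ) = 2 ^ Λ.card := by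
    rw [Finset.sum_const, Finset.card_univ, Fintype.card_fun]; simp
  rw [hc] at hsum
  unfold fieldE
  have hp : (0 : ℝ) < 2 ^ Λ.card := by positivity
  rw [one_div, ← div_eq_inv_mul, le_div_iff₀ hp]
  refine le_trans ?_ hsum
  nlinarith

end LR

/-- **Quenched two-phase estimate.**  For `α ∈ (1/2, ln 3/ln 2 - 1)` and
`ζ = 1 - 2(2^α - 1) > 0`, there exist `θ₀(α) > 0`, `β₀(α) > 0` and a large enough value of
`J(1)` such that for all `0 < θ ≤ θ₀`, `β ≥ β₀` and every finite `Λ ∋ 0`, with probability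
at least `1 - 2e^{-b̄/200}` over the random field one has simultaneously
`μ⁺_Λ(σ₀ = +1) > 1 - e^{-b̄/200}` and `μ⁻_Λ(σ₀ = -1) > 1 - e^{-b̄/200}`,
where `b̄ = min(βζ/4, ζ²/(2¹⁰θ²))`. -/
theorem quenched_two_phases
    (α : ℝ) (hα₁ : 1 / 2 < α) (hα₂ : α < Real.log 3 / Real.log 2 - 1)
    (ζ : ℝ) (hζdef : ζ = 1 - 2 * ((2 : ℝ) ^ α - 1)) :
    0 < ζ ∧
    ∃ θ₀ > (0 : ℝ), ∃ β₀ > (0 : ℝ), ∃ J₁min : ℝ, ∀ J₁ : ℝ, J₁min ≤ J₁ →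
      ∀ θ : ℝ, 0 < θ → θ ≤ θ₀ → ∀ β : ℝ, β₀ ≤ β →
      ∀ Λ : Finset ℤ, ∀ h0 : (0 : ℤ) ∈ Λ,
        1 - 2 * Real.exp (-(min (β * ζ / 4) (ζ ^ 2 / (2 ^ 10 * θ ^ 2))) / 200)
          ≤ fieldE Λ (fun h =>
              if (1 - Real.exp (-(min (β * ζ / 4) (ζ ^ 2 / (2 ^ 10 * θ ^ 2))) / 200) <
                    gibbs J₁ α θ 1 β Λ h (fun σ => spin (σ ⟨0, h0⟩) = 1)) ∧
                 (1 - Real.exp (-(min (β * ζ / 4) (ζ ^ 2 / (2 ^ 10 * θ ^ 2))) / 200) <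
                    gibbs J₁ α θ (-1) β Λ h (fun σ => spin (σ ⟨0, h0⟩) = -1))
              then 1 else 0) := by
  obtain ⟨hα2, h2α⟩ := LR.alpha_bounds hα₂
  have hζ0 : 0 < ζ := by rw [hζdef]; linarith
  have hζ1 : ζ ≤ 1 := by
    have : (1 : ℝ) ≤ 2 ^ α := Real.one_le_rpow (by norm_num) (by linarith)
    rw [hζdef]; linarith
  refine ⟨hζ0, ?_⟩
  obtain ⟨κ, hκ⟩ : ∃ κ : ℝ, κ = (2 * α - 1) / 2 := ⟨_, rfl⟩
  have hκ0 : 0 < κ := by rw [hκ]; linarith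
  have hq1 : (2 : ℝ) ^ (-κ / 2) < 1 := Real.rpow_lt_one_of_one_lt_of_neg (by norm_num) (by linarith)
  obtain ⟨ε, hε⟩ : ∃ ε : ℝ, ε = (1 - (2 : ℝ) ^ (-κ / 2)) ^ 2 / 8000 := ⟨_, rfl⟩
  have hε0 : 0 < ε := by
    rw [hε]
    have : 0 < 1 - (2 : ℝ) ^ (-κ / 2) := by linarith
    positivity
  refine ⟨ε / 2, by positivity, 32000, by norm_num,
    max (max 16 (16 * LR.C0).toReal) ((2 / ε ^ 2) ^ (1 / κ)), ?_⟩
  intro J₁ hJm θ hθ hθ0 β hβ Λ h0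
  have hJ16 : 16 ≤ J₁ := ((le_max_left _ _).trans (le_max_left _ _)).trans hJm
  have hJC : (16 * LR.C0).toReal ≤ J₁ := ((le_max_right _ _).trans (le_max_left _ _)).trans hJm
  have hJk : (2 / ε ^ 2) ^ (1 / κ) ≤ J₁ := (le_max_right _ _).trans hJm
  have hJ' : 16 * LR.C0 ≤ ENNReal.ofReal J₁ := by
    have hne : 16 * LR.C0 ≠ ⊤ := ENNReal.mul_ne_top (by norm_num) LR.C0_lt.ne
    rw [← ENNReal.ofReal_toReal hne]
    exact ENNReal.ofReal_le_ofReal hJC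
  have hJ0 : 0 < J₁ := by linarith
  have hJpow : J₁ ^ (-κ) ≤ ε ^ 2 / 2 := by
    have h1 : 2 / ε ^ 2 ≤ J₁ ^ κ := by
      calc 2 / ε ^ 2 = ((2 / ε ^ 2) ^ (1 / κ)) ^ κ := by
            rw [← Real.rpow_mul (by positivity), one_div, inv_mul_cancel₀ hκ0.ne', Real.rpow_one]
        _ ≤ J₁ ^ κ := Real.rpow_le_rpow (by positivity) hJk hκ0.le
    rw [Real.rpow_neg hJ0.le]
    have h2 := inv_anti₀ (by positivity) h1
    rwa [inv_div] at h2
  have hsm : Real.sqrt (θ ^ 2 + J₁ ^ (-κ)) ≤ (1 - (2 : ℝ) ^ (-κ / 2)) ^ 2 / 8000 := by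
    rw [← hε]
    apply Real.sqrt_le_iff.2 ⟨hε0.le, ?_⟩
    nlinarith
  set b := min (β * ζ / 4) (ζ ^ 2 / (2 ^ 10 * θ ^ 2)) with hb
  have hb1 : b ≤ β / 4 := by
    have : b ≤ β * ζ / 4 := min_le_left _ _
    nlinarith
  have hb2 : b ≤ 1 / θ ^ 2 := by
    have h1 : b ≤ ζ ^ 2 / (2 ^ 10 * θ ^ 2) := min_le_right _ _
    have h2 : ζ ^ 2 / (2 ^ 10 * θ ^ 2) ≤ 1 / θ ^ 2 := by
      apply div_le_div₀ (by norm_num) (by nlinarith) (by positivity)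
      nlinarith [sq_nonneg θ]
    linarith
  have hb0 : 0 ≤ b := by
    apply le_min
    · have : 0 < β := by linarith
      positivity
    · positivity
  have hE1 : 2 * Real.exp (-(β * J₁ / 8)) < Real.exp (-b / 200) := by
    have h2 : (2 : ℝ) ≤ Real.exp 1 := by
      have := Real.add_one_le_exp (1 : ℝ)
      linarith
    calc 2 * Real.exp (-(β * J₁ / 8)) ≤ Real.exp 1 * Real.exp (-(β * J₁ / 8)) :=
          mul_le_mul_of_nonneg_right h2 (Real.exp_pos _).le
      _ = Real.exp (1 - β * J₁ / 8) := by rw [← Real.exp_add]; congr 1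
      _ < Real.exp (-b / 200) := by
          rw [Real.exp_lt_exp]
          nlinarith
  have hE2 : Real.exp (-(1 / θ ^ 2)) ≤ Real.exp (-b / 200) := by
    rw [Real.exp_le_exp]; linarith
  have hΛ : Λ ⊆ Finset.Icc (Λ.min' ⟨0, h0⟩) (Λ.max' ⟨0, h0⟩) := fun i hi =>
    Finset.mem_Icc.2 ⟨Finset.min'_le _ _ hi, Finset.le_max' _ _ hi⟩
  have hbad := LR.bad_card (e := LR.en J₁ α) (β := β) (by linarith) hθ (Finset.Icc (Λ.min' ⟨0, h0⟩) (Λ.max' ⟨0, h0⟩)) Λ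
  have hbad' : ((Λ.powerset.filter (fun D => ¬ LR.Good (LR.en J₁ α) β θ (Finset.Icc (Λ.min' ⟨0, h0⟩) (Λ.max' ⟨0, h0⟩)) Λ D)).card : ℝ) ≤
      2 ^ Λ.card * Real.exp (-b / 200) :=
    hbad.trans (mul_le_mul_of_nonneg_left hE2 (by positivity))
  refine LR.field_count hbad' (fun h => ?_) ?_
  · split_ifs <;> norm_num
  · intro h D D' hD hD' hg hg'
    apply if_pos
    constructor
    · have := LR.plus_good (by linarith) hJ' hα₁ hα2 hθ hβ hκ hsm hΛ hg hD h0
      linarith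
    · rw [LR.gibbs_minus h0]
      have := LR.plus_good (h := fun i => - h i) (by linarith) hJ' hα₁ hα2 hθ hβ hκ hsm hΛ hg' hD' h0
      linarith
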